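/- arXiv:1911.02164 — 3 statements merged into one kernel-verified Lean document; each statement's English description precedes it below -/
import Mathlib

section
/- Assume r ∈ [0,1] is fixed, α is strictly increasing on (a,b), β ∈ BV_loc((a,b),ℝ), and θ_{1−r}(x) ≠ 0 and θ_r(x) ≠ 0 for all x ∈ (a,b). If u and v are r-balanced solutions of −d(dy/dα) + y dβ = 0 on (a,b), then the measure generated by the Wronskian W[u,v] satisfies dW[u,v] = W^-[u,v] · ((1−2r)Δ_{dα}/θ_{1−r}) dβ = W^+[u,v] · ((1−2r)Δ_{dα}/θ_r) dβ. -/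
open Set Filter Function MeasureTheory Topology

noncomputable section

/-- The open interval `(a,b) ⊆ ℝ` determined by extended-real endpoints `a`, `b`. -/
def EI (a b : EReal) : Set ℝ := {x : ℝ | a < (x : EReal) ∧ (x : EReal) < b}

/-- The jump `Δ_{df}(x) = f⁺(x) - f⁻(x)` of a real-valued function. -/
def jump (f : ℝ → ℝ) (x : ℝ) : ℝ := rightLim f x - leftLim f x

/-- The jump `Δ_{df}(x) = f⁺(x) - f⁻(x)` of a complex-valued function. -/
def jumpC (f : ℝ → ℂ) (x : ℝ) : ℂ := rightLim f x - leftLim f x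

/-- `θ_z(x) = 1 - z² Δ_{dα}(x) Δ_{dβ}(x)`. -/
def theta (α β : ℝ → ℝ) (z x : ℝ) : ℝ := 1 - z ^ 2 * jump α x * jump β x

/-- `ω(x) = 1 - Δ_{dα}(x) Δ_{dβ}(x) / 4`. -/
def omegaFn (α β : ℝ → ℝ) (x : ℝ) : ℝ := 1 - jump α x * jump β x / 4

/-- A real-valued function is `r`-balanced on `I`: it is of locally bounded variation and
`f(x) = r f⁻(x) + (1-r) f⁺(x)` for all `x ∈ I`. -/
def RBalanced (r : ℝ) (I : Set ℝ) (f : ℝ → ℝ) : Prop :=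
  LocallyBoundedVariationOn f I ∧
    ∀ x ∈ I, f x = r * leftLim f x + (1 - r) * rightLim f x

/-- A complex-valued function is `r`-balanced on `I`. -/
def RBalancedC (r : ℂ) (I : Set ℝ) (f : ℝ → ℂ) : Prop :=
  LocallyBoundedVariationOn f I ∧
    ∀ x ∈ I, f x = r * leftLim f x + (1 - r) * rightLim f x

/-- `ν` coincides on `[c,d]` with the Lebesgue–Stieltjes measure `df` generated by `f`,
determined by `df((x,y]) = f⁺(y) - f⁺(x)`. -/
def SMRepresents (ν : SignedMeasure ℝ) (f : ℝ → ℝ) (c d : ℝ) : Prop :=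
  ∀ x ∈ Icc c d, ∀ y ∈ Icc c d, x ≤ y → ν (Ioc x y) = rightLim f y - rightLim f x

/-- The integral of `h` against the signed measure `ν` over the set `E`. -/
def sInt (ν : SignedMeasure ℝ) (h : ℝ → ℝ) (E : Set ℝ) : ℝ :=
  (∫ x in E, h x ∂ν.toJordanDecomposition.posPart) -
    (∫ x in E, h x ∂ν.toJordanDecomposition.negPart)

/-- The equality of (locally finite, real Borel) measures `dg = ∑ j, (h j) d(β j)` on the
interval `I`, expressed via localizations to compact subintervals of `I`. -/
def MeasureEqOn (I : Set ℝ) {ι : Type} [Fintype ι] (g : ℝ → ℝ) (h β : ι → ℝ → ℝ) : Prop :=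
  ∀ c ∈ I, ∀ d ∈ I, c < d →
    ∃ (νg : SignedMeasure ℝ) (ν : ι → SignedMeasure ℝ),
      SMRepresents νg g c d ∧ (∀ j, SMRepresents (ν j) (β j) c d) ∧
      ∀ E : Set ℝ, E ⊆ Ioc c d → MeasurableSet E → νg E = ∑ j, sInt (ν j) (h j) E

/-- The equality of complex measures `dg = ∑ j, (h j) d(β j)` on `I`, encoded via real and
imaginary parts. -/
def MeasureEqOnC (I : Set ℝ) {ι : Type} [Fintype ι] (g : ℝ → ℂ) (h β : ι → ℝ → ℂ) : Prop :=
  MeasureEqOn I (fun x => (g x).re)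
    (Sum.elim (fun j x => (h j x).re) (fun j x => -(h j x).im))
    (Sum.elim (fun j x => (β j x).re) (fun j x => (β j x).im)) ∧
  MeasureEqOn I (fun x => (g x).im)
    (Sum.elim (fun j x => (h j x).im) (fun j x => (h j x).re))
    (Sum.elim (fun j x => (β j x).re) (fun j x => (β j x).im))

/-- The support of `dα` is all of `I`: no open subinterval of `I` is `dα`-null, i.e. on no
open subinterval of `I` do all one-sided limits of `α` coincide with a single constant. -/
def SuppFull (I : Set ℝ) (α : ℝ → ℂ) : Prop :=
  ∀ x ∈ I, ∀ ε > (0 : ℝ), Icc (x - ε) (x + ε) ⊆ I →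
    ¬ (∀ p ∈ Ioo (x - ε) (x + ε), ∀ q ∈ Ioo (x - ε) (x + ε),
        rightLim α p = rightLim α q ∧ leftLim α p = rightLim α q)

/-- `u`, together with the representative `w` of `du/dα`, is an `r`-balanced solution of the
homogeneous equation `-d(du/dα) + u dβ = 0` on `I`: `u` and `w` are `r`-balanced,
`du = w dα` (so `du ≪ dα` with `du/dα = w`), and `dw = u dβ`. -/
def IsHomSol (I : Set ℝ) (r : ℝ) (α β u w : ℝ → ℝ) : Prop :=
  RBalanced r I u ∧ RBalanced r I w ∧
  MeasureEqOn I u (fun _ : Fin 1 => w) (fun _ => α) ∧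
  MeasureEqOn I w (fun _ : Fin 1 => u) (fun _ => β)

/-- `u`, together with the representative `w` of `du/dα`, is an `r`-balanced solution of
`-d(du/dα) + u dβ = dη` on `I` (complex-valued coefficients): `dw = u dβ - dη`. -/
def IsSolC (I : Set ℝ) (r : ℂ) (α β η u w : ℝ → ℂ) : Prop :=
  RBalancedC r I u ∧ RBalancedC r I w ∧
  MeasureEqOnC I u (fun _ : Fin 1 => w) (fun _ => α) ∧
  MeasureEqOnC I w ![u, fun _ => (-1 : ℂ)] ![β, η]

/-- `y` solves the linear system `dy = dφ · y + dψ` on `I`, componentwise: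
`d(y i) = ∑ j, (y j) d(φ i j) + dψ i`. -/
def IsSysSolC (I : Set ℝ) (n : ℕ) (φ : ℝ → Matrix (Fin n) (Fin n) ℂ)
    (ψ : ℝ → Fin n → ℂ) (y : ℝ → Fin n → ℂ) : Prop :=
  ∀ i : Fin n,
    MeasureEqOnC I (fun x => y x i)
      (Sum.elim (fun j : Fin n => fun x => y x j) (fun _ : Unit => fun _ => (1 : ℂ)))
      (Sum.elim (fun j : Fin n => fun x => φ x i j) (fun _ : Unit => fun x => ψ x i))

/-- `Z_I(f) = {x ∈ I : f⁻(x) f⁺(x) ≤ 0}`, the set of sign-changing points of `f` in `I`. -/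
def ZSet (f : ℝ → ℝ) (I : Set ℝ) : Set ℝ := {x ∈ I | leftLim f x * rightLim f x ≤ 0}

/-- `u` changes sign at `s ∈ I`. -/
def ChangesSignAt (I : Set ℝ) (u : ℝ → ℝ) (s : ℝ) : Prop :=
  ∃ δ > (0 : ℝ), Ioo (s - δ) (s + δ) ⊆ I ∧
    (((∀ x ∈ Ioo (s - δ) s, leftLim u x < 0) ∧ ∀ x ∈ Ioo s (s + δ), 0 < rightLim u x) ∨
     ((∀ x ∈ Ioo (s - δ) s, 0 < leftLim u x) ∧ ∀ x ∈ Ioo s (s + δ), rightLim u x < 0))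

/-- `u` changes sign in `J` (a subinterval of `I`). -/
def ChangesSignIn (I : Set ℝ) (u : ℝ → ℝ) (J : Set ℝ) : Prop :=
  ∃ s ∈ J, ChangesSignAt I u s

/-- `u` and `v` are linearly dependent on `I`. -/
def LinDepOn (I : Set ℝ) (u v : ℝ → ℝ) : Prop :=
  ∃ c₁ c₂ : ℝ, ¬(c₁ = 0 ∧ c₂ = 0) ∧ ∀ x ∈ I, c₁ * u x + c₂ * v x = 0

/-- The Lebesgue–Stieltjes measure `dg` is nonnegative on (Borel subsets of) `S`, expressed by
nonnegativity on all subintervals of `S` of each of the four kinds. -/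
def PosMeasureOn (g : ℝ → ℝ) (S : Set ℝ) : Prop :=
  (∀ x y : ℝ, x ≤ y → Icc x y ⊆ S → 0 ≤ rightLim g y - leftLim g x) ∧
  (∀ x y : ℝ, x ≤ y → Ico x y ⊆ S → 0 ≤ leftLim g y - leftLim g x) ∧
  (∀ x y : ℝ, x ≤ y → Ioc x y ⊆ S → 0 ≤ rightLim g y - rightLim g x) ∧
  (∀ x y : ℝ, x < y → Ioo x y ⊆ S → 0 ≤ leftLim g y - rightLim g x)

/-- The density of a signed measure with respect to a measure dominating its variation. -/
def MeasureTheory.SignedMeasure.density (ν : SignedMeasure ℝ) (ρ : Measure ℝ) (x : ℝ) : ℝ :=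
  (ν.toJordanDecomposition.posPart.rnDeriv ρ x).toReal -
    (ν.toJordanDecomposition.negPart.rnDeriv ρ x).toReal

theorem integrable_signedMeasure_density (ν : SignedMeasure ℝ) (ρ : Measure ℝ) :
    Integrable (SignedMeasure.density ν ρ) ρ :=
  Measure.integrable_toReal_rnDeriv.sub Measure.integrable_toReal_rnDeriv

theorem setIntegral_rnDeriv_mul {μ ρ : Measure ℝ} [IsFiniteMeasure μ] [IsFiniteMeasure ρ]
    (hμ : μ ≪ ρ) {h : ℝ → ℝ} {E : Set ℝ} (hE : MeasurableSet E) (hh : IntegrableOn h E μ) :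
    IntegrableOn (fun x => (μ.rnDeriv ρ x).toReal * h x) E ρ ∧
      ∫ x in E, (μ.rnDeriv ρ x).toReal * h x ∂ρ = ∫ x in E, h x ∂μ := by
  have key : (fun x => (μ.rnDeriv ρ x).toReal • E.indicator h x) =
      E.indicator (fun x => (μ.rnDeriv ρ x).toReal * h x) := by
    ext x
    by_cases hx : x ∈ E <;> simp [hx]
  constructor
  · rw [← integrable_indicator_iff hE, ← key, integrable_rnDeriv_smul_iff hμ,
      integrable_indicator_iff hE]
    exact hh
  · rw [← integral_indicator hE, ← integral_indicator hE, ← key, integral_rnDeriv_smul hμ]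

theorem sInt_eq_setIntegral_density {ν : SignedMeasure ℝ} {ρ : Measure ℝ} [IsFiniteMeasure ρ]
    (hν : ν.totalVariation ≪ ρ) {h : ℝ → ℝ} {E : Set ℝ} (hE : MeasurableSet E)
    (hh : ∀ μ : Measure ℝ, IsFiniteMeasure μ → IntegrableOn h E μ) :
    IntegrableOn (fun x => h x * SignedMeasure.density ν ρ x) E ρ ∧
      sInt ν h E = ∫ x in E, h x * SignedMeasure.density ν ρ x ∂ρ := by
  have hp : ν.toJordanDecomposition.posPart ≪ ρ :=
    (Measure.absolutelyContinuous_of_le (Measure.le_add_right le_rfl)).trans hν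
  have hn : ν.toJordanDecomposition.negPart ≪ ρ :=
    (Measure.absolutelyContinuous_of_le (Measure.le_add_left le_rfl)).trans hν
  obtain ⟨hp1, hp2⟩ := setIntegral_rnDeriv_mul hp hE (hh _ inferInstance)
  obtain ⟨hn1, hn2⟩ := setIntegral_rnDeriv_mul hn hE (hh _ inferInstance)
  have key : (fun x => h x * SignedMeasure.density ν ρ x) = fun x =>
      (ν.toJordanDecomposition.posPart.rnDeriv ρ x).toReal * h x -
        (ν.toJordanDecomposition.negPart.rnDeriv ρ x).toReal * h x := by
    ext x; simp only [SignedMeasure.density]; ring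
  refine ⟨key ▸ hp1.sub hn1, ?_⟩
  rw [key, integral_sub hp1 hn1, hp2, hn2, sInt]

theorem signedMeasure_apply_eq_setIntegral_density {ν : SignedMeasure ℝ} {ρ : Measure ℝ}
    [IsFiniteMeasure ρ] (hν : ν.totalVariation ≪ ρ) {E : Set ℝ} (hE : MeasurableSet E) :
    ν E = ∫ x in E, SignedMeasure.density ν ρ x ∂ρ := by
  have h := (sInt_eq_setIntegral_density hν hE (h := fun _ => 1)
    fun μ _ => integrable_const _).2
  simp only [one_mul] at h
  rw [← h, sInt]
  nth_rw 1 [← ν.toSignedMeasure_toJordanDecomposition]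
  simp [JordanDecomposition.toSignedMeasure, hE]

theorem ae_eq_of_setIntegral_Ioc_eq {ρ : Measure ℝ} {c d : ℝ} {p q : ℝ → ℝ}
    (hcd : c ≤ d) (hp : IntegrableOn p (Ioc c d) ρ) (hq : IntegrableOn q (Ioc c d) ρ)
    (h : ∀ x ∈ Icc c d, ∀ y ∈ Icc c d, x ≤ y →
      ∫ t in Ioc x y, p t ∂ρ = ∫ t in Ioc x y, q t ∂ρ) :
    p =ᵐ[ρ.restrict (Ioc c d)] q := by
  apply Integrable.ae_eq_of_withDensityᵥ_eq hp hq
  refine VectorMeasure.ext_of_generateFrom _ ?_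
    (borel_eq_generateFrom_Ioc ℝ ▸ BorelSpace.measurable_eq) (isPiSystem_Ioc id id) ?_
  · rintro _ ⟨l, u, -, rfl⟩
    rw [withDensityᵥ_apply hp measurableSet_Ioc, withDensityᵥ_apply hq measurableSet_Ioc,
      Measure.restrict_restrict measurableSet_Ioc, id, id, Ioc_inter_Ioc]
    rcases le_or_gt (l ⊔ c) (u ⊓ d) with hle | hlt
    · refine h _ ⟨le_sup_right, hle.trans inf_le_right⟩ _ ⟨?_, inf_le_right⟩ hle
      exact le_sup_right.trans hle
    · simp [Ioc_eq_empty hlt.not_gt]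
  · rw [withDensityᵥ_apply hp MeasurableSet.univ, withDensityᵥ_apply hq MeasurableSet.univ]
    simpa using h c (left_mem_Icc.2 hcd) d (right_mem_Icc.2 hcd) hcd

theorem integral_mul_integral_Ioc {ρ : Measure ℝ} [IsFiniteMeasure ρ] {x y : ℝ} {p q : ℝ → ℝ}
    (hp : IntegrableOn p (Ioc x y) ρ) (hq : IntegrableOn q (Ioc x y) ρ) :
    IntegrableOn (fun t => (∫ s in Ioo x t, p s ∂ρ) * q t) (Ioc x y) ρ ∧
    IntegrableOn (fun t => (∫ s in Ioc x t, q s ∂ρ) * p t) (Ioc x y) ρ ∧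
    (∫ t in Ioc x y, p t ∂ρ) * (∫ t in Ioc x y, q t ∂ρ) =
      (∫ t in Ioc x y, (∫ s in Ioo x t, p s ∂ρ) * q t ∂ρ) +
        ∫ t in Ioc x y, (∫ s in Ioc x t, q s ∂ρ) * p t ∂ρ := by
  set μ := ρ.restrict (Ioc x y) with hμ
  have hpq : Integrable (fun z : ℝ × ℝ => p z.1 * q z.2) (μ.prod μ) := hp.mul_prod hq
  have hD : MeasurableSet {z : ℝ × ℝ | z.1 < z.2} := measurableSet_lt measurable_fst measurable_snd
  have h1 := hpq.indicator hD
  have h2 := hpq.indicator hD.compl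
  have e1 : ∀ t ∈ Ioc x y, ∫ s, {z : ℝ × ℝ | z.1 < z.2}.indicator
      (fun z : ℝ × ℝ => p z.1 * q z.2) (s, t) ∂μ = (∫ s in Ioo x t, p s ∂ρ) * q t := by
    intro t ht
    have : (fun s => {z : ℝ × ℝ | z.1 < z.2}.indicator
        (fun z : ℝ × ℝ => p z.1 * q z.2) (s, t)) = (Iio t).indicator fun s => p s * q t := by
      ext s; simp [indicator_apply]
    rw [this, integral_indicator measurableSet_Iio, hμ,
      Measure.restrict_restrict measurableSet_Iio, integral_mul_const]
    congr 3
    grind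
  have e2 : ∀ s ∈ Ioc x y, ∫ t, {z : ℝ × ℝ | z.1 < z.2}ᶜ.indicator
      (fun z : ℝ × ℝ => p z.1 * q z.2) (s, t) ∂μ = (∫ t in Ioc x s, q t ∂ρ) * p s := by
    intro s hs
    have : (fun t => {z : ℝ × ℝ | z.1 < z.2}ᶜ.indicator
        (fun z : ℝ × ℝ => p z.1 * q z.2) (s, t)) = (Iic s).indicator fun t => q t * p s := by
      ext t; simp [indicator_apply, mul_comm]
    rw [this, integral_indicator measurableSet_Iic, hμ,
      Measure.restrict_restrict measurableSet_Iic, integral_mul_const]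
    congr 3
    grind
  refine ⟨?_, ?_, ?_⟩
  · refine h1.integral_prod_right.congr ?_
    filter_upwards [ae_restrict_mem measurableSet_Ioc] with t ht using e1 t ht
  · refine h2.integral_prod_left.congr ?_
    filter_upwards [ae_restrict_mem measurableSet_Ioc] with t ht using e2 t ht
  · rw [← setIntegral_congr_fun measurableSet_Ioc e1, ← setIntegral_congr_fun measurableSet_Ioc e2,
      ← integral_prod_symm _ h1, ← integral_prod _ h2, ← integral_add h1 h2,
      ← integral_prod_mul (L := ℝ)]
    congr 1
    ext z
    by_cases hz : z.1 < z.2 <;> simp [hz]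

theorem ordConnected_EI (a b : EReal) : (EI a b).OrdConnected :=
  ⟨fun _ hx _ hy _ hz => ⟨hx.1.trans_le (EReal.coe_le_coe_iff.2 hz.1),
    (EReal.coe_le_coe_iff.2 hz.2).trans_lt hy.2⟩⟩

theorem isOpen_EI (a b : EReal) : IsOpen (EI a b) :=
  (isOpen_lt continuous_const continuous_coe_real_ereal).inter
    (isOpen_lt continuous_coe_real_ereal continuous_const)

theorem exists_Ioo_of_mem_EI {a b : EReal} {x : ℝ} (hx : x ∈ EI a b) :
    ∃ l ∈ EI a b, ∃ m ∈ EI a b, l < x ∧ x < m := by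
  obtain ⟨ε, hε, h⟩ := Metric.isOpen_iff.1 (isOpen_EI a b) x hx
  refine ⟨x - ε / 2, h ?_, x + ε / 2, h ?_, by linarith, by linarith⟩ <;>
    simp [abs_of_pos hε, hε]

theorem LocallyBoundedVariationOn.tendsto_leftLim_EI {a b : EReal} {f : ℝ → ℝ}
    (hf : LocallyBoundedVariationOn f (EI a b)) {x : ℝ} (hx : x ∈ EI a b) :
    Tendsto f (𝓝[<] x) (𝓝 (leftLim f x)) := by
  obtain ⟨l, hl, -, -, hlx, -⟩ := exists_Ioo_of_mem_EI hx
  obtain ⟨y, hy⟩ := (hf l x hl hx).exists_tendsto_left x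
  refine tendsto_leftLim_of_tendsto ⟨y, hy.mono_left (nhdsWithin_le_of_mem ?_)⟩
  filter_upwards [Ioo_mem_nhdsLT hlx] with z hz
  exact ⟨⟨(ordConnected_EI a b).out hl hx ⟨hz.1.le, hz.2.le⟩, hz.1.le, hz.2.le⟩, hz.2⟩

theorem LocallyBoundedVariationOn.tendsto_rightLim_EI {a b : EReal} {f : ℝ → ℝ}
    (hf : LocallyBoundedVariationOn f (EI a b)) {x : ℝ} (hx : x ∈ EI a b) :
    Tendsto f (𝓝[>] x) (𝓝 (rightLim f x)) := by
  obtain ⟨-, -, m, hm, -, hxm⟩ := exists_Ioo_of_mem_EI hx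
  obtain ⟨y, hy⟩ := (hf x m hx hm).exists_tendsto_right x
  refine tendsto_rightLim_of_tendsto ⟨y, hy.mono_left (nhdsWithin_le_of_mem ?_)⟩
  filter_upwards [Ioo_mem_nhdsGT hxm] with z hz
  exact ⟨⟨(ordConnected_EI a b).out hx hm ⟨hz.1.le, hz.2.le⟩, hz.1.le, hz.2.le⟩, hz.1⟩

/-- Measurable up to a null set and bounded on `E`, for every Borel measure. -/
def MeasurableBoundedOn (f : ℝ → ℝ) (E : Set ℝ) : Prop :=
  (∀ μ : Measure ℝ, AEMeasurable f (μ.restrict E)) ∧ ∃ C, ∀ x ∈ E, |f x| ≤ C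

namespace MeasurableBoundedOn

variable {f g : ℝ → ℝ} {E F : Set ℝ}

theorem mono (hf : MeasurableBoundedOn f E) (h : F ⊆ E) : MeasurableBoundedOn f F :=
  ⟨fun μ => (hf.1 μ).mono_measure (Measure.restrict_mono h le_rfl),
    hf.2.imp fun _ hC x hx => hC x (h hx)⟩

theorem sub (hf : MeasurableBoundedOn f E) (hg : MeasurableBoundedOn g E) :
    MeasurableBoundedOn (fun x => f x - g x) E := by
  obtain ⟨C, hC⟩ := hf.2
  obtain ⟨D, hD⟩ := hg.2
  exact ⟨fun μ => (hf.1 μ).sub (hg.1 μ), C + D, fun x hx =>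
    (abs_sub _ _).trans (add_le_add (hC x hx) (hD x hx))⟩

theorem mul (hf : MeasurableBoundedOn f E) (hg : MeasurableBoundedOn g E) :
    MeasurableBoundedOn (fun x => f x * g x) E := by
  obtain ⟨C, hC⟩ := hf.2
  obtain ⟨D, hD⟩ := hg.2
  refine ⟨fun μ => (hf.1 μ).mul (hg.1 μ), C * D, fun x hx => ?_⟩
  rw [abs_mul]
  exact mul_le_mul (hC x hx) (hD x hx) (abs_nonneg _) ((abs_nonneg _).trans (hC x hx))

theorem const (c : ℝ) : MeasurableBoundedOn (fun _ => c) E :=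
  ⟨fun _ => aemeasurable_const, |c|, fun _ _ => le_rfl⟩

theorem integrableOn (hf : MeasurableBoundedOn f E) (hE : MeasurableSet E) (μ : Measure ℝ)
    [IsFiniteMeasure μ] : IntegrableOn f E μ := by
  obtain ⟨C, hC⟩ := hf.2
  exact Integrable.of_bound (hf.1 μ).aestronglyMeasurable C
    ((ae_restrict_mem hE).mono fun x hx => hC x hx)

theorem of_monotoneOn {c d : ℝ} (hf : MonotoneOn f (Icc c d)) :
    MeasurableBoundedOn f (Icc c d) := by
  refine ⟨fun μ => aemeasurable_restrict_of_monotoneOn measurableSet_Icc hf,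
    max |f c| |f d|, fun x hx => abs_le_max_abs_abs ?_ ?_⟩
  · exact hf (left_mem_Icc.2 (hx.1.trans hx.2)) hx hx.1
  · exact hf hx (right_mem_Icc.2 (hx.1.trans hx.2)) hx.2

theorem of_locallyBoundedVariationOn {c d : ℝ} (hf : LocallyBoundedVariationOn f (Icc c d)) :
    MeasurableBoundedOn f (Icc c d) := by
  obtain ⟨p, q, hp, hq, rfl⟩ := hf.exists_monotoneOn_sub_monotoneOn
  exact (of_monotoneOn hp).sub (of_monotoneOn hq)

end MeasurableBoundedOn

theorem MonotoneOn.rightLim_EI {a b : EReal} {f : ℝ → ℝ} (hf : MonotoneOn f (EI a b)) :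
    MonotoneOn (rightLim f) (EI a b) := by
  intro x hx y hy hxy
  rcases hxy.eq_or_lt with rfl | hxy
  · exact le_rfl
  obtain ⟨-, -, m, hm, -, hym⟩ := exists_Ioo_of_mem_EI hy
  have hle : rightLim f x ≤ f y := by
    refine le_of_tendsto (hf.locallyBoundedVariationOn.tendsto_rightLim_EI hx) ?_
    filter_upwards [Ioo_mem_nhdsGT hxy] with z hz
    exact hf ((ordConnected_EI a b).out hx hy ⟨hz.1.le, hz.2.le⟩) hy hz.2.le
  refine hle.trans (ge_of_tendsto (hf.locallyBoundedVariationOn.tendsto_rightLim_EI hy) ?_)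
  filter_upwards [Ioo_mem_nhdsGT hym] with z hz
  exact hf hy ((ordConnected_EI a b).out hy hm ⟨hz.1.le, hz.2.le⟩) hz.1.le

theorem MonotoneOn.leftLim_EI {a b : EReal} {f : ℝ → ℝ} (hf : MonotoneOn f (EI a b)) :
    MonotoneOn (leftLim f) (EI a b) := by
  intro x hx y hy hxy
  rcases hxy.eq_or_lt with rfl | hxy
  · exact le_rfl
  obtain ⟨l, hl, -, -, hlx, -⟩ := exists_Ioo_of_mem_EI hx
  have hle : f x ≤ leftLim f y := by
    refine ge_of_tendsto (hf.locallyBoundedVariationOn.tendsto_leftLim_EI hy) ?_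
    filter_upwards [Ioo_mem_nhdsLT hxy] with z hz
    exact hf hx ((ordConnected_EI a b).out hx hy ⟨hz.1.le, hz.2.le⟩) hz.1.le
  refine (le_of_tendsto (hf.locallyBoundedVariationOn.tendsto_leftLim_EI hx) ?_).trans hle
  filter_upwards [Ioo_mem_nhdsLT hlx] with z hz
  exact hf ((ordConnected_EI a b).out hl hx ⟨hz.1.le, hz.2.le⟩) hx hz.2.le

/-- On `(c,d]`, the Lebesgue–Stieltjes measure generated by `f` is `f' dρ`. -/
structure HasDensityOn (ρ : Measure ℝ) (f f' : ℝ → ℝ) (c d : ℝ) : Prop where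
  integrableOn : IntegrableOn f' (Ioc c d) ρ
  rightLim_sub : ∀ x ∈ Icc c d, ∀ y ∈ Icc c d, x ≤ y →
    rightLim f y - rightLim f x = ∫ t in Ioc x y, f' t ∂ρ
  tendsto_left : ∀ t ∈ Ioc c d, Tendsto f (𝓝[<] t) (𝓝 (leftLim f t))

namespace HasDensityOn

variable {ρ : Measure ℝ} {f f' g g' : ℝ → ℝ} {c d : ℝ}

theorem congr_ae (hf : HasDensityOn ρ f f' c d) (h : f' =ᵐ[ρ.restrict (Ioc c d)] g') :
    HasDensityOn ρ f g' c d := by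
  refine ⟨hf.integrableOn.congr h, fun x hx y hy hxy => ?_, hf.tendsto_left⟩
  rw [hf.rightLim_sub x hx y hy hxy]
  exact integral_congr_ae
    (ae_mono (Measure.restrict_mono (Ioc_subset_Ioc hx.1 hy.2) le_rfl) h)

theorem leftLim_eq (hf : HasDensityOn ρ f f' c d) {x t : ℝ} (hx : c ≤ x) (hxt : x < t)
    (htd : t ≤ d) : leftLim f t = rightLim f x + ∫ s in Ioo x t, f' s ∂ρ := by
  have hI : IntegrableOn f' (Ioc x t) ρ := hf.integrableOn.mono_set (Ioc_subset_Ioc hx htd)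
  have h1 : Tendsto (rightLim f) (𝓝[<] t) (𝓝 (leftLim f t)) := by
    have hlim := hf.tendsto_left t ⟨hx.trans_lt hxt, htd⟩
    rw [(closed_nhds_basis (leftLim f t)).tendsto_right_iff]
    intro V hV
    have hev := hlim.eventually hV.1
    obtain ⟨l, hl, hlt⟩ := (mem_nhdsLT_iff_exists_Ioo_subset).1 hev
    filter_upwards [Ioo_mem_nhdsLT hl] with s hs
    have hcl := mapClusterPt_rightLim f s
    refine hV.2.mem_of_mapClusterPt hcl ?_
    filter_upwards [Ico_mem_nhdsGE hs.2] with z hz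
    exact hlt ⟨hs.1.trans_le hz.1, hz.2⟩
  have h2 : Tendsto (rightLim f) (𝓝[<] t)
      (𝓝 (rightLim f x + ∫ s in Ioo x t, f' s ∂ρ)) := by
    have h3 : Tendsto (fun z => ∫ s, (Iic z).indicator f' s ∂ρ.restrict (Ioc x t)) (𝓝[<] t)
        (𝓝 (∫ s, (Iio t).indicator f' s ∂ρ.restrict (Ioc x t))) := by
      refine tendsto_integral_filter_of_dominated_convergence (fun s => ‖f' s‖)
        (Eventually.of_forall fun z => hI.aestronglyMeasurable.indicator measurableSet_Iic)
        (Eventually.of_forall fun z => Eventually.of_forall fun s =>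
          norm_indicator_le_norm_self _ _) hI.norm
        (Eventually.of_forall fun s => tendsto_const_nhds.congr' ?_)
      by_cases hs : s < t
      · filter_upwards [Ioo_mem_nhdsLT hs] with z hz
        simp [hs, hz.1.le]
      · filter_upwards [self_mem_nhdsWithin] with z hz
        have : ¬ s ≤ z := fun h => hs (h.trans_lt hz)
        simp [hs, this]
    rw [integral_indicator measurableSet_Iio, Measure.restrict_restrict measurableSet_Iio,
      show Iio t ∩ Ioc x t = Ioo x t by grind] at h3
    refine (tendsto_const_nhds.add h3).congr' ?_
    filter_upwards [Ioo_mem_nhdsLT hxt] with z hz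
    rw [integral_indicator measurableSet_Iic, Measure.restrict_restrict measurableSet_Iic,
      show Iic z ∩ Ioc x t = Ioc x z by grind,
      ← hf.rightLim_sub x ⟨hx, hxt.le.trans htd⟩ z ⟨hx.trans hz.1.le, hz.2.le.trans htd⟩ hz.1.le]
    ring
  exact tendsto_nhds_unique h1 h2

theorem jump_eq (hf : HasDensityOn ρ f f' c d) {t : ℝ} (ht : t ∈ Ioc c d) :
    rightLim f t = leftLim f t + f' t * ρ.real {t} := by
  have hcd := ht.1.le.trans ht.2
  have h := hf.rightLim_sub c (left_mem_Icc.2 hcd) t ⟨ht.1.le, ht.2⟩ ht.1.le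
  rw [← Ioo_union_right ht.1, setIntegral_union (by simp) (measurableSet_singleton t)
    (hf.integrableOn.mono_set fun s hs => ⟨hs.1, hs.2.le.trans ht.2⟩)
    (hf.integrableOn.mono_set (by simpa using ht)), integral_singleton, smul_eq_mul] at h
  rw [hf.leftLim_eq le_rfl ht.1 ht.2]
  linarith

theorem rightLim_mul_sub (hf : HasDensityOn ρ f f' c d) (hg : HasDensityOn ρ g g' c d)
    [IsFiniteMeasure ρ] {x y : ℝ} (hx : c ≤ x) (hxy : x ≤ y) (hy : y ≤ d) :
    IntegrableOn (fun t => leftLim f t * g' t + rightLim g t * f' t) (Ioc x y) ρ ∧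
    rightLim f y * rightLim g y - rightLim f x * rightLim g x =
      ∫ t in Ioc x y, (leftLim f t * g' t + rightLim g t * f' t) ∂ρ := by
  have hp := hf.integrableOn.mono_set (Ioc_subset_Ioc hx hy)
  have hq := hg.integrableOn.mono_set (Ioc_subset_Ioc hx hy)
  obtain ⟨h1, h2, h3⟩ := integral_mul_integral_Ioc hp hq
  have hxm : x ∈ Icc c d := ⟨hx, hxy.trans hy⟩
  have hym : y ∈ Icc c d := ⟨hx.trans hxy, hy⟩
  have key : EqOn (fun t => leftLim f t * g' t + rightLim g t * f' t)
      (fun t => (rightLim f x * g' t + rightLim g x * f' t) +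
        ((∫ s in Ioo x t, f' s ∂ρ) * g' t + (∫ s in Ioc x t, g' s ∂ρ) * f' t)) (Ioc x y) := by
    intro t ht
    have e1 := hf.leftLim_eq hx ht.1 (ht.2.trans hy)
    have e2 := hg.rightLim_sub x hxm t ⟨hx.trans ht.1.le, ht.2.trans hy⟩ ht.1.le
    simp only [e1, ← e2]
    ring
  have i1 : IntegrableOn (fun t => rightLim f x * g' t + rightLim g x * f' t) (Ioc x y) ρ :=
    (hq.const_mul _).add (hp.const_mul _)
  have i2 : IntegrableOn (fun t => (∫ s in Ioo x t, f' s ∂ρ) * g' t +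
      (∫ s in Ioc x t, g' s ∂ρ) * f' t) (Ioc x y) ρ := h1.add h2
  refine ⟨(integrableOn_congr_fun key measurableSet_Ioc).2 (i1.add i2), ?_⟩
  rw [setIntegral_congr_fun measurableSet_Ioc key, integral_add i1 i2, integral_add h1 h2,
    integral_add (hq.const_mul _) (hp.const_mul _), ← h3, integral_const_mul, integral_const_mul,
    ← hf.rightLim_sub x hxm y hym hxy, ← hg.rightLim_sub x hxm y hym hxy]
  ring

end HasDensityOn

theorem SMRepresents.hasDensityOn {ρ : Measure ℝ} [IsFiniteMeasure ρ] {ν : SignedMeasure ℝ}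
    {f : ℝ → ℝ} {c d : ℝ} (hf : SMRepresents ν f c d) (hν : ν.totalVariation ≪ ρ)
    (ht : ∀ t ∈ Ioc c d, Tendsto f (𝓝[<] t) (𝓝 (leftLim f t))) :
    HasDensityOn ρ f (SignedMeasure.density ν ρ) c d :=
  ⟨(integrable_signedMeasure_density ν ρ).integrableOn, fun x hx y hy hxy => by
    rw [← hf x hx y hy hxy, signedMeasure_apply_eq_setIntegral_density hν measurableSet_Ioc], ht⟩

theorem SMRepresents.hasDensityOn_mul {ρ : Measure ℝ} [IsFiniteMeasure ρ]
    {νf ν : SignedMeasure ℝ} {f h : ℝ → ℝ} {c d : ℝ} (hf : SMRepresents νf f c d)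
    (hν : ν.totalVariation ≪ ρ) (hh : MeasurableBoundedOn h (Ioc c d))
    (hE : ∀ E : Set ℝ, E ⊆ Ioc c d → MeasurableSet E → νf E = sInt ν h E)
    (ht : ∀ t ∈ Ioc c d, Tendsto f (𝓝[<] t) (𝓝 (leftLim f t))) :
    HasDensityOn ρ f (fun t => h t * SignedMeasure.density ν ρ t) c d := by
  refine ⟨(sInt_eq_setIntegral_density hν measurableSet_Ioc fun μ _ =>
    hh.integrableOn measurableSet_Ioc μ).1, fun x hx y hy hxy => ?_, ht⟩
  have hsub := Ioc_subset_Ioc hx.1 hy.2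
  rw [← hf x hx y hy hxy, hE _ hsub measurableSet_Ioc]
  exact (sInt_eq_setIntegral_density hν measurableSet_Ioc fun μ _ =>
    (hh.mono hsub).integrableOn measurableSet_Ioc μ).2

theorem sInt_congr {ν : SignedMeasure ℝ} {h k : ℝ → ℝ} {E : Set ℝ} (hE : MeasurableSet E)
    (hk : EqOn h k E) : sInt ν h E = sInt ν k E := by
  rw [sInt, sInt, setIntegral_congr_fun hE hk, setIntegral_congr_fun hE hk]

theorem HasDensityOn.ae_eq {ρ : Measure ℝ} {f p q : ℝ → ℝ} {c d : ℝ} (hcd : c ≤ d)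
    (hp : HasDensityOn ρ f p c d) (hq : HasDensityOn ρ f q c d) :
    p =ᵐ[ρ.restrict (Ioc c d)] q :=
  ae_eq_of_setIntegral_Ioc_eq hcd hp.integrableOn hq.integrableOn fun x hx y hy hxy => by
    rw [← hp.rightLim_sub x hx y hy hxy, hq.rightLim_sub x hx y hy hxy]

/-- The jump relations for the Wronskian and its density with respect to a dominating measure,
when `α` and `β` have the densities `A` and `B`. -/
theorem wronskian_of_hasDensityOn {ρ : Measure ℝ} [IsFiniteMeasure ρ]
    {r c d : ℝ} {α β u wu v wv A B : ℝ → ℝ}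
    (hα : HasDensityOn ρ α A c d) (hβ : HasDensityOn ρ β B c d)
    (hu : HasDensityOn ρ u (fun t => wu t * A t) c d)
    (hwu : HasDensityOn ρ wu (fun t => u t * B t) c d)
    (hv : HasDensityOn ρ v (fun t => wv t * A t) c d)
    (hwv : HasDensityOn ρ wv (fun t => v t * B t) c d)
    (bu : ∀ t ∈ Ioc c d, u t = r * leftLim u t + (1 - r) * rightLim u t)
    (bwu : ∀ t ∈ Ioc c d, wu t = r * leftLim wu t + (1 - r) * rightLim wu t)
    (bv : ∀ t ∈ Ioc c d, v t = r * leftLim v t + (1 - r) * rightLim v t)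
    (bwv : ∀ t ∈ Ioc c d, wv t = r * leftLim wv t + (1 - r) * rightLim wv t) :
    (∀ t ∈ Ioc c d,
      leftLim u t * leftLim wv t - leftLim v t * leftLim wu t =
        (u t * wv t - v t * wu t) * theta α β (1 - r) t ∧
      rightLim u t * rightLim wv t - rightLim v t * rightLim wu t =
        (u t * wv t - v t * wu t) * theta α β r t) ∧
    ∀ x y, c ≤ x → x ≤ y → y ≤ d →
      (rightLim u y * rightLim wv y - rightLim v y * rightLim wu y) -
        (rightLim u x * rightLim wv x - rightLim v x * rightLim wu x) =
      ∫ t in Ioc x y, ((1 - 2 * r) * jump α t * (u t * wv t - v t * wu t)) * B t ∂ρ := by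
  have hleft : ∀ {f f' : ℝ → ℝ}, HasDensityOn ρ f f' c d →
      (∀ t ∈ Ioc c d, f t = r * leftLim f t + (1 - r) * rightLim f t) → ∀ t ∈ Ioc c d,
      leftLim f t = f t - (1 - r) * (f' t * ρ.real {t}) ∧
        rightLim f t = f t + r * (f' t * ρ.real {t}) := by
    intro f f' hf hb t ht
    have h1 := hf.jump_eq ht
    have h2 := hb t ht
    rw [h1] at h2 ⊢
    constructor <;> linear_combination -h2
  have jα : ∀ t ∈ Ioc c d, jump α t = A t * ρ.real {t} := fun t ht => by
    rw [jump, hα.jump_eq ht]; ring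
  have jβ : ∀ t ∈ Ioc c d, jump β t = B t * ρ.real {t} := fun t ht => by
    rw [jump, hβ.jump_eq ht]; ring
  refine ⟨fun t ht => ?_, fun x y hx hxy hy => ?_⟩
  · obtain ⟨u1, u2⟩ := hleft hu bu t ht
    obtain ⟨wu1, wu2⟩ := hleft hwu bwu t ht
    obtain ⟨v1, v2⟩ := hleft hv bv t ht
    obtain ⟨wv1, wv2⟩ := hleft hwv bwv t ht
    rw [u1, u2, wu1, wu2, v1, v2, wv1, wv2, theta, theta, jα t ht, jβ t ht]
    constructor <;> ring
  · obtain ⟨i1, e1⟩ := hu.rightLim_mul_sub hwv hx hxy hy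
    obtain ⟨i2, e2⟩ := hv.rightLim_mul_sub hwu hx hxy hy
    rw [sub_sub_sub_comm, e1, e2, ← integral_sub i1 i2]
    refine setIntegral_congr_fun measurableSet_Ioc fun t ht => ?_
    have ht : t ∈ Ioc c d := Ioc_subset_Ioc hx hy ht
    obtain ⟨u1, -⟩ := hleft hu bu t ht
    obtain ⟨-, wu2⟩ := hleft hwu bwu t ht
    obtain ⟨v1, -⟩ := hleft hv bv t ht
    obtain ⟨-, wv2⟩ := hleft hwv bwv t ht
    simp only [u1, v1, wu2, wv2, jα t ht]
    ring

theorem IsHomSol.measureEqOn_wronskian {a b : EReal} {r : ℝ} {α β u wu v wv : ℝ → ℝ}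
    (hα : MonotoneOn α (EI a b)) (hβ : LocallyBoundedVariationOn β (EI a b))
    (hu : IsHomSol (EI a b) r α β u wu) (hv : IsHomSol (EI a b) r α β v wv) :
    MeasureEqOn (EI a b) (fun x => u x * wv x - v x * wu x)
      (fun _ : Fin 1 => fun x => (1 - 2 * r) * jump α x * (u x * wv x - v x * wu x))
      (fun _ => β) ∧
    ∀ x ∈ EI a b,
      leftLim (fun z => u z * wv z - v z * wu z) x =
        (u x * wv x - v x * wu x) * theta α β (1 - r) x ∧
      rightLim (fun z => u z * wv z - v z * wu z) x =
        (u x * wv x - v x * wu x) * theta α β r x := by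
  obtain ⟨⟨Vu, bu⟩, ⟨Vwu, bwu⟩, hu1, hu2⟩ := hu
  obtain ⟨⟨Vv, bv⟩, ⟨Vwv, bwv⟩, hv1, hv2⟩ := hv
  have hleft : ∀ x ∈ EI a b, leftLim (fun z => u z * wv z - v z * wu z) x =
      leftLim u x * leftLim wv x - leftLim v x * leftLim wu x := fun x hx =>
    leftLim_eq_of_tendsto (((Vu.tendsto_leftLim_EI hx).mul (Vwv.tendsto_leftLim_EI hx)).sub
      ((Vv.tendsto_leftLim_EI hx).mul (Vwu.tendsto_leftLim_EI hx)))
  have hright : ∀ x ∈ EI a b, rightLim (fun z => u z * wv z - v z * wu z) x =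
      rightLim u x * rightLim wv x - rightLim v x * rightLim wu x := fun x hx =>
    rightLim_eq_of_tendsto (((Vu.tendsto_rightLim_EI hx).mul (Vwv.tendsto_rightLim_EI hx)).sub
      ((Vv.tendsto_rightLim_EI hx).mul (Vwu.tendsto_rightLim_EI hx)))
  have main : ∀ c ∈ EI a b, ∀ d ∈ EI a b, c < d →
      (∃ νW ν : SignedMeasure ℝ, SMRepresents νW (fun x => u x * wv x - v x * wu x) c d ∧
        SMRepresents ν β c d ∧ ∀ E : Set ℝ, E ⊆ Ioc c d → MeasurableSet E →
          νW E = sInt ν (fun x => (1 - 2 * r) * jump α x * (u x * wv x - v x * wu x)) E) ∧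
      ∀ t ∈ Ioc c d,
        leftLim u t * leftLim wv t - leftLim v t * leftLim wu t =
          (u t * wv t - v t * wu t) * theta α β (1 - r) t ∧
        rightLim u t * rightLim wv t - rightLim v t * rightLim wu t =
          (u t * wv t - v t * wu t) * theta α β r t := by
    intro c hc d hd hcd
    have hI : Icc c d ⊆ EI a b := (ordConnected_EI a b).out hc hd
    have hIoc : Ioc c d ⊆ EI a b := Ioc_subset_Icc_self.trans hI
    have hlim {f : ℝ → ℝ} (hf : LocallyBoundedVariationOn f (EI a b)) :
        ∀ t ∈ Ioc c d, Tendsto f (𝓝[<] t) (𝓝 (leftLim f t)) :=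
      fun t ht => hf.tendsto_leftLim_EI (hIoc ht)
    have hmb {f : ℝ → ℝ} (hf : LocallyBoundedVariationOn f (EI a b)) :
        MeasurableBoundedOn f (Ioc c d) :=
      (MeasurableBoundedOn.of_locallyBoundedVariationOn fun x y hx hy =>
        (hf x y (hI hx) (hI hy)).mono (inter_subset_inter_left _ hI)).mono Ioc_subset_Icc_self
    obtain ⟨νu, να, ru, rα, eu⟩ := hu1 c hc d hd hcd
    obtain ⟨νwu, νβ, rwu, rβ, ewu⟩ := hu2 c hc d hd hcd
    obtain ⟨νv, να', rv, rα', ev⟩ := hv1 c hc d hd hcd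
    obtain ⟨νwv, νβ', rwv, rβ', ewv⟩ := hv2 c hc d hd hcd
    simp only [Fin.sum_univ_one] at eu ewu ev ewv
    set ρ : Measure ℝ := (να 0).totalVariation + (νβ 0).totalVariation +
      ((να' 0).totalVariation + (νβ' 0).totalVariation)
    have a1 : (να 0).totalVariation ≪ ρ := Measure.absolutelyContinuous_of_le
      (Measure.le_add_right (Measure.le_add_right le_rfl))
    have a2 : (νβ 0).totalVariation ≪ ρ := Measure.absolutelyContinuous_of_le
      (Measure.le_add_right (Measure.le_add_left le_rfl))
    have a3 : (να' 0).totalVariation ≪ ρ := Measure.absolutelyContinuous_of_le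
      (Measure.le_add_left (Measure.le_add_right le_rfl))
    have a4 : (νβ' 0).totalVariation ≪ ρ := Measure.absolutelyContinuous_of_le
      (Measure.le_add_left (Measure.le_add_left le_rfl))
    have Vα := hα.locallyBoundedVariationOn
    have dα := (rα 0).hasDensityOn a1 (hlim Vα)
    have dβ := (rβ 0).hasDensityOn a2 (hlim hβ)
    have eα := ((rα' 0).hasDensityOn a3 (hlim Vα)).ae_eq hcd.le dα
    have eβ := ((rβ' 0).hasDensityOn a4 (hlim hβ)).ae_eq hcd.le dβ
    have du := ru.hasDensityOn_mul a1 (hmb Vwu) eu (hlim Vu)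
    have dwu := rwu.hasDensityOn_mul a2 (hmb Vu) ewu (hlim Vwu)
    have dv := (rv.hasDensityOn_mul a3 (hmb Vwv) ev (hlim Vv)).congr_ae
      (eα.mono fun t (ht : _ = _) => congrArg (wv t * ·) ht)
    have dwv := (rwv.hasDensityOn_mul a4 (hmb Vv) ewv (hlim Vwv)).congr_ae
      (eβ.mono fun t (ht : _ = _) => congrArg (v t * ·) ht)
    obtain ⟨hjump, hW⟩ := wronskian_of_hasDensityOn dα dβ du dwu dv dwv
      (fun t ht => bu t (hIoc ht)) (fun t ht => bwu t (hIoc ht))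
      (fun t ht => bv t (hIoc ht)) (fun t ht => bwv t (hIoc ht))
    refine ⟨?_, hjump⟩
    have mh : MeasurableBoundedOn
        (fun x => (1 - 2 * r) * jump α x * (u x * wv x - v x * wu x)) (Ioc c d) :=
      (((MeasurableBoundedOn.const _).mul
        ((MeasurableBoundedOn.of_monotoneOn (hα.rightLim_EI.mono hI)).sub
          (MeasurableBoundedOn.of_monotoneOn (hα.leftLim_EI.mono hI)))).mono
            Ioc_subset_Icc_self).mul
        (((hmb Vu).mul (hmb Vwv)).sub ((hmb Vv).mul (hmb Vwu)))
    have hs {E : Set ℝ} (hE : E ⊆ Ioc c d) (hm : MeasurableSet E) :=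
      sInt_eq_setIntegral_density a2 hm fun μ _ => (mh.mono hE).integrableOn hm μ
    have hint := (hs subset_rfl measurableSet_Ioc).1
    have happ : ∀ E : Set ℝ, E ⊆ Ioc c d → MeasurableSet E →
        (ρ.restrict (Ioc c d)).withDensityᵥ (fun x => ((1 - 2 * r) * jump α x *
          (u x * wv x - v x * wu x)) * SignedMeasure.density (νβ 0) ρ x) E =
        ∫ x in E, ((1 - 2 * r) * jump α x * (u x * wv x - v x * wu x)) *
          SignedMeasure.density (νβ 0) ρ x ∂ρ := fun E hE hm => by
      rw [withDensityᵥ_apply hint hm, Measure.restrict_restrict hm, inter_eq_left.2 hE]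
    refine ⟨_, νβ 0, fun x hx y hy hxy => ?_, rβ 0, fun E hE hm =>
      (happ E hE hm).trans (hs hE hm).2.symm⟩
    rw [happ _ (Ioc_subset_Ioc hx.1 hy.2) measurableSet_Ioc, hright x (hI hx), hright y (hI hy),
      hW x y hx.1 hxy hy.2]
  refine ⟨fun c hc d hd hcd => ?_, fun x hx => ?_⟩
  · obtain ⟨νW, ν, h1, h2, h3⟩ := (main c hc d hd hcd).1
    exact ⟨νW, fun _ => ν, h1, fun _ => h2, fun E hE hm => by simpa using h3 E hE hm⟩
  · obtain ⟨l, hl, -, -, hlx, -⟩ := exists_Ioo_of_mem_EI hx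
    rw [hleft x hx, hright x hx]
    exact (main l hl x hx hlx).2 x ⟨hlx, le_rfl⟩

theorem MeasureEqOn.congr {I : Set ℝ} (hI : I.OrdConnected) {ι : Type} [Fintype ι] {g : ℝ → ℝ}
    {h k β : ι → ℝ → ℝ} (hg : MeasureEqOn I g h β) (hk : ∀ j, EqOn (h j) (k j) I) :
    MeasureEqOn I g k β := by
  intro c hc d hd hcd
  obtain ⟨νg, ν, h1, h2, h3⟩ := hg c hc d hd hcd
  refine ⟨νg, ν, h1, h2, fun E hE hm => (h3 E hE hm).trans (Finset.sum_congr rfl fun j _ => ?_)⟩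
  exact sInt_congr hm ((hk j).mono (hE.trans (Ioc_subset_Icc_self.trans (hI.out hc hd))))

/-- Theorem 5.1: the Wronskian `W[u,v] = u (dv/dα) - v (du/dα)` of two
`r`-balanced solutions satisfies
`dW[u,v] = W⁻[u,v] (1-2r)Δ_{dα}/θ_{1-r} dβ = W⁺[u,v] (1-2r)Δ_{dα}/θ_r dβ`. -/
theorem statement11 (a b : EReal) (hab : a < b) (r : ℝ) (hr : r ∈ Icc (0 : ℝ) 1)
    (α β : ℝ → ℝ) (hα : StrictMonoOn α (EI a b))
    (hβ : LocallyBoundedVariationOn β (EI a b))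
    (hθ : ∀ x ∈ EI a b, theta α β (1 - r) x ≠ 0 ∧ theta α β r x ≠ 0)
    (u wu v wv : ℝ → ℝ)
    (hu : IsHomSol (EI a b) r α β u wu) (hv : IsHomSol (EI a b) r α β v wv) :
    MeasureEqOn (EI a b) (fun x => u x * wv x - v x * wu x)
      (fun _ : Fin 1 => fun x =>
        leftLim (fun z => u z * wv z - v z * wu z) x *
          ((1 - 2 * r) * jump α x / theta α β (1 - r) x))
      (fun _ => β) ∧
    MeasureEqOn (EI a b) (fun x => u x * wv x - v x * wu x)
      (fun _ : Fin 1 => fun x =>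
        rightLim (fun z => u z * wv z - v z * wu z) x *
          ((1 - 2 * r) * jump α x / theta α β r x))
      (fun _ => β) := by
  obtain ⟨hW, hlim⟩ := hu.measureEqOn_wronskian hα.monotoneOn hβ hv
  refine ⟨hW.congr (ordConnected_EI a b) fun _ x hx => ?_,
    hW.congr (ordConnected_EI a b) fun _ x hx => ?_⟩
  · have := (hθ x hx).1
    simp only [(hlim x hx).1]
    field_simp
  · have := (hθ x hx).2
    simp only [(hlim x hx).2]
    field_simp
end
end

section
/- (Sturm Separation Theorem I) Assume r ∈ [0,1] is fixed, α is strictly increasing on (a,b), β ∈ BV_loc((a,b),ℝ), and θ_{1−r}(x) ≠ 0 and θ_r(x) ≠ 0 for all x ∈ (a,b). Let u and v be linearly independent real-valued r-balanced solutions of −d(dy/dα) + y dβ = 0 on (a,b), and let s < t be consecutive points of Z_{(a,b)}(u) with θ > 0 on (s,t). Then: (1) if u^+(s) = u^-(t) = 0, then v changes sign in (s,t); (2) if u^-(s) = u^-(t) = 0 and θ_r(s) > 0, then v changes sign in [s,t); (3) if u^+(s) = u^+(t) = 0 and θ_{1−r}(t) > 0, then v changes sign in (s,t]; (4) if u^-(s)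 = u^+(t) = 0 and θ_r(s) θ_{1−r}(t) > 0, then v changes sign in [s,t]. -/
open Set Filter Function MeasureTheory Topology

noncomputable section

/-- `f` has one-sided limits at every point of `I` and is integrable on compact subintervals
of `I` with respect to every finite measure. -/
structure RegulatedOn (I : Set ℝ) (f : ℝ → ℝ) : Prop where
  left : ∀ p ∈ I, Tendsto f (𝓝[<] p) (𝓝 (leftLim f p))
  right : ∀ p ∈ I, Tendsto f (𝓝[>] p) (𝓝 (rightLim f p))
  integrableOn : ∀ c ∈ I, ∀ d ∈ I, ∀ (μ : Measure ℝ) [IsFiniteMeasure μ],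
    IntegrableOn f (Icc c d) μ

theorem MonotoneOn.regulatedOn {I : Set ℝ} (ho : IsOpen I) (hc : I.OrdConnected) {f : ℝ → ℝ}
    (hf : MonotoneOn f I) : RegulatedOn I f := by
  refine ⟨fun p hp ↦ ?_, fun p hp ↦ ?_, fun c hc' d hd μ _ ↦ ?_⟩
  · apply tendsto_leftLim_of_tendsto
    obtain ⟨q, hqp, hq⟩ := (mem_nhdsLE_iff_exists_Ioc_subset' (sub_one_lt p)).1
      (mem_nhdsWithin_of_mem_nhds (ho.mem_nhds hp) : I ∈ 𝓝[≤] p)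
    refine ⟨_, MonotoneOn.tendsto_nhdsWithin_Ioo_left (y := q) (nonempty_Ioo.2 hqp)
      (hf.mono (Ioo_subset_Ioc_self.trans hq)) ⟨f p, ?_⟩⟩
    rintro _ ⟨x, hx, rfl⟩
    exact hf (hq ⟨hx.1, hx.2.le⟩) hp hx.2.le
  · apply tendsto_rightLim_of_tendsto
    obtain ⟨q, hqp, hq⟩ := (mem_nhdsGE_iff_exists_Ico_subset' (lt_add_one p)).1
      (mem_nhdsWithin_of_mem_nhds (ho.mem_nhds hp) : I ∈ 𝓝[≥] p)
    refine ⟨_, MonotoneOn.tendsto_nhdsWithin_Ioo_right (y := q) (nonempty_Ioo.2 hqp)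
      (hf.mono (Ioo_subset_Ico_self.trans hq)) ⟨f p, ?_⟩⟩
    rintro _ ⟨x, hx, rfl⟩
    exact hf hp (hq ⟨hx.1.le, hx.2⟩) hx.1.le
  · have hsub := hc.out hc' hd
    have := (hf.mono hsub).integrableOn_isCompact (μ := μ) isCompact_Icc
    exact this

theorem RegulatedOn.add {I : Set ℝ} {f g : ℝ → ℝ} (hf : RegulatedOn I f) (hg : RegulatedOn I g)
    (c₁ c₂ : ℝ) : RegulatedOn I (fun x ↦ c₁ * f x + c₂ * g x) :=
  ⟨fun p hp ↦ tendsto_leftLim_of_tendsto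
      ⟨_, ((hf.left p hp).const_mul c₁).add ((hg.left p hp).const_mul c₂)⟩,
    fun p hp ↦ tendsto_rightLim_of_tendsto
      ⟨_, ((hf.right p hp).const_mul c₁).add ((hg.right p hp).const_mul c₂)⟩,
    fun c hc d hd μ _ ↦
      ((hf.integrableOn c hc d hd μ).const_mul c₁).add
        ((hg.integrableOn c hc d hd μ).const_mul c₂)⟩

theorem RegulatedOn.leftLim_add {I : Set ℝ} {f g : ℝ → ℝ} (hf : RegulatedOn I f)
    (hg : RegulatedOn I g) (c₁ c₂ : ℝ) {p : ℝ} (hp : p ∈ I) :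
    leftLim (fun x ↦ c₁ * f x + c₂ * g x) p = c₁ * leftLim f p + c₂ * leftLim g p :=
  leftLim_eq_of_tendsto (((hf.left p hp).const_mul c₁).add ((hg.left p hp).const_mul c₂))

theorem RegulatedOn.rightLim_add {I : Set ℝ} {f g : ℝ → ℝ} (hf : RegulatedOn I f)
    (hg : RegulatedOn I g) (c₁ c₂ : ℝ) {p : ℝ} (hp : p ∈ I) :
    rightLim (fun x ↦ c₁ * f x + c₂ * g x) p = c₁ * rightLim f p + c₂ * rightLim g p :=
  rightLim_eq_of_tendsto (((hf.right p hp).const_mul c₁).add ((hg.right p hp).const_mul c₂))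

theorem LocallyBoundedVariationOn.regulatedOn {I : Set ℝ} (ho : IsOpen I) (hc : I.OrdConnected)
    {f : ℝ → ℝ} (hf : LocallyBoundedVariationOn f I) : RegulatedOn I f := by
  obtain ⟨p, q, hp, hq, rfl⟩ := hf.exists_monotoneOn_sub_monotoneOn
  have := (hp.regulatedOn ho hc).add (hq.regulatedOn ho hc) 1 (-1)
  have e : p - q = fun x ↦ 1 * p x + (-1) * q x := by
    ext x; simp [sub_eq_add_neg]
  rwa [e]

theorem tendsto_rightLim_nhdsLT {f : ℝ → ℝ} {a l : ℝ} (h : Tendsto f (𝓝[<] a) (𝓝 l)) :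
    Tendsto (rightLim f) (𝓝[<] a) (𝓝 l) := by
  apply (closed_nhds_basis l).tendsto_right_iff.2
  rintro s ⟨s_mem, s_closed⟩
  obtain ⟨u, au, hu⟩ : ∃ u, u < a ∧ Ioo u a ⊆ {x | f x ∈ s} := by
    have := (closed_nhds_basis l).tendsto_right_iff.1 h s ⟨s_mem, s_closed⟩
    simpa using (mem_nhdsLT_iff_exists_Ioo_subset' (sub_one_lt a)).1 this
  filter_upwards [Ioo_mem_nhdsLT au] with c hc
  by_cases! h''c : ¬ ∃ y, Tendsto f (𝓝[>] c) (𝓝 y)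
  · simpa [rightLim_eq_of_not_tendsto _ h''c] using hu hc
  apply s_closed.mem_of_tendsto (tendsto_rightLim_of_tendsto h''c)
  filter_upwards [Ioo_mem_nhdsGT_of_mem ⟨hc.1.le, hc.2⟩] with d hd using hu hd

theorem tendsto_leftLim_nhdsGT {f : ℝ → ℝ} {a l : ℝ} (h : Tendsto f (𝓝[>] a) (𝓝 l)) :
    Tendsto (leftLim f) (𝓝[>] a) (𝓝 l) := by
  apply (closed_nhds_basis l).tendsto_right_iff.2
  rintro s ⟨s_mem, s_closed⟩
  obtain ⟨u, au, hu⟩ : ∃ u, a < u ∧ Ioo a u ⊆ {x | f x ∈ s} := by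
    have := (closed_nhds_basis l).tendsto_right_iff.1 h s ⟨s_mem, s_closed⟩
    simpa using (mem_nhdsGT_iff_exists_Ioo_subset' (lt_add_one a)).1 this
  filter_upwards [Ioo_mem_nhdsGT au] with c hc
  by_cases! h''c : ¬ ∃ y, Tendsto f (𝓝[<] c) (𝓝 y)
  · simpa [leftLim_eq_of_not_tendsto _ h''c] using hu hc
  apply s_closed.mem_of_tendsto (tendsto_leftLim_of_tendsto h''c)
  filter_upwards [Ioo_mem_nhdsLT_of_mem ⟨hc.1, hc.2.le⟩] with d hd using hu hd

section RegulatedOn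

variable {I : Set ℝ} {f : ℝ → ℝ}

theorem RegulatedOn.leftLim_left (hf : RegulatedOn I f) {p : ℝ} (hp : p ∈ I) :
    Tendsto (leftLim f) (𝓝[<] p) (𝓝 (leftLim f p)) :=
  (continuousWithinAt_leftLim_Iic (hf.left p hp)).mono_left (nhdsWithin_mono _ Iio_subset_Iic_self)

theorem RegulatedOn.rightLim_left (hf : RegulatedOn I f) {p : ℝ} (hp : p ∈ I) :
    Tendsto (rightLim f) (𝓝[<] p) (𝓝 (leftLim f p)) :=
  tendsto_rightLim_nhdsLT (hf.left p hp)

theorem RegulatedOn.leftLim_right (hf : RegulatedOn I f) {p : ℝ} (hp : p ∈ I) :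
    Tendsto (leftLim f) (𝓝[>] p) (𝓝 (rightLim f p)) :=
  tendsto_leftLim_nhdsGT (hf.right p hp)

theorem RegulatedOn.rightLim_right (hf : RegulatedOn I f) {p : ℝ} (hp : p ∈ I) :
    Tendsto (rightLim f) (𝓝[>] p) (𝓝 (rightLim f p)) :=
  (continuousWithinAt_rightLim_Ici (hf.right p hp)).mono_left
    (nhdsWithin_mono _ Ioi_subset_Ici_self)

end RegulatedOn

/-- The difference `P - N` of finite measures is the Lebesgue–Stieltjes measure of `f`
on `(c, d]`. -/
def MeasRepr (P N : Measure ℝ) (f : ℝ → ℝ) (c d : ℝ) : Prop :=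
  ∀ x ∈ Icc c d, ∀ y ∈ Icc c d, x ≤ y →
    P.real (Ioc x y) - N.real (Ioc x y) = rightLim f y - rightLim f x

theorem SMRepresents.measRepr {ν : SignedMeasure ℝ} {f : ℝ → ℝ} {c d : ℝ}
    (h : SMRepresents ν f c d) :
    MeasRepr ν.toJordanDecomposition.posPart ν.toJordanDecomposition.negPart f c d := by
  intro x hx y hy hxy
  rw [← h x hx y hy hxy]
  conv_rhs => rw [← ν.toSignedMeasure_toJordanDecomposition]
  rw [JordanDecomposition.toSignedMeasure, Measure.toSignedMeasure_sub_apply measurableSet_Ioc]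

theorem MeasRepr.add_restrict_eq {P N P' N' : Measure ℝ} [IsFiniteMeasure P] [IsFiniteMeasure N]
    [IsFiniteMeasure P'] [IsFiniteMeasure N'] {f : ℝ → ℝ} {c d : ℝ}
    (h : MeasRepr P N f c d) (h' : MeasRepr P' N' f c d) :
    (P + N').restrict (Ioc c d) = (P' + N).restrict (Ioc c d) := by
  apply Measure.ext_of_Ioc
  intro x y hxy
  rw [Measure.restrict_apply measurableSet_Ioc, Measure.restrict_apply measurableSet_Ioc,
    Ioc_inter_Ioc]
  rcases le_or_gt (y ⊓ d) (x ⊔ c) with hle | hlt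
  · simp [Ioc_eq_empty_of_le hle]
  have hx : x ⊔ c ∈ Icc c d := ⟨le_sup_right, hlt.le.trans inf_le_right⟩
  have hy : y ⊓ d ∈ Icc c d := ⟨le_sup_right.trans hlt.le, inf_le_right⟩
  rw [← measureReal_eq_measureReal_iff, measureReal_add_apply, measureReal_add_apply]
  linarith [h _ hx _ hy hlt.le, h' _ hx _ hy hlt.le]

theorem MeasRepr.integral_eq {P N P' N' : Measure ℝ} [IsFiniteMeasure P] [IsFiniteMeasure N]
    [IsFiniteMeasure P'] [IsFiniteMeasure N'] {f g : ℝ → ℝ} {c d : ℝ}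
    (h : MeasRepr P N f c d) (h' : MeasRepr P' N' f c d)
    (hg : ∀ (μ : Measure ℝ) [IsFiniteMeasure μ], IntegrableOn g (Icc c d) μ)
    {E : Set ℝ} (hE : E ⊆ Ioc c d) :
    (∫ x in E, g x ∂P) - (∫ x in E, g x ∂N) = (∫ x in E, g x ∂P') - (∫ x in E, g x ∂N') := by
  have hres : (P + N').restrict E = (P' + N).restrict E := by
    have := congrArg (fun μ ↦ Measure.restrict μ E) (h.add_restrict_eq h')
    simpa only [Measure.restrict_restrict_of_subset hE] using this
  have hi : ∀ (μ : Measure ℝ) [IsFiniteMeasure μ], Integrable g (μ.restrict E) :=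
    fun μ _ ↦ (hg μ).mono_set (hE.trans Ioc_subset_Icc_self)
  have := congrArg (fun μ ↦ ∫ x, g x ∂μ) hres
  simp only [Measure.restrict_add] at this
  rw [integral_add_measure (hi P) (hi N'), integral_add_measure (hi P') (hi N)] at this
  linarith

/-- The integrated form of `dg = w df` on `I`. -/
def IntegralEqOn (I : Set ℝ) (g w f : ℝ → ℝ) : Prop :=
  ∀ c ∈ I, ∀ d ∈ I, c < d → ∀ (P N : Measure ℝ) [IsFiniteMeasure P] [IsFiniteMeasure N],
    MeasRepr P N f c d → ∀ x ∈ Icc c d, ∀ y ∈ Icc c d, x ≤ y →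
      rightLim g y - rightLim g x = (∫ z in Ioc x y, w z ∂P) - ∫ z in Ioc x y, w z ∂N

theorem MeasureEqOn.integralEqOn {I : Set ℝ} {g w f : ℝ → ℝ} (hw : RegulatedOn I w)
    (h : MeasureEqOn I g (fun _ : Fin 1 ↦ w) (fun _ ↦ f)) : IntegralEqOn I g w f := by
  intro c hc d hd hcd P N _ _ hPN x hx y hy hxy
  obtain ⟨νg, ν, hg, hν, hE⟩ := h c hc d hd hcd
  have hsub : Ioc x y ⊆ Ioc c d := Ioc_subset_Ioc hx.1 hy.2
  rw [← hg x hx y hy hxy, hE _ hsub measurableSet_Ioc]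
  simp only [Finset.univ_unique, Finset.sum_singleton, sInt]
  exact (hν _).measRepr.integral_eq hPN (fun μ _ ↦ hw.integrableOn c hc d hd μ) hsub

theorem MeasureEqOn.exists_measRepr {I : Set ℝ} {g w f : ℝ → ℝ}
    (h : MeasureEqOn I g (fun _ : Fin 1 ↦ w) (fun _ ↦ f)) {c d : ℝ} (hc : c ∈ I) (hd : d ∈ I)
    (hcd : c < d) :
    ∃ P N : Measure ℝ, IsFiniteMeasure P ∧ IsFiniteMeasure N ∧ MeasRepr P N f c d := by
  obtain ⟨νg, ν, -, hν, -⟩ := h c hc d hd hcd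
  exact ⟨_, _, inferInstance, inferInstance, (hν 0).measRepr⟩

theorem MonotoneOn.exists_measRepr {I : Set ℝ} (ho : IsOpen I) (hI : I.OrdConnected) {f : ℝ → ℝ}
    (hf : MonotoneOn f I) {c d : ℝ} (hc : c ∈ I) (hd : d ∈ I) :
    ∃ P : Measure ℝ, IsFiniteMeasure P ∧ MeasRepr P 0 f c d := by
  obtain ⟨d', hd'd, hd'⟩ := (mem_nhdsGE_iff_exists_Ico_subset' (lt_add_one d)).1
    (mem_nhdsWithin_of_mem_nhds (ho.mem_nhds hd) : I ∈ 𝓝[≥] d)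
  obtain ⟨e, hde, hed'⟩ := exists_between (show d < d' from hd'd)
  have heI : e ∈ I := hd' ⟨hde.le, hed'⟩
  rcases lt_or_ge d c with hdc | hcd
  · refine ⟨0, inferInstance, fun x hx ↦ absurd (hx.1.trans hx.2) (not_le.2 hdc)⟩
  have hsub := hI.out hc heI
  have hce : c ≤ e := hcd.trans hde.le
  let g : ℝ → ℝ := fun x ↦ f (max c (min x e))
  have hmem : ∀ x, max c (min x e) ∈ I := fun x ↦
    hsub ⟨le_max_left _ _, max_le hce (min_le_right _ _)⟩
  have hg : Monotone g := fun x y hxy ↦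
    hf (hmem x) (hmem y) (max_le_max le_rfl (min_le_min hxy le_rfl))
  have hfg : ∀ x ∈ Icc c d, rightLim g x = rightLim f x := by
    intro x hx
    have hxI : x ∈ I := hI.out hc hd hx
    apply rightLim_eq_of_tendsto
    refine ((hf.regulatedOn ho hI).right x hxI).congr' ?_
    filter_upwards [Ioo_mem_nhdsGT (hx.2.trans_lt hde)] with y hy
    simp only [g, min_eq_left hy.2.le, max_eq_right (hx.1.trans hy.1.le)]
  refine ⟨hg.stieltjesFunction.measure.restrict (Ioc c d), ⟨?_⟩, ?_⟩
  · simp [StieltjesFunction.measure_Ioc]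
  · intro x hx y hy hxy
    have hsub' : Ioc x y ⊆ Ioc c d := Ioc_subset_Ioc hx.1 hy.2
    rw [measureReal_restrict_apply measurableSet_Ioc, inter_eq_left.2 hsub', measureReal_def,
      StieltjesFunction.measure_Ioc, hg.stieltjesFunction_eq, hg.stieltjesFunction_eq,
      ENNReal.toReal_ofReal (sub_nonneg.2 (hg.rightLim hxy))]
    simp [hfg x hx, hfg y hy]

/-- Integrated form of being an `r`-balanced solution; unlike `IsHomSol` it is visibly stable
under linear combinations. -/
structure IsIntSol (I : Set ℝ) (r : ℝ) (α β y w : ℝ → ℝ) : Prop where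
  reg : RegulatedOn I y
  regw : RegulatedOn I w
  bal : ∀ x ∈ I, y x = r * leftLim y x + (1 - r) * rightLim y x
  balw : ∀ x ∈ I, w x = r * leftLim w x + (1 - r) * rightLim w x
  eq : IntegralEqOn I y w α
  eqw : IntegralEqOn I w y β

theorem IsHomSol.isIntSol {I : Set ℝ} (ho : IsOpen I) (hI : I.OrdConnected) {r : ℝ}
    {α β y w : ℝ → ℝ} (h : IsHomSol I r α β y w) : IsIntSol I r α β y w :=
  have hy := h.1.1.regulatedOn ho hI
  have hw := h.2.1.1.regulatedOn ho hI
  ⟨hy, hw, h.1.2, h.2.1.2, h.2.2.1.integralEqOn hw, h.2.2.2.integralEqOn hy⟩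

theorem IntegralEqOn.add {I : Set ℝ} (hI : I.OrdConnected) {g₁ g₂ w₁ w₂ f : ℝ → ℝ}
    (hg₁ : RegulatedOn I g₁) (hg₂ : RegulatedOn I g₂)
    (hw₁ : RegulatedOn I w₁) (hw₂ : RegulatedOn I w₂)
    (h₁ : IntegralEqOn I g₁ w₁ f) (h₂ : IntegralEqOn I g₂ w₂ f) (c₁ c₂ : ℝ) :
    IntegralEqOn I (fun x ↦ c₁ * g₁ x + c₂ * g₂ x) (fun x ↦ c₁ * w₁ x + c₂ * w₂ x) f := by
  intro c hc d hd hcd P N _ _ hPN x hx y hy hxy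
  have hsub : Ioc x y ⊆ Icc c d := (Ioc_subset_Ioc hx.1 hy.2).trans Ioc_subset_Icc_self
  have e₁ := h₁ c hc d hd hcd P N hPN x hx y hy hxy
  have e₂ := h₂ c hc d hd hcd P N hPN x hx y hy hxy
  have key : ∀ (μ : Measure ℝ) [IsFiniteMeasure μ],
      ∫ z in Ioc x y, (c₁ * w₁ z + c₂ * w₂ z) ∂μ =
        c₁ * (∫ z in Ioc x y, w₁ z ∂μ) + c₂ * ∫ z in Ioc x y, w₂ z ∂μ := by
    intro μ _
    rw [integral_add (((hw₁.integrableOn c hc d hd μ).mono_set hsub).const_mul c₁)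
      (((hw₂.integrableOn c hc d hd μ).mono_set hsub).const_mul c₂), integral_const_mul,
      integral_const_mul]
  rw [hg₁.rightLim_add hg₂ c₁ c₂ (hI.out hc hd hx), hg₁.rightLim_add hg₂ c₁ c₂ (hI.out hc hd hy),
    key P, key N]
  linear_combination c₁ * e₁ + c₂ * e₂

theorem IsIntSol.add {I : Set ℝ} (hI : I.OrdConnected) {r : ℝ} {α β y₁ w₁ y₂ w₂ : ℝ → ℝ}
    (h₁ : IsIntSol I r α β y₁ w₁) (h₂ : IsIntSol I r α β y₂ w₂) (c₁ c₂ : ℝ) :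
    IsIntSol I r α β (fun x ↦ c₁ * y₁ x + c₂ * y₂ x) (fun x ↦ c₁ * w₁ x + c₂ * w₂ x) where
  reg := h₁.reg.add h₂.reg c₁ c₂
  regw := h₁.regw.add h₂.regw c₁ c₂
  bal x hx := by
    rw [h₁.reg.leftLim_add h₂.reg c₁ c₂ hx, h₁.reg.rightLim_add h₂.reg c₁ c₂ hx]
    linear_combination c₁ * h₁.bal x hx + c₂ * h₂.bal x hx
  balw x hx := by
    rw [h₁.regw.leftLim_add h₂.regw c₁ c₂ hx, h₁.regw.rightLim_add h₂.regw c₁ c₂ hx]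
    linear_combination c₁ * h₁.balw x hx + c₂ * h₂.balw x hx
  eq := h₁.eq.add hI h₁.reg h₂.reg h₁.regw h₂.regw h₂.eq c₁ c₂
  eqw := h₁.eqw.add hI h₁.regw h₂.regw h₁.reg h₂.reg h₂.eqw c₁ c₂

theorem tendsto_setIntegral_Ioc_singleton {μ : Measure ℝ} [IsFiniteMeasure μ] {w : ℝ → ℝ}
    {c p : ℝ} {x : ℕ → ℝ} (hw : IntegrableOn w (Icc c p) μ) (hx : StrictMono x)
    (hxc : ∀ n, x n ∈ Ioo c p) (hxp : Tendsto x atTop (𝓝 p)) :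
    Tendsto (fun n ↦ ∫ z in Ioc (x n) p, w z ∂μ) atTop (𝓝 (w p * μ.real {p})) := by
  have hanti : Antitone (fun n ↦ Ioc (x n) p) := fun m n hmn ↦
    Ioc_subset_Ioc (hx.monotone hmn) le_rfl
  have := tendsto_setIntegral_of_antitone (μ := μ) (f := w) (fun n ↦ measurableSet_Ioc) hanti
    ⟨0, hw.mono_set ((Ioc_subset_Ioc (hxc 0).1.le le_rfl).trans Ioc_subset_Icc_self)⟩
  have hset : ⋂ n, Ioc (x n) p = {p} := by
    ext z
    simp only [mem_iInter, mem_Ioc, mem_singleton_iff]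
    refine ⟨fun h ↦ le_antisymm (h 0).2 (le_of_tendsto' hxp fun n ↦ (h n).1.le), ?_⟩
    rintro rfl n
    exact ⟨(hxc n).2, le_rfl⟩
  rw [hset, integral_singleton] at this
  simpa [mul_comm] using this

theorem exists_lt_mem_of_isOpen {I : Set ℝ} (ho : IsOpen I) {p : ℝ} (hp : p ∈ I) :
    ∃ c ∈ I, c < p := by
  obtain ⟨c, hcp, hc⟩ := (mem_nhdsLE_iff_exists_Ioc_subset' (sub_one_lt p)).1
    (mem_nhdsWithin_of_mem_nhds (ho.mem_nhds hp) : I ∈ 𝓝[≤] p)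
  obtain ⟨e, hce, hep⟩ := exists_between (show c < p from hcp)
  exact ⟨e, hc ⟨hce, hep.le⟩, hep⟩

theorem exists_gt_mem_of_isOpen {I : Set ℝ} (ho : IsOpen I) {p : ℝ} (hp : p ∈ I) :
    ∃ d ∈ I, p < d := by
  obtain ⟨d, hdp, hd⟩ := (mem_nhdsGE_iff_exists_Ico_subset' (lt_add_one p)).1
    (mem_nhdsWithin_of_mem_nhds (ho.mem_nhds hp) : I ∈ 𝓝[≥] p)
  obtain ⟨e, hpe, hed⟩ := exists_between (show p < d from hdp)
  exact ⟨e, hd ⟨hpe.le, hed⟩, hpe⟩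

theorem IntegralEqOn.jump_eq {I : Set ℝ} (ho : IsOpen I) {g w f : ℝ → ℝ}
    (hg : RegulatedOn I g) (hw : RegulatedOn I w) (hf : RegulatedOn I f)
    (hex : ∀ c ∈ I, ∀ d ∈ I, c < d →
      ∃ P N : Measure ℝ, IsFiniteMeasure P ∧ IsFiniteMeasure N ∧ MeasRepr P N f c d)
    (h : IntegralEqOn I g w f) {p : ℝ} (hp : p ∈ I) : jump g p = w p * jump f p := by
  obtain ⟨c, hc, hcp⟩ := exists_lt_mem_of_isOpen ho hp
  obtain ⟨P, N, _, _, hPN⟩ := hex c hc p hp hcp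
  obtain ⟨x, hx, hxc, hxp⟩ := exists_seq_strictMono_tendsto' hcp
  have hxp' : Tendsto x atTop (𝓝[<] p) :=
    tendsto_nhdsWithin_iff.2 ⟨hxp, Eventually.of_forall fun n ↦ (hxc n).2⟩
  have lim : ∀ {v : ℝ → ℝ}, (∀ (μ : Measure ℝ) [IsFiniteMeasure μ], IntegrableOn v (Icc c p) μ) →
      Tendsto (fun n ↦ (∫ z in Ioc (x n) p, v z ∂P) - ∫ z in Ioc (x n) p, v z ∂N) atTop
        (𝓝 (v p * (P.real {p} - N.real {p}))) := by
    intro v hv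
    rw [mul_sub]
    exact (tendsto_setIntegral_Ioc_singleton (hv P) hx hxc hxp).sub
      (tendsto_setIntegral_Ioc_singleton (hv N) hx hxc hxp)
  have memx : ∀ n, x n ∈ Icc c p := fun n ↦ Ioo_subset_Icc_self (hxc n)
  have memp : p ∈ Icc c p := ⟨hcp.le, le_rfl⟩
  have h1 : P.real {p} - N.real {p} = jump f p := by
    have l1 := lim (v := fun _ ↦ 1) (fun μ _ ↦ integrableOn_const (measure_ne_top _ _))
    have l2 : Tendsto (fun n ↦ rightLim f p - rightLim f (x n)) atTop (𝓝 (jump f p)) :=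
      ((hf.rightLim_left hp).comp hxp').const_sub _
    rw [one_mul] at l1
    refine tendsto_nhds_unique l1 (l2.congr fun n ↦ ?_)
    rw [← hPN _ (memx n) _ memp (memx n).2]
    simp
  have l1 := lim (v := w) (fun μ _ ↦ hw.integrableOn c hc p hp μ)
  have l2 : Tendsto (fun n ↦ rightLim g p - rightLim g (x n)) atTop (𝓝 (jump g p)) :=
    ((hg.rightLim_left hp).comp hxp').const_sub _
  rw [h1] at l1
  exact tendsto_nhds_unique (l2.congr fun n ↦ h c hc p hp hcp P N hPN _ (memx n) _ memp (memx n).2)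
    l1

theorem StrictMonoOn.rightLim_lt_rightLim {I : Set ℝ} (ho : IsOpen I) (hI : I.OrdConnected)
    {f : ℝ → ℝ} (hf : StrictMonoOn f I) {x y : ℝ} (hx : x ∈ I) (hy : y ∈ I) (hxy : x < y) :
    rightLim f x < rightLim f y := by
  have hreg := hf.monotoneOn.regulatedOn ho hI
  obtain ⟨m, hxm, hmy⟩ := exists_between hxy
  obtain ⟨d, hd, hyd⟩ := exists_gt_mem_of_isOpen ho hy
  have hm : m ∈ I := hI.out hx hy ⟨hxm.le, hmy.le⟩
  calc rightLim f x ≤ f m := by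
        refine le_of_tendsto (hreg.right x hx) ?_
        filter_upwards [Ioo_mem_nhdsGT hxm] with z hz
        exact hf.monotoneOn (hI.out hx hm (Ioo_subset_Icc_self hz)) hm hz.2.le
    _ < f y := hf hm hy hmy
    _ ≤ rightLim f y := by
        refine ge_of_tendsto (hreg.right y hy) ?_
        filter_upwards [Ioo_mem_nhdsGT hyd] with z hz
        exact hf.monotoneOn hy (hI.out hy hd (Ioo_subset_Icc_self hz)) hz.1.le

theorem StrictMonoOn.jump_nonneg {I : Set ℝ} (ho : IsOpen I) (hI : I.OrdConnected)
    {f : ℝ → ℝ} (hf : StrictMonoOn f I) {x : ℝ} (hx : x ∈ I) : 0 ≤ jump f x := by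
  have hreg := hf.monotoneOn.regulatedOn ho hI
  obtain ⟨c, hc, hcx⟩ := exists_lt_mem_of_isOpen ho hx
  refine sub_nonneg.2 (le_of_tendsto (hreg.rightLim_left hx) ?_)
  filter_upwards [Ioo_mem_nhdsLT hcx] with z hz
  exact (hf.rightLim_lt_rightLim ho hI (hI.out hc hx (Ioo_subset_Icc_self hz)) hx hz.2).le

section Positivity

variable {I : Set ℝ} {α y w : ℝ → ℝ}

theorem IntegralEqOn.rightLim_lt_rightLim (ho : IsOpen I) (hI : I.OrdConnected)
    (hα : StrictMonoOn α I) (hw : RegulatedOn I w) (h : IntegralEqOn I y w α) {p q : ℝ}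
    (hp : p ∈ I) (hq : q ∈ I) (hpos : ∀ z ∈ Ioo p q, 0 < w z) {x x' : ℝ} (hpx : p ≤ x)
    (hxx' : x < x') (hx'q : x' < q) : rightLim y x < rightLim y x' := by
  have hpq : p < q := hpx.trans_lt (hxx'.trans hx'q)
  obtain ⟨P, _, hP⟩ := hα.monotoneOn.exists_measRepr ho hI hp hq
  have hx : x ∈ Icc p q := ⟨hpx, (hxx'.trans hx'q).le⟩
  have hx' : x' ∈ Icc p q := ⟨hpx.trans hxx'.le, hx'q.le⟩
  have e := h p hp q hq hpq P 0 hP x hx x' hx' hxx'.le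
  have e' := hP x hx x' hx' hxx'.le
  have hlt := hα.rightLim_lt_rightLim ho hI (hI.out hp hq hx) (hI.out hp hq hx') hxx'
  simp only [measureReal_zero, Pi.zero_apply, sub_zero, Measure.restrict_zero,
    integral_zero_measure] at e e'
  have hsub : Ioc x x' ⊆ Ioo p q := fun z hz ↦ ⟨hpx.trans_lt hz.1, hz.2.trans_lt hx'q⟩
  rw [← sub_pos, e]
  rw [setIntegral_pos_iff_support_of_nonneg_ae]
  · have : Function.support w ∩ Ioc x x' = Ioc x x' :=
      inter_eq_right.2 fun z hz ↦ (hpos z (hsub hz)).ne'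
    rw [this]
    exact (ENNReal.toReal_pos_iff.1 (show 0 < P.real (Ioc x x') by linarith)).1
  · filter_upwards [self_mem_ae_restrict measurableSet_Ioc] with z hz
    exact (hpos z (hsub hz)).le
  · exact (hw.integrableOn p hp q hq P).mono_set (hsub.trans Ioo_subset_Icc_self)

theorem IntegralEqOn.rightLim_lt_leftLim (ho : IsOpen I) (hI : I.OrdConnected)
    (hα : StrictMonoOn α I) (hy : RegulatedOn I y) (hw : RegulatedOn I w)
    (h : IntegralEqOn I y w α) {p q : ℝ}
    (hp : p ∈ I) (hq : q ∈ I) (hpos : ∀ z ∈ Ioo p q, 0 < w z) {x x' : ℝ} (hpx : p ≤ x)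
    (hxx' : x < x') (hx'q : x' ≤ q) : rightLim y x < leftLim y x' := by
  obtain ⟨m, hxm, hmx'⟩ := exists_between hxx'
  refine (h.rightLim_lt_rightLim ho hI hα hw hp hq hpos hpx hxm (hmx'.trans_le hx'q)).trans_le ?_
  refine ge_of_tendsto
    (hy.rightLim_left (hI.out hp hq ⟨hpx.trans hxx'.le, hx'q⟩)) ?_
  filter_upwards [Ioo_mem_nhdsLT hmx'] with z hz
  exact (h.rightLim_lt_rightLim ho hI hα hw hp hq hpos (hpx.trans hxm.le) hz.1
    (hz.2.trans_le hx'q)).le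

theorem IntegralEqOn.leftLim_le_rightLim (ho : IsOpen I) (hI : I.OrdConnected)
    (hα : StrictMonoOn α I) (hy : RegulatedOn I y) (hw : RegulatedOn I w)
    (h : IntegralEqOn I y w α) {p q : ℝ}
    (hp : p ∈ I) (hq : q ∈ I) (hpos : ∀ z ∈ Ioo p q, 0 < w z) {x : ℝ} (hx : x ∈ Ioo p q) :
    leftLim y x ≤ rightLim y x := by
  refine le_of_tendsto (hy.rightLim_left (hI.out hp hq (Ioo_subset_Icc_self hx))) ?_
  filter_upwards [Ioo_mem_nhdsLT hx.1] with z hz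
  exact (h.rightLim_lt_rightLim ho hI hα hw hp hq hpos hz.1.le hz.2 hx.2).le

theorem IntegralEqOn.eventually_pos_right (ho : IsOpen I) (hI : I.OrdConnected)
    (hα : StrictMonoOn α I) (hy : RegulatedOn I y) (hw : RegulatedOn I w)
    (h : IntegralEqOn I y w α) {p : ℝ} (hp : p ∈ I) (h0 : rightLim y p = 0)
    (hwp : 0 < rightLim w p) : ∀ᶠ x in 𝓝[>] p, 0 < leftLim y x ∧ 0 < rightLim y x := by
  obtain ⟨d, hd, hpd⟩ := exists_gt_mem_of_isOpen ho hp
  obtain ⟨q, hpq, hq⟩ := (mem_nhdsGT_iff_exists_Ioo_subset' (lt_add_one p)).1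
    ((hw.right p hp).eventually (lt_mem_nhds hwp))
  have hpm : p < min q d := lt_min hpq hpd
  have hm : min q d ∈ I := hI.out hp hd ⟨hpm.le, min_le_right _ _⟩
  have hpos : ∀ z ∈ Ioo p (min q d), 0 < w z :=
    fun z hz ↦ hq ⟨hz.1, hz.2.trans_le (min_le_left _ _)⟩
  filter_upwards [Ioo_mem_nhdsGT hpm] with x hx
  have h1 := h.rightLim_lt_leftLim ho hI hα hy hw hp hm hpos le_rfl hx.1 hx.2.le
  rw [h0] at h1
  exact ⟨h1, h1.trans_le (h.leftLim_le_rightLim ho hI hα hy hw hp hm hpos hx)⟩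

theorem IntegralEqOn.eventually_neg_left (ho : IsOpen I) (hI : I.OrdConnected)
    (hα : StrictMonoOn α I) (hy : RegulatedOn I y) (hw : RegulatedOn I w)
    (h : IntegralEqOn I y w α) {p : ℝ} (hp : p ∈ I) (h0 : leftLim y p = 0)
    (hwp : 0 < leftLim w p) : ∀ᶠ x in 𝓝[<] p, leftLim y x < 0 ∧ rightLim y x < 0 := by
  obtain ⟨d, hd, hpd⟩ := exists_lt_mem_of_isOpen ho hp
  obtain ⟨q, hpq, hq⟩ := (mem_nhdsLT_iff_exists_Ioo_subset' (sub_one_lt p)).1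
    ((hw.left p hp).eventually (lt_mem_nhds hwp))
  have hpm : max q d < p := max_lt hpq hpd
  have hm : max q d ∈ I := hI.out hd hp ⟨le_max_right _ _, hpm.le⟩
  have hpos : ∀ z ∈ Ioo (max q d) p, 0 < w z :=
    fun z hz ↦ hq ⟨(le_max_left _ _).trans_lt hz.1, hz.2⟩
  filter_upwards [Ioo_mem_nhdsLT hpm] with x hx
  have h1 := h.rightLim_lt_leftLim ho hI hα hy hw hm hp hpos hx.1.le hx.2 le_rfl
  rw [h0] at h1
  exact ⟨(h.leftLim_le_rightLim ho hI hα hy hw hm hp hpos hx).trans_lt h1, h1⟩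

end Positivity

theorem eventually_measureReal_Icc_diff_singleton_le (κ : Measure ℝ) [IsFiniteMeasure κ] (p : ℝ)
    {ε : ℝ} (hε : 0 < ε) :
    ∀ᶠ δ in 𝓝[>] (0 : ℝ), κ.real (Icc (p - δ) (p + δ) \ {p}) ≤ ε := by
  have h := tendsto_measure_Icc_nhdsWithin_right' (μ := κ.restrict {p}ᶜ) p
  have h0 : κ.restrict {p}ᶜ {p} = 0 := by
    rw [Measure.restrict_apply (measurableSet_singleton p)]
    simp
  rw [h0] at h
  filter_upwards [h.eventually (ge_mem_nhds (ENNReal.ofReal_pos.2 hε))] with δ hδ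
  rw [Measure.restrict_apply measurableSet_Icc, ← sdiff_eq] at hδ
  exact ENNReal.toReal_le_of_le_ofReal hε.le hδ

theorem MeasRepr.abs_integral_sub_le {P N : Measure ℝ} [IsFiniteMeasure P] [IsFiniteMeasure N]
    {w : ℝ → ℝ} {p q M : ℝ} (hM : 0 ≤ M) (hsmall : P.real (Ioo p q) + N.real (Ioo p q) ≤ 1 / 2)
    (hw : ∀ z ∈ Ioo p q, |w z| ≤ M) {x x' : ℝ} (hx : x ∈ Ioo p q) (hx' : x' ∈ Ioo p q) :
    |(∫ z in Ioc x x', w z ∂P) - ∫ z in Ioc x x', w z ∂N| ≤ M / 2 := by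
  have hsub : Ioc x x' ⊆ Ioo p q := fun z hz ↦ ⟨hx.1.trans hz.1, hz.2.trans_lt hx'.2⟩
  have key : ∀ (μ : Measure ℝ) [IsFiniteMeasure μ],
      |∫ z in Ioc x x', w z ∂μ| ≤ M * μ.real (Ioo p q) := by
    intro μ _
    have := norm_setIntegral_le_of_norm_le_const (μ := μ) (f := w) (C := M)
      (measure_lt_top μ (Ioc x x')) (fun z hz ↦ hw z (hsub hz))
    exact this.trans (mul_le_mul_of_nonneg_left (measureReal_mono hsub) hM)
  calc _ ≤ |∫ z in Ioc x x', w z ∂P| + |∫ z in Ioc x x', w z ∂N| := abs_sub _ _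
    _ ≤ M * P.real (Ioo p q) + M * N.real (Ioo p q) := add_le_add (key P) (key N)
    _ ≤ M / 2 := by nlinarith

/-- A balanced function whose right limits have oscillation at most `M` on `(p, q)` and tend to
zero along some filter on `(p, q)` is bounded by `M`. -/
theorem RegulatedOn.abs_le_of_oscillation {I : Set ℝ} {r : ℝ} (hr : r ∈ Icc (0 : ℝ) 1)
    {y : ℝ → ℝ} {p q M : ℝ} (hy : RegulatedOn I y) (hsub : Ioo p q ⊆ I)
    (bal : ∀ x ∈ I, y x = r * leftLim y x + (1 - r) * rightLim y x) {F : Filter ℝ} [F.NeBot]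
    (hF : ∀ᶠ x in F, x ∈ Ioo p q) (h0 : Tendsto (rightLim y) F (𝓝 0))
    (hosc : ∀ x ∈ Ioo p q, ∀ x' ∈ Ioo p q, |rightLim y x' - rightLim y x| ≤ M) :
    ∀ x ∈ Ioo p q, |y x| ≤ M := by
  have hR : ∀ x ∈ Ioo p q, |rightLim y x| ≤ M := by
    intro x hx
    have : Tendsto (fun x' ↦ |rightLim y x' - rightLim y x|) F (𝓝 |0 - rightLim y x|) :=
      (h0.sub_const _).abs
    rw [zero_sub, abs_neg] at this
    refine le_of_tendsto this ?_
    filter_upwards [hF] with x' hx' using hosc x hx x' hx'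
  intro x hx
  have hL : |leftLim y x| ≤ M := by
    refine le_of_tendsto (hy.rightLim_left (hsub hx)).abs ?_
    filter_upwards [Ioo_mem_nhdsLT hx.1] with z hz using hR z ⟨hz.1, hz.2.trans hx.2⟩
  rw [bal x (hsub hx)]
  calc |r * leftLim y x + (1 - r) * rightLim y x|
      ≤ |r * leftLim y x| + |(1 - r) * rightLim y x| := abs_add_le _ _
    _ = r * |leftLim y x| + (1 - r) * |rightLim y x| := by
        rw [abs_mul, abs_mul, abs_of_nonneg hr.1, abs_of_nonneg (sub_nonneg.2 hr.2)]
    _ ≤ r * M + (1 - r) * M := add_le_add (mul_le_mul_of_nonneg_left hL hr.1)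
        (mul_le_mul_of_nonneg_left (hR x hx) (sub_nonneg.2 hr.2))
    _ = M := by ring

theorem IntegralEqOn.oscillation_le {I : Set ℝ} {g w f : ℝ → ℝ} (h : IntegralEqOn I g w f)
    {c d : ℝ} (hc : c ∈ I) (hd : d ∈ I) (hcd : c < d) {P N : Measure ℝ} [IsFiniteMeasure P]
    [IsFiniteMeasure N] (hPN : MeasRepr P N f c d) {p q M : ℝ} (hM : 0 ≤ M)
    (hsmall : P.real (Ioo p q) + N.real (Ioo p q) ≤ 1 / 2) (hsub : Ioo p q ⊆ Icc c d)
    (hw : ∀ z ∈ Ioo p q, |w z| ≤ M) :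
    ∀ x ∈ Ioo p q, ∀ x' ∈ Ioo p q, |rightLim g x' - rightLim g x| ≤ M / 2 := by
  have key : ∀ x ∈ Ioo p q, ∀ x' ∈ Ioo p q, x ≤ x' → |rightLim g x' - rightLim g x| ≤ M / 2 := by
    intro x hx x' hx' hxx'
    rw [h c hc d hd hcd P N hPN x (hsub hx) x' (hsub hx') hxx']
    exact MeasRepr.abs_integral_sub_le hM hsmall hw hx hx'
  intro x hx x' hx'
  rcases le_total x x' with hle | hle
  · exact key x hx x' hx' hle
  · rw [abs_sub_comm]
    exact key x' hx' x hx hle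

section Uniqueness

variable {I : Set ℝ} {r : ℝ} {α β y w : ℝ → ℝ}

theorem IsIntSol.eq_zero_of_small (h : IsIntSol I r α β y w) (hI : I.OrdConnected)
    (hr : r ∈ Icc (0 : ℝ) 1) {c d : ℝ} (hc : c ∈ I) (hd : d ∈ I) (hcd : c < d)
    {P N P' N' : Measure ℝ} [IsFiniteMeasure P] [IsFiniteMeasure N]
    [IsFiniteMeasure P'] [IsFiniteMeasure N'] (hα : MeasRepr P N α c d)
    (hβ : MeasRepr P' N' β c d) {p q : ℝ} (hsub : Ioo p q ⊆ Icc c d)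
    (hs : P.real (Ioo p q) + N.real (Ioo p q) ≤ 1 / 2)
    (hs' : P'.real (Ioo p q) + N'.real (Ioo p q) ≤ 1 / 2)
    {F : Filter ℝ} [F.NeBot] (hF : ∀ᶠ x in F, x ∈ Ioo p q) (hy0 : Tendsto (rightLim y) F (𝓝 0))
    (hw0 : Tendsto (rightLim w) F (𝓝 0)) (hb : ∀ x ∈ Ioo p q, |y x| ≤ 1 ∧ |w x| ≤ 1) :
    ∀ x ∈ Ioo p q, y x = 0 ∧ w x = 0 := by
  have hsubI : Ioo p q ⊆ I := hsub.trans (hI.out hc hd)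
  have key : ∀ n : ℕ, ∀ x ∈ Ioo p q, |y x| ≤ (1 / 2) ^ n ∧ |w x| ≤ (1 / 2) ^ n := by
    intro n
    induction n with
    | zero => simpa using hb
    | succ n ih =>
      have hM : (0 : ℝ) ≤ (1 / 2) ^ n := by positivity
      have e : ((1 : ℝ) / 2) ^ (n + 1) = (1 / 2) ^ n / 2 := by ring
      rw [e]
      have o1 := h.eq.oscillation_le hc hd hcd hα hM hs hsub (fun z hz ↦ (ih z hz).2)
      have o2 := h.eqw.oscillation_le hc hd hcd hβ hM hs' hsub (fun z hz ↦ (ih z hz).1)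
      exact fun x hx ↦ ⟨h.reg.abs_le_of_oscillation hr hsubI h.bal hF hy0 o1 x hx,
        h.regw.abs_le_of_oscillation hr hsubI h.balw hF hw0 o2 x hx⟩
  have lim : Tendsto (fun n : ℕ ↦ ((1 : ℝ) / 2) ^ n) atTop (𝓝 0) :=
    tendsto_pow_atTop_nhds_zero_of_lt_one (by norm_num) (by norm_num)
  exact fun x hx ↦ ⟨abs_nonpos_iff.1 (ge_of_tendsto' lim fun n ↦ (key n x hx).1),
    abs_nonpos_iff.1 (ge_of_tendsto' lim fun n ↦ (key n x hx).2)⟩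

/-- `f` has a Lebesgue–Stieltjes measure on every compact subinterval of `I`. -/
def HasMeasRepr (I : Set ℝ) (f : ℝ → ℝ) : Prop :=
  ∀ c ∈ I, ∀ d ∈ I, c < d →
    ∃ P N : Measure ℝ, IsFiniteMeasure P ∧ IsFiniteMeasure N ∧ MeasRepr P N f c d

theorem HasMeasRepr.exists_small {f g : ℝ → ℝ} (hf : HasMeasRepr I f) (hg : HasMeasRepr I g)
    (ho : IsOpen I) {p : ℝ} (hp : p ∈ I) :
    ∃ c ∈ I, ∃ d ∈ I, c < p ∧ p < d ∧ ∃ P N P' N' : Measure ℝ, IsFiniteMeasure P ∧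
      IsFiniteMeasure N ∧ IsFiniteMeasure P' ∧ IsFiniteMeasure N' ∧ MeasRepr P N f c d ∧
      MeasRepr P' N' g c d ∧ ∃ δ > 0, ∀ E : Set ℝ, E ⊆ Icc (p - δ) (p + δ) \ {p} →
        P.real E + N.real E ≤ 1 / 2 ∧ P'.real E + N'.real E ≤ 1 / 2 := by
  obtain ⟨c, hc, hcp⟩ := exists_lt_mem_of_isOpen ho hp
  obtain ⟨d, hd, hpd⟩ := exists_gt_mem_of_isOpen ho hp
  obtain ⟨P, N, _, _, hPN⟩ := hf c hc d hd (hcp.trans hpd)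
  obtain ⟨P', N', _, _, hPN'⟩ := hg c hc d hd (hcp.trans hpd)
  refine ⟨c, hc, d, hd, hcp, hpd, P, N, P', N', inferInstance, inferInstance, inferInstance,
    inferInstance, hPN, hPN', ?_⟩
  obtain ⟨δ, hδ, hδ0⟩ := ((eventually_measureReal_Icc_diff_singleton_le (P + N + (P' + N')) p
    (ε := 1 / 2) (by norm_num)).and self_mem_nhdsWithin).exists
  refine ⟨δ, hδ0, fun E hE ↦ ?_⟩
  have := (measureReal_mono (μ := P + N + (P' + N')) hE).trans hδ
  rw [measureReal_add_apply, measureReal_add_apply, measureReal_add_apply] at this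
  have a1 : 0 ≤ P.real E := measureReal_nonneg
  have a2 : 0 ≤ N.real E := measureReal_nonneg
  have a3 : 0 ≤ P'.real E := measureReal_nonneg
  have a4 : 0 ≤ N'.real E := measureReal_nonneg
  constructor <;> linarith

theorem IsIntSol.eventually_eq_zero_right (h : IsIntSol I r α β y w) (ho : IsOpen I)
    (hI : I.OrdConnected) (hr : r ∈ Icc (0 : ℝ) 1) (hα : HasMeasRepr I α) (hβ : HasMeasRepr I β)
    {p : ℝ} (hp : p ∈ I) (hy : rightLim y p = 0) (hw : rightLim w p = 0) :
    ∀ᶠ x in 𝓝[>] p, y x = 0 ∧ w x = 0 := by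
  obtain ⟨c, hc, d, hd, hcp, hpd, P, N, P', N', _, _, _, _, hPN, hPN', δ, hδ, hs⟩ :=
    hα.exists_small hβ ho hp
  have ly := h.reg.right p hp
  have lw := h.regw.right p hp
  rw [hy] at ly
  rw [hw] at lw
  have hb := ((ly.abs.eventually (ge_mem_nhds (show |(0 : ℝ)| < 1 by simp))).and
    (lw.abs.eventually (ge_mem_nhds (show |(0 : ℝ)| < 1 by simp))))
  obtain ⟨e, hpe, he⟩ := (mem_nhdsGT_iff_exists_Ioo_subset' (lt_add_one p)).1 hb
  have hpq : p < min e (min d (p + δ)) := lt_min hpe (lt_min hpd (by linarith))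
  set q := min e (min d (p + δ))
  have hq1 : q ≤ e := min_le_left _ _
  have hq2 : q ≤ d := (min_le_right _ _).trans (min_le_left _ _)
  have hq3 : q ≤ p + δ := (min_le_right _ _).trans (min_le_right _ _)
  have hsE := hs (Ioo p q) fun z hz ↦
    ⟨⟨by linarith [hz.1], by linarith [hz.2]⟩, by simpa using hz.1.ne'⟩
  have hmem : Ioo p q ∈ 𝓝[>] p := Ioo_mem_nhdsGT hpq
  have ty := h.reg.rightLim_right hp
  have tw := h.regw.rightLim_right hp
  rw [hy] at ty
  rw [hw] at tw
  have := h.eq_zero_of_small hI hr hc hd (hcp.trans hpd) hPN hPN' (p := p) (q := q)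
    (fun z hz ↦ ⟨(hcp.trans hz.1).le, (hz.2.trans_le hq2).le⟩) hsE.1 hsE.2 hmem ty tw
    (fun x hx ↦ he ⟨hx.1, hx.2.trans_le hq1⟩)
  filter_upwards [hmem] with x hx using this x hx

theorem IsIntSol.eventually_eq_zero_left (h : IsIntSol I r α β y w) (ho : IsOpen I)
    (hI : I.OrdConnected) (hr : r ∈ Icc (0 : ℝ) 1) (hα : HasMeasRepr I α) (hβ : HasMeasRepr I β)
    {p : ℝ} (hp : p ∈ I) (hy : leftLim y p = 0) (hw : leftLim w p = 0) :
    ∀ᶠ x in 𝓝[<] p, y x = 0 ∧ w x = 0 := by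
  obtain ⟨c, hc, d, hd, hcp, hpd, P, N, P', N', _, _, _, _, hPN, hPN', δ, hδ, hs⟩ :=
    hα.exists_small hβ ho hp
  have ly := h.reg.left p hp
  have lw := h.regw.left p hp
  rw [hy] at ly
  rw [hw] at lw
  have hb := ((ly.abs.eventually (ge_mem_nhds (show |(0 : ℝ)| < 1 by simp))).and
    (lw.abs.eventually (ge_mem_nhds (show |(0 : ℝ)| < 1 by simp))))
  obtain ⟨e, hpe, he⟩ := (mem_nhdsLT_iff_exists_Ioo_subset' (sub_one_lt p)).1 hb
  have hpq : max e (max c (p - δ)) < p := max_lt hpe (max_lt hcp (by linarith))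
  set q := max e (max c (p - δ))
  have hq1 : e ≤ q := le_max_left _ _
  have hq2 : c ≤ q := (le_max_left _ _).trans (le_max_right _ _)
  have hq3 : p - δ ≤ q := (le_max_right _ _).trans (le_max_right _ _)
  have hsE := hs (Ioo q p) fun z hz ↦
    ⟨⟨by linarith [hz.1], by linarith [hz.2]⟩, by simpa using hz.2.ne⟩
  have hmem : Ioo q p ∈ 𝓝[<] p := Ioo_mem_nhdsLT hpq
  have ty := h.reg.rightLim_left hp
  have tw := h.regw.rightLim_left hp
  rw [hy] at ty
  rw [hw] at tw
  have := h.eq_zero_of_small hI hr hc hd (hcp.trans hpd) hPN hPN' (p := q) (q := p)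
    (fun z hz ↦ ⟨(hq2.trans_lt hz.1).le, (hz.2.trans hpd).le⟩) hsE.1 hsE.2 hmem ty tw
    (fun x hx ↦ he ⟨hq1.trans_lt hx.1, hx.2⟩)
  filter_upwards [hmem] with x hx using this x hx

/-- The one-sided limits of a balanced solution in terms of its values. -/
theorem IsIntSol.lims (h : IsIntSol I r α β y w) (ho : IsOpen I)
    (hα : HasMeasRepr I α) (hβ : HasMeasRepr I β) (rα : RegulatedOn I α) (rβ : RegulatedOn I β)
    {p : ℝ} (hp : p ∈ I) :
    rightLim y p = y p + r * (w p * jump α p) ∧ leftLim y p = y p - (1 - r) * (w p * jump α p) ∧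
    rightLim w p = w p + r * (y p * jump β p) ∧ leftLim w p = w p - (1 - r) * (y p * jump β p) := by
  have j1 := h.eq.jump_eq ho h.reg h.regw rα hα hp
  have j2 := h.eqw.jump_eq ho h.regw h.reg rβ hβ hp
  have b1 := h.bal p hp
  have b2 := h.balw p hp
  rw [← j1, ← j2]
  simp only [jump]
  refine ⟨?_, ?_, ?_, ?_⟩ <;> linarith

theorem IsIntSol.eq_zero (h : IsIntSol I r α β y w) (ho : IsOpen I)
    (hI : I.OrdConnected) (hr : r ∈ Icc (0 : ℝ) 1) (hα : HasMeasRepr I α) (hβ : HasMeasRepr I β)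
    (rα : RegulatedOn I α) (rβ : RegulatedOn I β)
    (hθ : ∀ x ∈ I, theta α β (1 - r) x ≠ 0 ∧ theta α β r x ≠ 0)
    {p : ℝ} (hp : p ∈ I) (hy : y p = 0) (hw : w p = 0) : ∀ x ∈ I, y x = 0 := by
  let S : Set ℝ := {x | x ∈ I ∧ y x = 0 ∧ w x = 0}
  suffices hS : I ⊆ S from fun x hx ↦ (hS hx).2.1
  have hpre : IsPreconnected I := hI.isPreconnected
  refine hpre.subset_of_closure_inter_subset (isOpen_iff_mem_nhds.2 ?_) ⟨p, hp, hp, hy, hw⟩ ?_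
  · rintro x ⟨hx, hyx, hwx⟩
    obtain ⟨l1, l2, l3, l4⟩ := h.lims ho hα hβ rα rβ hx
    simp only [hyx, hwx, zero_mul, mul_zero, add_zero, sub_zero] at l1 l2 l3 l4
    have e1 := h.eventually_eq_zero_right ho hI hr hα hβ hx l1 l3
    have e2 := h.eventually_eq_zero_left ho hI hr hα hβ hx l2 l4
    have e3 : ∀ᶠ z in 𝓝[≠] x, y z = 0 ∧ w z = 0 := by
      rw [← nhdsLT_sup_nhdsGT]
      exact eventually_sup.2 ⟨e2, e1⟩
    have e4 : ∀ᶠ z in 𝓝 x, y z = 0 ∧ w z = 0 := by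
      filter_upwards [eventually_nhdsWithin_iff.1 e3] with z hz
      rcases eq_or_ne z x with rfl | hne
      · exact ⟨hyx, hwx⟩
      · exact hz hne
    filter_upwards [e4, ho.mem_nhds hx] with z hz hzI using ⟨hzI, hz⟩
  · rintro x ⟨hxS, hx⟩
    by_contra hxn
    obtain ⟨l1, l2, l3, l4⟩ := h.lims ho hα hβ rα rβ hx
    have hfr : ∃ᶠ z in 𝓝[≠] x, y z = 0 ∧ w z = 0 := by
      have h1 : ∃ᶠ z in 𝓝 x, z ∈ S := mem_closure_iff_frequently.1 hxS
      rw [frequently_nhdsWithin_iff]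
      exact h1.mono fun z hz ↦ ⟨hz.2, fun hzx ↦ hxn (hzx ▸ hz)⟩
    rw [← nhdsLT_sup_nhdsGT, frequently_sup] at hfr
    have hdet : y x = 0 ∧ w x = 0 := by
      have uniq : ∀ {f : ℝ → ℝ} {F : Filter ℝ} {l : ℝ}, Tendsto f F (𝓝 l) →
          (∃ᶠ z in F, f z = 0) → l = 0 := by
        intro f F l hf hfr
        by_contra hne
        exact hfr (hf.eventually_ne hne)
      obtain ⟨t1, t2⟩ := hθ x hx
      simp only [theta] at t1 t2
      rcases hfr with hfr | hfr
      · have z1 := uniq (h.reg.left x hx) (hfr.mono fun z hz ↦ hz.1)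
        have z2 := uniq (h.regw.left x hx) (hfr.mono fun z hz ↦ hz.2)
        rw [z1] at l2
        rw [z2] at l4
        constructor
        · refine (mul_eq_zero.1 (?_ : _ * y x = 0)).resolve_left t1
          linear_combination -l2 - (1 - r) * jump α x * l4
        · refine (mul_eq_zero.1 (?_ : _ * w x = 0)).resolve_left t1
          linear_combination -l4 - (1 - r) * jump β x * l2
      · have z1 := uniq (h.reg.right x hx) (hfr.mono fun z hz ↦ hz.1)
        have z2 := uniq (h.regw.right x hx) (hfr.mono fun z hz ↦ hz.2)
        rw [z1] at l1
        rw [z2] at l3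
        constructor
        · refine (mul_eq_zero.1 (?_ : _ * y x = 0)).resolve_left t2
          linear_combination -l1 + r * jump α x * l3
        · refine (mul_eq_zero.1 (?_ : _ * w x = 0)).resolve_left t2
          linear_combination -l3 + r * jump β x * l1
    exact hxn ⟨hx, hdet⟩

end Uniqueness

section Connectedness

variable {A B C : ℝ → Prop} {s t : ℝ}

theorem isOpen_setOf_eventually_nhdsNE (A : ℝ → Prop) : IsOpen {p | ∀ᶠ x in 𝓝[≠] p, A x} := by
  refine isOpen_iff_mem_nhds.2 fun p hp ↦ ?_
  have h : ∀ᶠ x in 𝓝[≠] p, A x := hp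
  rw [eventually_nhdsWithin_iff] at h
  filter_upwards [eventually_eventually_nhds.2 h] with q hq
  rcases eq_or_ne q p with rfl | hne
  · exact hp
  · refine Eventually.filter_mono nhdsWithin_le_nhds ?_
    filter_upwards [hq, isOpen_ne.mem_nhds hne] with x hx hxp using hx hxp

/-- Two mutually exclusive properties, one of which holds near each point of `(s, t)`, cannot hold
near different endpoints. -/
theorem not_eventually_nhdsGT_and_nhdsLT (hAB : ∀ x, A x → ¬ B x) (hst : s < t)
    (h : ∀ p ∈ Ioo s t, (∀ᶠ x in 𝓝[≠] p, A x) ∨ ∀ᶠ x in 𝓝[≠] p, B x)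
    (hs : ∀ᶠ x in 𝓝[>] s, A x) (ht : ∀ᶠ x in 𝓝[<] t, B x) : False := by
  have hs' : ∃ p ∈ Ioo s t, ∀ᶠ x in 𝓝[≠] p, A x := by
    obtain ⟨p, hp, hpA⟩ := ((eventually_mem_set.2 (Ioo_mem_nhdsGT hst)).and
      (eventually_eventually_nhdsWithin.2 hs)).exists
    rw [isOpen_Ioi.nhdsWithin_eq hp.1] at hpA
    exact ⟨p, hp, hpA.filter_mono nhdsWithin_le_nhds⟩
  have ht' : ∃ p ∈ Ioo s t, ∀ᶠ x in 𝓝[≠] p, B x := by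
    obtain ⟨p, hp, hpB⟩ := ((eventually_mem_set.2 (Ioo_mem_nhdsLT hst)).and
      (eventually_eventually_nhdsWithin.2 ht)).exists
    rw [isOpen_Iio.nhdsWithin_eq hp.2] at hpB
    exact ⟨p, hp, hpB.filter_mono nhdsWithin_le_nhds⟩
  obtain ⟨p, -, hpA, hpB⟩ := isPreconnected_Ioo _ _ (isOpen_setOf_eventually_nhdsNE A)
    (isOpen_setOf_eventually_nhdsNE B) h hs' ht'
  have hpA' : ∀ᶠ x in 𝓝[≠] p, A x := hpA
  obtain ⟨x, hx, hx'⟩ := (hpA'.and hpB).exists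
  exact hAB x hx hx'

theorem exists_mem_of_eventually_sides {J : Set ℝ} (hAB : ∀ x, A x → ¬ B x) (hst : s < t)
    (hJ : Ioo s t ⊆ J)
    (hR : ∀ p ∈ J, (∀ᶠ x in 𝓝[>] p, A x) ∨ ∀ᶠ x in 𝓝[>] p, B x)
    (hL : ∀ p ∈ J, (∀ᶠ x in 𝓝[<] p, A x) ∨ ∀ᶠ x in 𝓝[<] p, B x)
    (h₁ : ∀ p ∈ J, (∀ᶠ x in 𝓝[<] p, A x) → (∀ᶠ x in 𝓝[>] p, B x) → C p)
    (h₂ : ∀ p ∈ J, (∀ᶠ x in 𝓝[<] p, B x) → (∀ᶠ x in 𝓝[>] p, A x) → C p)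
    (hs : (∀ᶠ x in 𝓝[>] s, A x) ∨ s ∈ J ∧ ∀ᶠ x in 𝓝[<] s, A x)
    (ht : (∀ᶠ x in 𝓝[<] t, B x) ∨ t ∈ J ∧ ∀ᶠ x in 𝓝[>] t, B x) : ∃ p ∈ J, C p := by
  by_contra! hC
  refine not_eventually_nhdsGT_and_nhdsLT hAB hst (fun p hp ↦ ?_) (?_ : ∀ᶠ x in 𝓝[>] s, A x)
    (?_ : ∀ᶠ x in 𝓝[<] t, B x)
  · have hpJ := hJ hp
    rw [← nhdsLT_sup_nhdsGT, eventually_sup, eventually_sup]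
    rcases hL p hpJ with l | l <;> rcases hR p hpJ with m | m
    · exact .inl ⟨l, m⟩
    · exact absurd (h₁ p hpJ l m) (hC p hpJ)
    · exact absurd (h₂ p hpJ l m) (hC p hpJ)
    · exact .inr ⟨l, m⟩
  · rcases hs with hs | ⟨hsJ, hs⟩
    · exact hs
    · exact (hR s hsJ).resolve_right fun m ↦ hC s hsJ (h₁ s hsJ hs m)
  · rcases ht with ht | ⟨htJ, ht⟩
    · exact ht
    · exact (hL t htJ).resolve_left fun l ↦ hC t htJ (h₁ t htJ l ht)

end Connectedness

/-- Both one-sided limits of `f` at `x` are positive. -/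
def PosAt (f : ℝ → ℝ) (x : ℝ) : Prop := 0 < leftLim f x ∧ 0 < rightLim f x

/-- Both one-sided limits of `f` at `x` are negative. -/
def NegAt (f : ℝ → ℝ) (x : ℝ) : Prop := leftLim f x < 0 ∧ rightLim f x < 0

theorem PosAt.not_negAt {f : ℝ → ℝ} {x : ℝ} (h : PosAt f x) : ¬ NegAt f x :=
  fun h' ↦ h.1.not_gt h'.1

section Signs

variable {I : Set ℝ} {f : ℝ → ℝ} {p : ℝ}

theorem RegulatedOn.eventually_posAt_right (hf : RegulatedOn I f) (hp : p ∈ I)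
    (h : 0 < rightLim f p) : ∀ᶠ x in 𝓝[>] p, PosAt f x :=
  ((hf.leftLim_right hp).eventually (lt_mem_nhds h)).and
    ((hf.rightLim_right hp).eventually (lt_mem_nhds h))

theorem RegulatedOn.eventually_negAt_right (hf : RegulatedOn I f) (hp : p ∈ I)
    (h : rightLim f p < 0) : ∀ᶠ x in 𝓝[>] p, NegAt f x :=
  ((hf.leftLim_right hp).eventually (gt_mem_nhds h)).and
    ((hf.rightLim_right hp).eventually (gt_mem_nhds h))

theorem RegulatedOn.eventually_posAt_left (hf : RegulatedOn I f) (hp : p ∈ I)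
    (h : 0 < leftLim f p) : ∀ᶠ x in 𝓝[<] p, PosAt f x :=
  ((hf.leftLim_left hp).eventually (lt_mem_nhds h)).and
    ((hf.rightLim_left hp).eventually (lt_mem_nhds h))

theorem RegulatedOn.eventually_negAt_left (hf : RegulatedOn I f) (hp : p ∈ I)
    (h : leftLim f p < 0) : ∀ᶠ x in 𝓝[<] p, NegAt f x :=
  ((hf.leftLim_left hp).eventually (gt_mem_nhds h)).and
    ((hf.rightLim_left hp).eventually (gt_mem_nhds h))

theorem RegulatedOn.leftLim_neg (hf : RegulatedOn I f) (hp : p ∈ I) :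
    leftLim (fun x ↦ -f x) p = -leftLim f p :=
  leftLim_eq_of_tendsto (hf.left p hp).neg

theorem RegulatedOn.rightLim_neg (hf : RegulatedOn I f) (hp : p ∈ I) :
    rightLim (fun x ↦ -f x) p = -rightLim f p :=
  rightLim_eq_of_tendsto (hf.right p hp).neg

theorem exists_pos_Ioo_of_eventually (ho : IsOpen I) (hp : p ∈ I) {A B : ℝ → Prop}
    (hl : ∀ᶠ x in 𝓝[<] p, A x) (hr : ∀ᶠ x in 𝓝[>] p, B x) :
    ∃ δ > (0 : ℝ), Ioo (p - δ) (p + δ) ⊆ I ∧ (∀ x ∈ Ioo (p - δ) p, A x) ∧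
      ∀ x ∈ Ioo p (p + δ), B x := by
  have h : ∀ᶠ x in 𝓝 p, x ∈ I ∧ (x < p → A x) ∧ (p < x → B x) :=
    (ho.eventually_mem hp).and
      ((eventually_nhdsWithin_iff.1 hl).and (eventually_nhdsWithin_iff.1 hr))
  obtain ⟨δ, hδ, hb⟩ := Metric.eventually_nhds_iff_ball.1 h
  rw [Real.ball_eq_Ioo] at hb
  exact ⟨δ, hδ, fun x hx ↦ (hb x hx).1,
    fun x hx ↦ (hb x ⟨hx.1, hx.2.trans (by linarith)⟩).2.1 hx.2,
    fun x hx ↦ (hb x ⟨lt_trans (by linarith) hx.1, hx.2⟩).2.2 hx.1⟩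

theorem changesSignAt_of_negAt_posAt (ho : IsOpen I) (hp : p ∈ I)
    (hl : ∀ᶠ x in 𝓝[<] p, NegAt f x) (hr : ∀ᶠ x in 𝓝[>] p, PosAt f x) :
    ChangesSignAt I f p := by
  obtain ⟨δ, hδ, hI, h₁, h₂⟩ := exists_pos_Ioo_of_eventually ho hp hl hr
  exact ⟨δ, hδ, hI, .inl ⟨fun x hx ↦ (h₁ x hx).1, fun x hx ↦ (h₂ x hx).2⟩⟩

theorem changesSignAt_of_posAt_negAt (ho : IsOpen I) (hp : p ∈ I)
    (hl : ∀ᶠ x in 𝓝[<] p, PosAt f x) (hr : ∀ᶠ x in 𝓝[>] p, NegAt f x) :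
    ChangesSignAt I f p := by
  obtain ⟨δ, hδ, hI, h₁, h₂⟩ := exists_pos_Ioo_of_eventually ho hp hl hr
  exact ⟨δ, hδ, hI, .inr ⟨fun x hx ↦ (h₁ x hx).1, fun x hx ↦ (h₂ x hx).2⟩⟩

/-- A regulated function without sign-changing points in `(s, t)` has constant sign there. -/
theorem RegulatedOn.posAt_or_negAt (hf : RegulatedOn I f) {s t : ℝ} (hI : Ioo s t ⊆ I)
    (hZ : ZSet f (Ioo s t) = ∅) :
    (∀ x ∈ Ioo s t, PosAt f x) ∨ ∀ x ∈ Ioo s t, NegAt f x := by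
  have h : ∀ x ∈ Ioo s t, PosAt f x ∨ NegAt f x := by
    intro x hx
    have : ¬ leftLim f x * rightLim f x ≤ 0 := fun hle ↦
      (Set.eq_empty_iff_forall_notMem.1 hZ x) ⟨hx, hle⟩
    exact pos_and_pos_or_neg_and_neg_of_mul_pos (not_le.1 this)
  have key : ∀ x ∈ Ioo s t, ∀ y ∈ Ioo s t, x < y →
      ¬ (PosAt f x ∧ NegAt f y) ∧ ¬ (NegAt f x ∧ PosAt f y) := by
    intro x hx y hy hxy
    have hsub : Ioo x y ⊆ Ioo s t := Ioo_subset_Ioo hx.1.le hy.2.le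
    have hnear : ∀ p ∈ Ioo s t,
        (∀ᶠ z in 𝓝[≠] p, PosAt f z) ∨ ∀ᶠ z in 𝓝[≠] p, NegAt f z := by
      intro p hp
      rw [← nhdsLT_sup_nhdsGT, eventually_sup, eventually_sup]
      rcases h p hp with hp' | hp'
      · exact .inl ⟨hf.eventually_posAt_left (hI hp) hp'.1,
          hf.eventually_posAt_right (hI hp) hp'.2⟩
      · exact .inr ⟨hf.eventually_negAt_left (hI hp) hp'.1,
          hf.eventually_negAt_right (hI hp) hp'.2⟩
    refine ⟨fun ⟨hx', hy'⟩ ↦ ?_, fun ⟨hx', hy'⟩ ↦ ?_⟩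
    · exact not_eventually_nhdsGT_and_nhdsLT (fun _ ↦ PosAt.not_negAt) hxy
        (fun p hp ↦ hnear p (hsub hp)) (hf.eventually_posAt_right (hI hx) hx'.2)
        (hf.eventually_negAt_left (hI hy) hy'.1)
    · exact not_eventually_nhdsGT_and_nhdsLT (fun _ hn hp ↦ PosAt.not_negAt hp hn) hxy
        (fun p hp ↦ (hnear p (hsub hp)).symm) (hf.eventually_negAt_right (hI hx) hx'.2)
        (hf.eventually_posAt_left (hI hy) hy'.1)
  by_contra! hcon
  obtain ⟨⟨x, hx, hx'⟩, y, hy, hy'⟩ := hcon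
  replace hx' := (h x hx).resolve_left hx'
  replace hy' := (h y hy).resolve_right hy'
  rcases lt_trichotomy x y with hxy | rfl | hxy
  · exact (key x hx y hy hxy).2 ⟨hx', hy'⟩
  · exact hy'.not_negAt hx'
  · exact (key y hy x hx hxy).1 ⟨hy', hx'⟩

end Signs

/-- The standing hypotheses on the coefficients of the equation. -/
structure SturmCoefficients (I : Set ℝ) (r : ℝ) (α β : ℝ → ℝ) : Prop where
  isOpen : IsOpen I
  ordConnected : I.OrdConnected
  mem_Icc : r ∈ Icc (0 : ℝ) 1
  strictMonoOn : StrictMonoOn α I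
  measRepr_left : HasMeasRepr I α
  measRepr_right : HasMeasRepr I β
  regulatedOn_right : RegulatedOn I β
  theta_ne_zero : ∀ x ∈ I, theta α β (1 - r) x ≠ 0 ∧ theta α β r x ≠ 0

theorem SturmCoefficients.regulatedOn_left {I : Set ℝ} {r : ℝ} {α β : ℝ → ℝ}
    (hc : SturmCoefficients I r α β) : RegulatedOn I α :=
  hc.strictMonoOn.monotoneOn.regulatedOn hc.isOpen hc.ordConnected

/-- The Wronskian of two solutions with given derivatives with respect to `α`. -/
def wronskian (u wu v wv : ℝ → ℝ) (x : ℝ) : ℝ := u x * wv x - v x * wu x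

section Solutions

variable {I : Set ℝ} {r : ℝ} {α β u wu v wv : ℝ → ℝ} {p s t : ℝ}

theorem IsIntSol.neg (h : IsIntSol I r α β u wu) (hI : I.OrdConnected) :
    IsIntSol I r α β (fun x ↦ -u x) (fun x ↦ -wu x) := by
  simpa using h.add hI h (-1) 0

theorem wronskian_right (hc : SturmCoefficients I r α β) (hu : IsIntSol I r α β u wu)
    (hv : IsIntSol I r α β v wv) (hp : p ∈ I) :
    rightLim u p * rightLim wv p - rightLim v p * rightLim wu p =
      theta α β r p * wronskian u wu v wv p := by
  obtain ⟨u₁, -, u₃, -⟩ := hu.lims hc.isOpen hc.measRepr_left hc.measRepr_right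
    hc.regulatedOn_left hc.regulatedOn_right hp
  obtain ⟨v₁, -, v₃, -⟩ := hv.lims hc.isOpen hc.measRepr_left hc.measRepr_right
    hc.regulatedOn_left hc.regulatedOn_right hp
  rw [u₁, u₃, v₁, v₃, theta, wronskian]
  ring

theorem wronskian_left (hc : SturmCoefficients I r α β) (hu : IsIntSol I r α β u wu)
    (hv : IsIntSol I r α β v wv) (hp : p ∈ I) :
    leftLim u p * leftLim wv p - leftLim v p * leftLim wu p =
      theta α β (1 - r) p * wronskian u wu v wv p := by
  obtain ⟨-, u₁, -, u₃⟩ := hu.lims hc.isOpen hc.measRepr_left hc.measRepr_right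
    hc.regulatedOn_left hc.regulatedOn_right hp
  obtain ⟨-, v₁, -, v₃⟩ := hv.lims hc.isOpen hc.measRepr_left hc.measRepr_right
    hc.regulatedOn_left hc.regulatedOn_right hp
  rw [u₁, u₃, v₁, v₃, theta, wronskian]
  ring

theorem tendsto_wronskian_right (hc : SturmCoefficients I r α β) (hu : IsIntSol I r α β u wu)
    (hv : IsIntSol I r α β v wv) (hp : p ∈ I) :
    Tendsto (wronskian u wu v wv) (𝓝[>] p) (𝓝 (theta α β r p * wronskian u wu v wv p)) := by
  rw [← wronskian_right hc hu hv hp]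
  exact ((hu.reg.right p hp).mul (hv.regw.right p hp)).sub
    ((hv.reg.right p hp).mul (hu.regw.right p hp))

theorem tendsto_wronskian_left (hc : SturmCoefficients I r α β) (hu : IsIntSol I r α β u wu)
    (hv : IsIntSol I r α β v wv) (hp : p ∈ I) :
    Tendsto (wronskian u wu v wv) (𝓝[<] p) (𝓝 (theta α β (1 - r) p * wronskian u wu v wv p)) := by
  rw [← wronskian_left hc hu hv hp]
  exact ((hu.reg.left p hp).mul (hv.regw.left p hp)).sub
    ((hv.reg.left p hp).mul (hu.regw.left p hp))

theorem linDepOn_of_wronskian_eq_zero (hc : SturmCoefficients I r α β)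
    (hu : IsIntSol I r α β u wu) (hv : IsIntSol I r α β v wv) (hp : p ∈ I)
    (h : wronskian u wu v wv p = 0) : LinDepOn I u v := by
  have key : ∀ c₁ c₂ : ℝ, ¬ (c₁ = 0 ∧ c₂ = 0) → c₁ * u p + c₂ * v p = 0 →
      c₁ * wu p + c₂ * wv p = 0 → LinDepOn I u v := fun c₁ c₂ hne e₁ e₂ ↦
    ⟨c₁, c₂, hne, (hu.add hc.ordConnected hv c₁ c₂).eq_zero hc.isOpen hc.ordConnected hc.mem_Icc
      hc.measRepr_left hc.measRepr_right hc.regulatedOn_left hc.regulatedOn_right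
      hc.theta_ne_zero hp e₁ e₂⟩
  simp only [wronskian] at h
  by_cases h₁ : v p = 0 ∧ u p = 0
  · by_cases h₂ : wv p = 0 ∧ wu p = 0
    · exact key 1 0 (by simp) (by simp [h₁.2]) (by simp [h₂.2])
    · exact key (wv p) (-wu p) (by simpa using h₂) (by simp [h₁]) (by ring)
  · exact key (v p) (-u p) (by simpa using h₁) (by ring) (by linear_combination -h)

/-- The Wronskian keeps its sign across an interval on which `θ` is positive. -/
theorem wronskian_mul_pos (hc : SturmCoefficients I r α β)
    (hu : IsIntSol I r α β u wu) (hv : IsIntSol I r α β v wv)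
    (hW : ∀ x ∈ I, wronskian u wu v wv x ≠ 0) (hs : s ∈ I) (ht : t ∈ I) (hst : s < t)
    (hθ : ∀ x ∈ Ioo s t, 0 < theta α β r x / theta α β (1 - r) x) :
    0 < (theta α β r s * wronskian u wu v wv s) *
      (theta α β (1 - r) t * wronskian u wu v wv t) := by
  set W := wronskian u wu v wv
  have hsW : theta α β r s * W s ≠ 0 := mul_ne_zero (hc.theta_ne_zero s hs).2 (hW s hs)
  have htW : theta α β (1 - r) t * W t ≠ 0 := mul_ne_zero (hc.theta_ne_zero t ht).1 (hW t ht)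
  have hnear : ∀ p ∈ Ioo s t, (∀ᶠ x in 𝓝[≠] p, 0 < W x) ∨ ∀ᶠ x in 𝓝[≠] p, W x < 0 := by
    intro p hp
    have hpI : p ∈ I := hc.ordConnected.out hs ht (Ioo_subset_Icc_self hp)
    have hR := tendsto_wronskian_right hc hu hv hpI
    have hL := tendsto_wronskian_left hc hu hv hpI
    have hprod : 0 < (theta α β r p * W p) * (theta α β (1 - r) p * W p) := by
      have h₁ : 0 < theta α β r p * theta α β (1 - r) p := by
        rcases div_pos_iff.1 (hθ p hp) with h | h
        · exact mul_pos h.1 h.2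
        · exact mul_pos_of_neg_of_neg h.1 h.2
      have h₂ : 0 < W p * W p := mul_self_pos.2 (hW p hpI)
      calc 0 < _ := mul_pos h₁ h₂
        _ = _ := by ring
    rw [← nhdsLT_sup_nhdsGT, eventually_sup, eventually_sup]
    rcases pos_and_pos_or_neg_and_neg_of_mul_pos hprod with h | h
    · exact .inl ⟨hL.eventually (lt_mem_nhds h.2), hR.eventually (lt_mem_nhds h.1)⟩
    · exact .inr ⟨hL.eventually (gt_mem_nhds h.2), hR.eventually (gt_mem_nhds h.1)⟩
  have hR := tendsto_wronskian_right hc hu hv hs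
  have hL := tendsto_wronskian_left hc hu hv ht
  rcases hsW.lt_or_gt with h₁ | h₁ <;> rcases htW.lt_or_gt with h₂ | h₂
  · exact mul_pos_of_neg_of_neg h₁ h₂
  · exact (not_eventually_nhdsGT_and_nhdsLT (fun _ hx ↦ not_lt.2 (le_of_lt hx)) hst
      (fun p hp ↦ (hnear p hp).symm) (hR.eventually (gt_mem_nhds h₁))
      (hL.eventually (lt_mem_nhds h₂))).elim
  · exact (not_eventually_nhdsGT_and_nhdsLT (fun _ hx ↦ not_lt.2 (le_of_lt hx)) hst
      hnear (hR.eventually (lt_mem_nhds h₁)) (hL.eventually (gt_mem_nhds h₂))).elim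
  · exact mul_pos h₁ h₂

theorem IsIntSol.eventually_posAt_right (hc : SturmCoefficients I r α β)
    (hu : IsIntSol I r α β u wu) (hp : p ∈ I) (h₀ : rightLim u p = 0) (hw : 0 < rightLim wu p) :
    ∀ᶠ x in 𝓝[>] p, PosAt u x :=
  hu.eq.eventually_pos_right hc.isOpen hc.ordConnected hc.strictMonoOn hu.reg hu.regw hp h₀ hw

theorem IsIntSol.eventually_negAt_left (hc : SturmCoefficients I r α β)
    (hu : IsIntSol I r α β u wu) (hp : p ∈ I) (h₀ : leftLim u p = 0) (hw : 0 < leftLim wu p) :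
    ∀ᶠ x in 𝓝[<] p, NegAt u x :=
  hu.eq.eventually_neg_left hc.isOpen hc.ordConnected hc.strictMonoOn hu.reg hu.regw hp h₀ hw

theorem IsIntSol.eventually_negAt_right (hc : SturmCoefficients I r α β)
    (hu : IsIntSol I r α β u wu) (hp : p ∈ I) (h₀ : rightLim u p = 0) (hw : rightLim wu p < 0) :
    ∀ᶠ x in 𝓝[>] p, NegAt u x := by
  have h := (hu.neg hc.ordConnected).eventually_posAt_right hc hp
    (by rw [hu.reg.rightLim_neg hp, h₀, neg_zero])
    (by rw [hu.regw.rightLim_neg hp]; exact neg_pos.2 hw)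
  filter_upwards [h, mem_nhdsWithin_of_mem_nhds (hc.isOpen.mem_nhds hp)] with x hx hxI
  rw [PosAt, hu.reg.leftLim_neg hxI, hu.reg.rightLim_neg hxI] at hx
  exact ⟨neg_pos.1 hx.1, neg_pos.1 hx.2⟩

theorem IsIntSol.eventually_posAt_left (hc : SturmCoefficients I r α β)
    (hu : IsIntSol I r α β u wu) (hp : p ∈ I) (h₀ : leftLim u p = 0) (hw : leftLim wu p < 0) :
    ∀ᶠ x in 𝓝[<] p, PosAt u x := by
  have h := (hu.neg hc.ordConnected).eventually_negAt_left hc hp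
    (by rw [hu.reg.leftLim_neg hp, h₀, neg_zero])
    (by rw [hu.regw.leftLim_neg hp]; exact neg_pos.2 hw)
  filter_upwards [h, mem_nhdsWithin_of_mem_nhds (hc.isOpen.mem_nhds hp)] with x hx hxI
  rw [NegAt, hu.reg.leftLim_neg hxI, hu.reg.rightLim_neg hxI] at hx
  exact ⟨neg_lt_zero.1 hx.1, neg_lt_zero.1 hx.2⟩

theorem IsIntSol.eventually_sign_right (hc : SturmCoefficients I r α β)
    (hu : IsIntSol I r α β u wu) (hp : p ∈ I) (h : rightLim u p = 0 → rightLim wu p ≠ 0) :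
    (∀ᶠ x in 𝓝[>] p, PosAt u x) ∨ ∀ᶠ x in 𝓝[>] p, NegAt u x := by
  rcases lt_trichotomy (rightLim u p) 0 with h₀ | h₀ | h₀
  · exact .inr (hu.reg.eventually_negAt_right hp h₀)
  · rcases (h h₀).lt_or_gt with hw | hw
    · exact .inr (hu.eventually_negAt_right hc hp h₀ hw)
    · exact .inl (hu.eventually_posAt_right hc hp h₀ hw)
  · exact .inl (hu.reg.eventually_posAt_right hp h₀)

theorem IsIntSol.eventually_sign_left (hc : SturmCoefficients I r α β)
    (hu : IsIntSol I r α β u wu) (hp : p ∈ I) (h : leftLim u p = 0 → leftLim wu p ≠ 0) :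
    (∀ᶠ x in 𝓝[<] p, PosAt u x) ∨ ∀ᶠ x in 𝓝[<] p, NegAt u x := by
  rcases lt_trichotomy (leftLim u p) 0 with h₀ | h₀ | h₀
  · exact .inr (hu.reg.eventually_negAt_left hp h₀)
  · rcases (h h₀).lt_or_gt with hw | hw
    · exact .inl (hu.eventually_posAt_left hc hp h₀ hw)
    · exact .inr (hu.eventually_negAt_left hc hp h₀ hw)
  · exact .inl (hu.reg.eventually_posAt_left hp h₀)

/-- If suitable one-sided limits of `v` at the endpoints of `(s, t)` have opposite signs, then `v`
changes sign. -/
theorem IsIntSol.changesSignIn (hc : SturmCoefficients I r α β) (hv : IsIntSol I r α β v wv)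
    (hR : ∀ x ∈ I, rightLim v x = 0 → rightLim wv x ≠ 0)
    (hL : ∀ x ∈ I, leftLim v x = 0 → leftLim wv x ≠ 0) {J : Set ℝ} (hJ : Ioo s t ⊆ J)
    (hJI : J ⊆ I) (hs : s ∈ I) (ht : t ∈ I) (hst : s < t) {k l : ℝ}
    (hk : k = rightLim v s ∨ s ∈ J ∧ k = leftLim v s)
    (hl : l = leftLim v t ∨ t ∈ J ∧ l = rightLim v t) (hkl : k * l < 0) :
    ChangesSignIn I v J := by
  have hR' := fun p (hp : p ∈ J) ↦ hv.eventually_sign_right hc (hJI hp) (hR p (hJI hp))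
  have hL' := fun p (hp : p ∈ J) ↦ hv.eventually_sign_left hc (hJI hp) (hL p (hJI hp))
  rcases mul_neg_iff.1 hkl with ⟨hk₀, hl₀⟩ | ⟨hk₀, hl₀⟩
  · refine exists_mem_of_eventually_sides (fun _ ↦ PosAt.not_negAt) hst hJ hR' hL'
      (fun p hp ↦ changesSignAt_of_posAt_negAt hc.isOpen (hJI hp))
      (fun p hp ↦ changesSignAt_of_negAt_posAt hc.isOpen (hJI hp))
      (hk.imp (fun e ↦ ?_) fun e ↦ ⟨e.1, ?_⟩) (hl.imp (fun e ↦ ?_) fun e ↦ ⟨e.1, ?_⟩)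
    · exact hv.reg.eventually_posAt_right hs (e ▸ hk₀)
    · exact hv.reg.eventually_posAt_left hs (e.2 ▸ hk₀)
    · exact hv.reg.eventually_negAt_left ht (e ▸ hl₀)
    · exact hv.reg.eventually_negAt_right ht (e.2 ▸ hl₀)
  · refine exists_mem_of_eventually_sides (fun _ hn hp ↦ PosAt.not_negAt hp hn) hst hJ
      (fun p hp ↦ (hR' p hp).symm) (fun p hp ↦ (hL' p hp).symm)
      (fun p hp ↦ changesSignAt_of_negAt_posAt hc.isOpen (hJI hp))
      (fun p hp ↦ changesSignAt_of_posAt_negAt hc.isOpen (hJI hp))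
      (hk.imp (fun e ↦ ?_) fun e ↦ ⟨e.1, ?_⟩) (hl.imp (fun e ↦ ?_) fun e ↦ ⟨e.1, ?_⟩)
    · exact hv.reg.eventually_negAt_right hs (e ▸ hk₀)
    · exact hv.reg.eventually_negAt_left hs (e.2 ▸ hk₀)
    · exact hv.reg.eventually_posAt_left ht (e ▸ hl₀)
    · exact hv.reg.eventually_posAt_right ht (e.2 ▸ hl₀)

end Solutions

/-- A solution `u` positive on `(s, t)` together with a second, linearly independent solution `v`,
where independence is expressed through the Wronskian. -/
structure SturmPair (I : Set ℝ) (r : ℝ) (α β u wu v wv : ℝ → ℝ) (s t : ℝ) : Prop where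
  coeff : SturmCoefficients I r α β
  sol_left : IsIntSol I r α β u wu
  sol_right : IsIntSol I r α β v wv
  wronskian_ne_zero : ∀ x ∈ I, wronskian u wu v wv x ≠ 0
  left_mem : s ∈ I
  right_mem : t ∈ I
  lt : s < t
  theta_pos : ∀ x ∈ Ioo s t, 0 < theta α β r x / theta α β (1 - r) x
  posAt : ∀ x ∈ Ioo s t, PosAt u x

namespace SturmPair

variable {I : Set ℝ} {r : ℝ} {α β u wu v wv : ℝ → ℝ} {s t x : ℝ}

theorem wronskian_right_ne_zero (h : SturmPair I r α β u wu v wv s t) (hx : x ∈ I) :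
    rightLim u x * rightLim wv x - rightLim v x * rightLim wu x ≠ 0 := by
  rw [wronskian_right h.coeff h.sol_left h.sol_right hx]
  exact mul_ne_zero (h.coeff.theta_ne_zero x hx).2 (h.wronskian_ne_zero x hx)

theorem wronskian_left_ne_zero (h : SturmPair I r α β u wu v wv s t) (hx : x ∈ I) :
    leftLim u x * leftLim wv x - leftLim v x * leftLim wu x ≠ 0 := by
  rw [wronskian_left h.coeff h.sol_left h.sol_right hx]
  exact mul_ne_zero (h.coeff.theta_ne_zero x hx).1 (h.wronskian_ne_zero x hx)

theorem rightLim_deriv_pos (h : SturmPair I r α β u wu v wv s t) (h₀ : rightLim u s = 0) :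
    0 < rightLim wu s := by
  have hne : rightLim wu s ≠ 0 := by
    intro h₁
    have := h.wronskian_right_ne_zero h.left_mem
    simp [h₀, h₁] at this
  refine hne.lt_or_gt.resolve_left fun hlt ↦ ?_
  obtain ⟨x, hn, hx⟩ := ((h.sol_left.eventually_negAt_right h.coeff h.left_mem h₀ hlt).and
    (Ioo_mem_nhdsGT h.lt)).exists
  exact (h.posAt x hx).not_negAt hn

theorem leftLim_deriv_neg (h : SturmPair I r α β u wu v wv s t) (h₀ : leftLim u t = 0) :
    leftLim wu t < 0 := by
  have hne : leftLim wu t ≠ 0 := by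
    intro h₁
    have := h.wronskian_left_ne_zero h.right_mem
    simp [h₀, h₁] at this
  refine hne.lt_or_gt.resolve_right fun hlt ↦ ?_
  obtain ⟨x, hn, hx⟩ := ((h.sol_left.eventually_negAt_left h.coeff h.right_mem h₀ hlt).and
    (Ioo_mem_nhdsLT h.lt)).exists
  exact (h.posAt x hx).not_negAt hn

theorem rightLim_nonneg (h : SturmPair I r α β u wu v wv s t) : 0 ≤ rightLim u s := by
  refine ge_of_tendsto (h.sol_left.reg.rightLim_right h.left_mem) ?_
  filter_upwards [Ioo_mem_nhdsGT h.lt] with x hx using (h.posAt x hx).2.le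

theorem leftLim_nonneg (h : SturmPair I r α β u wu v wv s t) : 0 ≤ leftLim u t := by
  refine ge_of_tendsto (h.sol_left.reg.leftLim_left h.right_mem) ?_
  filter_upwards [Ioo_mem_nhdsLT h.lt] with x hx using (h.posAt x hx).1.le

theorem exists_wronskian_eq_of_leftLim_eq_zero (h : SturmPair I r α β u wu v wv s t)
    (h₀ : leftLim u s = 0) :
    ∃ k > 0, wronskian u wu v wv s = -(k * leftLim v s) := by
  have hc := h.coeff
  obtain ⟨u₁, u₂, u₃, -⟩ := h.sol_left.lims hc.isOpen hc.measRepr_left hc.measRepr_right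
    hc.regulatedOn_left hc.regulatedOn_right h.left_mem
  obtain ⟨-, v₂, -, -⟩ := h.sol_right.lims hc.isOpen hc.measRepr_left hc.measRepr_right
    hc.regulatedOn_left hc.regulatedOn_right h.left_mem
  have hA := hc.strictMonoOn.jump_nonneg hc.isOpen hc.ordConnected h.left_mem
  rw [h₀] at u₂
  have hWs : wronskian u wu v wv s = -(wu s * leftLim v s) := by
    rw [v₂, wronskian]
    linear_combination -wv s * u₂
  refine ⟨wu s, ?_, hWs⟩
  have hne : wu s ≠ 0 := by
    intro h₁
    exact h.wronskian_ne_zero s h.left_mem (by rw [hWs, h₁]; ring)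
  have hu : rightLim u s = wu s * jump α s := by rw [u₁]; linear_combination -u₂
  rcases hA.eq_or_lt with hA | hA
  · rw [← hA] at u₂ hu
    have hus : u s = 0 := by linarith
    have := h.rightLim_deriv_pos (by rw [hu, mul_zero])
    rw [u₃, hus] at this
    linarith
  · have hn := h.rightLim_nonneg
    rw [hu] at hn
    exact (nonneg_of_mul_nonneg_left hn hA).lt_of_ne' hne

theorem exists_wronskian_eq_of_rightLim_eq_zero (h : SturmPair I r α β u wu v wv s t)
    (h₀ : rightLim u t = 0) :
    ∃ k < 0, wronskian u wu v wv t = -(k * rightLim v t) := by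
  have hc := h.coeff
  obtain ⟨u₁, u₂, -, u₄⟩ := h.sol_left.lims hc.isOpen hc.measRepr_left hc.measRepr_right
    hc.regulatedOn_left hc.regulatedOn_right h.right_mem
  obtain ⟨v₁, -, -, -⟩ := h.sol_right.lims hc.isOpen hc.measRepr_left hc.measRepr_right
    hc.regulatedOn_left hc.regulatedOn_right h.right_mem
  have hA := hc.strictMonoOn.jump_nonneg hc.isOpen hc.ordConnected h.right_mem
  rw [h₀] at u₁
  have hWt : wronskian u wu v wv t = -(wu t * rightLim v t) := by
    rw [v₁, wronskian]
    linear_combination -wv t * u₁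
  refine ⟨wu t, ?_, hWt⟩
  have hne : wu t ≠ 0 := by
    intro h₁
    exact h.wronskian_ne_zero t h.right_mem (by rw [hWt, h₁]; ring)
  have hu : leftLim u t = -wu t * jump α t := by rw [u₂]; linear_combination -u₁
  rcases hA.eq_or_lt with hA | hA
  · rw [← hA] at u₁ hu
    have hut : u t = 0 := by linarith
    have := h.leftLim_deriv_neg (by rw [hu, mul_zero])
    rw [u₄, hut] at this
    linarith
  · have hn := h.leftLim_nonneg
    rw [hu] at hn
    exact (neg_nonneg.1 (nonneg_of_mul_nonneg_left hn hA)).lt_of_ne hne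

theorem exists_right_wronskian_eq (h : SturmPair I r α β u wu v wv s t) (h₀ : rightLim u s = 0) :
    ∃ k > 0, theta α β r s * wronskian u wu v wv s = -(k * rightLim v s) :=
  ⟨_, h.rightLim_deriv_pos h₀, by
    rw [← wronskian_right h.coeff h.sol_left h.sol_right h.left_mem, h₀]; ring⟩

theorem exists_left_wronskian_eq (h : SturmPair I r α β u wu v wv s t) (h₀ : leftLim u t = 0) :
    ∃ k < 0, theta α β (1 - r) t * wronskian u wu v wv t = -(k * leftLim v t) :=
  ⟨_, h.leftLim_deriv_neg h₀, by
    rw [← wronskian_left h.coeff h.sol_left h.sol_right h.right_mem, h₀]; ring⟩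

theorem changesSignIn (h : SturmPair I r α β u wu v wv s t) {J : Set ℝ} (hJ : Ioo s t ⊆ J)
    (hJ' : J ⊆ Icc s t) {k l k' l' X Y : ℝ}
    (hk : k = rightLim v s ∨ s ∈ J ∧ k = leftLim v s)
    (hl : l = leftLim v t ∨ t ∈ J ∧ l = rightLim v t) (hk' : 0 < k') (hl' : l' < 0)
    (hX : X = -(k' * k)) (hY : Y = -(l' * l)) (hXY : 0 < X * Y) : ChangesSignIn I v J := by
  refine h.sol_right.changesSignIn h.coeff (fun x hx h₀ h₁ ↦ ?_) (fun x hx h₀ h₁ ↦ ?_) hJ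
    (hJ'.trans (h.coeff.ordConnected.out h.left_mem h.right_mem)) h.left_mem h.right_mem h.lt hk hl
    ?_
  · exact h.wronskian_right_ne_zero hx (by rw [h₀, h₁]; ring)
  · exact h.wronskian_left_ne_zero hx (by rw [h₀, h₁]; ring)
  · have e : X * Y = (k' * l') * (k * l) := by rw [hX, hY]; ring
    rw [e] at hXY
    exact neg_of_mul_pos_right hXY (mul_neg_of_pos_of_neg hk' hl').le

theorem separation (h : SturmPair I r α β u wu v wv s t) :
    (rightLim u s = 0 → leftLim u t = 0 → ChangesSignIn I v (Ioo s t)) ∧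
    (leftLim u s = 0 → leftLim u t = 0 → 0 < theta α β r s → ChangesSignIn I v (Ico s t)) ∧
    (rightLim u s = 0 → rightLim u t = 0 → 0 < theta α β (1 - r) t →
      ChangesSignIn I v (Ioc s t)) ∧
    (leftLim u s = 0 → rightLim u t = 0 → 0 < theta α β r s * theta α β (1 - r) t →
      ChangesSignIn I v (Icc s t)) := by
  have hW := wronskian_mul_pos h.coeff h.sol_left h.sol_right h.wronskian_ne_zero h.left_mem
    h.right_mem h.lt h.theta_pos
  refine ⟨fun hs ht ↦ ?_, fun hs ht hθ ↦ ?_, fun hs ht hθ ↦ ?_, fun hs ht hθ ↦ ?_⟩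
  · obtain ⟨k, hk, ek⟩ := h.exists_right_wronskian_eq hs
    obtain ⟨l, hl, el⟩ := h.exists_left_wronskian_eq ht
    exact h.changesSignIn subset_rfl Ioo_subset_Icc_self (.inl rfl) (.inl rfl) hk hl ek el hW
  · obtain ⟨k, hk, ek⟩ := h.exists_wronskian_eq_of_leftLim_eq_zero hs
    obtain ⟨l, hl, el⟩ := h.exists_left_wronskian_eq ht
    rw [mul_assoc] at hW
    exact h.changesSignIn Ioo_subset_Ico_self Ico_subset_Icc_self
      (.inr ⟨left_mem_Ico.2 h.lt, rfl⟩) (.inl rfl) hk hl ek el (pos_of_mul_pos_right hW hθ.le)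
  · obtain ⟨k, hk, ek⟩ := h.exists_right_wronskian_eq hs
    obtain ⟨l, hl, el⟩ := h.exists_wronskian_eq_of_rightLim_eq_zero ht
    rw [mul_left_comm] at hW
    exact h.changesSignIn Ioo_subset_Ioc_self Ioc_subset_Icc_self (.inl rfl)
      (.inr ⟨right_mem_Ioc.2 h.lt, rfl⟩) hk hl ek el (pos_of_mul_pos_right hW hθ.le)
  · obtain ⟨k, hk, ek⟩ := h.exists_wronskian_eq_of_leftLim_eq_zero hs
    obtain ⟨l, hl, el⟩ := h.exists_wronskian_eq_of_rightLim_eq_zero ht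
    rw [mul_mul_mul_comm] at hW
    exact h.changesSignIn Ioo_subset_Icc_self subset_rfl (.inr ⟨left_mem_Icc.2 h.lt.le, rfl⟩)
      (.inr ⟨right_mem_Icc.2 h.lt.le, rfl⟩) hk hl ek el (pos_of_mul_pos_right hW hθ.le)

end SturmPair

/-- Sturm Separation Theorem I, Theorem 5.3. -/
theorem statement13 (a b : EReal) (hab : a < b) (r : ℝ) (hr : r ∈ Icc (0 : ℝ) 1)
    (α β : ℝ → ℝ) (hα : StrictMonoOn α (EI a b))
    (hβ : LocallyBoundedVariationOn β (EI a b))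
    (hθ : ∀ x ∈ EI a b, theta α β (1 - r) x ≠ 0 ∧ theta α β r x ≠ 0)
    (u wu v wv : ℝ → ℝ)
    (hu : IsHomSol (EI a b) r α β u wu) (hv : IsHomSol (EI a b) r α β v wv)
    (hind : ¬ LinDepOn (EI a b) u v)
    (s t : ℝ) (hst : s < t)
    (hs : s ∈ ZSet u (EI a b)) (ht : t ∈ ZSet u (EI a b))
    (hcons : ZSet u (Ioo s t) = ∅)
    (hθpos : ∀ x ∈ Ioo s t, 0 < theta α β r x / theta α β (1 - r) x) :
    (rightLim u s = 0 → leftLim u t = 0 →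
      ChangesSignIn (EI a b) v (Ioo s t)) ∧
    (leftLim u s = 0 → leftLim u t = 0 → 0 < theta α β r s →
      ChangesSignIn (EI a b) v (Ico s t)) ∧
    (rightLim u s = 0 → rightLim u t = 0 → 0 < theta α β (1 - r) t →
      ChangesSignIn (EI a b) v (Ioc s t)) ∧
    (leftLim u s = 0 → rightLim u t = 0 → 0 < theta α β r s * theta α β (1 - r) t →
      ChangesSignIn (EI a b) v (Icc s t)) := by
  have ho := isOpen_EI a b
  have hI := ordConnected_EI a b
  have hc : SturmCoefficients (EI a b) r α β :=
    ⟨ho, hI, hr, hα, fun _ hc _ hd hcd ↦ hu.2.2.1.exists_measRepr hc hd hcd,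
      fun _ hc _ hd hcd ↦ hu.2.2.2.exists_measRepr hc hd hcd, hβ.regulatedOn ho hI, hθ⟩
  have hu' := hu.isIntSol ho hI
  have hv' := hv.isIntSol ho hI
  have hW : ∀ x ∈ EI a b, wronskian u wu v wv x ≠ 0 := fun x hx h₀ ↦
    hind (linDepOn_of_wronskian_eq_zero hc hu' hv' hx h₀)
  have hsub : Ioo s t ⊆ EI a b := Ioo_subset_Icc_self.trans (hI.out hs.1 ht.1)
  rcases hu'.reg.posAt_or_negAt hsub hcons with hpos | hneg
  · exact SturmPair.separation ⟨hc, hu', hv', hW, hs.1, ht.1, hst, hθpos, hpos⟩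
  · have key := SturmPair.separation (u := fun x ↦ -u x) (wu := fun x ↦ -wu x)
      ⟨hc, hu'.neg hI, hv', fun x hx h₀ ↦ hW x hx (by simp only [wronskian] at h₀ ⊢; linarith),
        hs.1, ht.1, hst, hθpos, fun x hx ↦ ⟨?_, ?_⟩⟩
    · simpa only [hu'.reg.leftLim_neg hs.1, hu'.reg.rightLim_neg hs.1, hu'.reg.leftLim_neg ht.1,
        hu'.reg.rightLim_neg ht.1, neg_eq_zero] using key
    · rw [hu'.reg.leftLim_neg (hsub hx)]
      exact neg_pos.2 (hneg x hx).1
    · rw [hu'.reg.rightLim_neg (hsub hx)]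
      exact neg_pos.2 (hneg x hx).2
end
end

section
/- Assume r ∈ [0,1] is fixed, α is strictly increasing on (a,b), β ∈ BV_loc((a,b),ℝ), and θ_{1−r}(x) ≠ 0 and θ_r(x) ≠ 0 for all x ∈ (a,b). Let u and v be linearly independent real-valued r-balanced solutions of −d(dy/dα) + y dβ = 0 on (a,b). If for some s ∈ (a,b) one has u^-(s) u^+(s) < 0 and v does not change sign at s, then v(s) · (du/dα)(s) · W[u,v](s) < 0. -/
open Set Filter Function MeasureTheory Topology

noncomputable section

theorem IsOpen.exists_Icc_subset {I : Set ℝ} (hI : IsOpen I) {x : ℝ} (hx : x ∈ I) :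
    ∃ c d, c < x ∧ x < d ∧ Icc c d ⊆ I := by
  obtain ⟨ε, hε, hball⟩ := Metric.isOpen_iff.1 hI x hx
  rw [Real.ball_eq_Ioo] at hball
  exact ⟨x - ε / 2, x + ε / 2, by linarith, by linarith,
    fun y hy => hball ⟨by linarith [hy.1], by linarith [hy.2]⟩⟩

theorem LocallyBoundedVariationOn.tendsto_leftLim {I : Set ℝ} (hI : IsOpen I) {f : ℝ → ℝ}
    (hf : LocallyBoundedVariationOn f I) {x : ℝ} (hx : x ∈ I) :
    Tendsto f (𝓝[<] x) (𝓝 (leftLim f x)) := by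
  obtain ⟨c, d, hcx, hxd, hcd⟩ := hI.exists_Icc_subset hx
  have hle := (hcx.trans hxd).le
  obtain ⟨l, hl⟩ := (hf _ _ (hcd ⟨le_rfl, hle⟩) (hcd ⟨hle, le_rfl⟩)).exists_tendsto_left x
  have hmem : I ∩ Icc c d ∈ 𝓝 x := inter_mem (hI.mem_nhds hx) (Icc_mem_nhds hcx hxd)
  rw [nhdsWithin_inter_of_mem (mem_nhdsWithin_of_mem_nhds hmem)] at hl
  exact tendsto_leftLim_of_tendsto ⟨l, hl⟩

theorem LocallyBoundedVariationOn.tendsto_rightLim {I : Set ℝ} (hI : IsOpen I) {f : ℝ → ℝ}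
    (hf : LocallyBoundedVariationOn f I) {x : ℝ} (hx : x ∈ I) :
    Tendsto f (𝓝[>] x) (𝓝 (rightLim f x)) := by
  obtain ⟨c, d, hcx, hxd, hcd⟩ := hI.exists_Icc_subset hx
  have hle := (hcx.trans hxd).le
  obtain ⟨l, hl⟩ := (hf _ _ (hcd ⟨le_rfl, hle⟩) (hcd ⟨hle, le_rfl⟩)).exists_tendsto_right x
  have hmem : I ∩ Icc c d ∈ 𝓝 x := inter_mem (hI.mem_nhds hx) (Icc_mem_nhds hcx hxd)
  rw [nhdsWithin_inter_of_mem (mem_nhdsWithin_of_mem_nhds hmem)] at hl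
  exact tendsto_rightLim_of_tendsto ⟨l, hl⟩

theorem LocallyBoundedVariationOn.tendsto_rightLim_left {I : Set ℝ} (hI : IsOpen I) {f : ℝ → ℝ}
    (hf : LocallyBoundedVariationOn f I) {x : ℝ} (hx : x ∈ I) :
    Tendsto (rightLim f) (𝓝[<] x) (𝓝 (leftLim f x)) := by
  refine (closed_nhds_basis (leftLim f x)).tendsto_right_iff.2 ?_
  rintro S ⟨hS, hSc⟩
  have hev : ∀ᶠ y in 𝓝[<] x, f y ∈ S ∧ y ∈ I :=
    ((hf.tendsto_leftLim hI hx).eventually hS).and (mem_nhdsWithin_of_mem_nhds (hI.mem_nhds hx))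
  obtain ⟨l, hl, hsub⟩ := mem_nhdsLT_iff_exists_Ioo_subset.1 hev
  filter_upwards [Ioo_mem_nhdsLT hl] with c hc
  refine hSc.mem_of_tendsto (hf.tendsto_rightLim hI (hsub hc).2) ?_
  filter_upwards [Ioo_mem_nhdsGT_of_mem ⟨hc.1.le, hc.2⟩] with y hy using (hsub hy).1

theorem SMRepresents.apply_singleton {I : Set ℝ} (hI : IsOpen I) {ν : SignedMeasure ℝ} {f : ℝ → ℝ}
    {c d x : ℝ} (hν : SMRepresents ν f c d) (hf : LocallyBoundedVariationOn f I) (hx : x ∈ I)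
    (hxc : x ∈ Ioc c d) : ν {x} = jump f x := by
  obtain ⟨w, w_mono, w_lt, w_lim⟩ := exists_seq_strictMono_tendsto' hxc.1
  have hset : {x} = ⋂ n, Ioc (w n) x := by
    refine Subset.antisymm (fun y hy => ?_) fun y hy => ?_
    · rw [mem_singleton_iff.1 hy]
      exact mem_iInter.2 fun n => ⟨(w_lt n).2, le_rfl⟩
    · have hy' : ∀ n, w n < y ∧ y ≤ x := fun n => mem_iInter.1 hy n
      exact le_antisymm (hy' 0).2 (le_of_tendsto' w_lim fun n => (hy' n).1.le)
  have h₁ : Tendsto (fun n => ν (Ioc (w n) x)) atTop (𝓝 (ν {x})) := by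
    rw [hset]
    exact VectorMeasure.tendsto_vectorMeasure_iInter_atTop_nat
      (fun m n hmn => Ioc_subset_Ioc_left (w_mono.monotone hmn)) fun _ => measurableSet_Ioc
  have hw : Tendsto w atTop (𝓝[<] x) := tendsto_nhdsWithin_of_tendsto_nhds_of_eventually_within _
    w_lim (Eventually.of_forall fun n => (w_lt n).2)
  have h₂ : Tendsto (fun n => rightLim f x - rightLim f (w n)) atTop (𝓝 (jump f x)) :=
    tendsto_const_nhds.sub ((hf.tendsto_rightLim_left hI hx).comp hw)
  refine tendsto_nhds_unique h₁ (h₂.congr fun n => ?_)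
  exact (hν _ ⟨(w_lt n).1.le, (w_lt n).2.le.trans hxc.2⟩ _ ⟨hxc.1.le, hxc.2⟩ (w_lt n).2.le).symm

theorem MeasureEqOn.jump_eq {I : Set ℝ} (hI : IsOpen I) {f g h : ℝ → ℝ}
    (H : MeasureEqOn I g (fun _ : Fin 1 => h) (fun _ => f))
    (hf : LocallyBoundedVariationOn f I) (hg : LocallyBoundedVariationOn g I)
    {x : ℝ} (hx : x ∈ I) : jump g x = h x * jump f x := by
  obtain ⟨c, d, hcx, hxd, hcd⟩ := hI.exists_Icc_subset hx
  obtain ⟨νg, ν, hνg, hν, hE⟩ := H c (hcd ⟨le_rfl, (hcx.trans hxd).le⟩) _ hx hcx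
  have hxc : x ∈ Ioc c x := ⟨hcx, le_rfl⟩
  have key := hE {x} (singleton_subset_iff.2 hxc) (measurableSet_singleton x)
  rw [hνg.apply_singleton hI hg hx hxc] at key
  rw [key, ← (hν 0).apply_singleton hI hf hx hxc]
  simp only [Fin.sum_univ_one, sInt, Measure.restrict_singleton,
    integral_smul_measure, integral_dirac]
  rw [SignedMeasure.apply_eq_posPart_real_sub_negPart_real _ (measurableSet_singleton x)]
  simp only [Measure.real, smul_eq_mul]
  ring

theorem MeasureEqOn.exists_measure {I : Set ℝ} {f g h : ℝ → ℝ}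
    (H : MeasureEqOn I g (fun _ : Fin 1 => h) (fun _ => f)) {c d : ℝ} (hc : c ∈ I) (hd : d ∈ I)
    (hcd : c < d) :
    ∃ p n : Measure ℝ, IsFiniteMeasure p ∧ IsFiniteMeasure n ∧ p ⟂ₘ n ∧
      ∀ x ∈ Icc c d, ∀ y ∈ Icc c d, x ≤ y →
        p.real (Ioc x y) - n.real (Ioc x y) = rightLim f y - rightLim f x ∧
        rightLim g y - rightLim g x = (∫ t in Ioc x y, h t ∂p) - ∫ t in Ioc x y, h t ∂n := by
  obtain ⟨νg, ν, hνg, hν, hE⟩ := H _ hc _ hd hcd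
  refine ⟨(ν 0).toJordanDecomposition.posPart, (ν 0).toJordanDecomposition.negPart,
    inferInstance, inferInstance, (ν 0).toJordanDecomposition.mutuallySingular,
    fun x hx y hy hxy => ⟨?_, ?_⟩⟩
  · rw [← hν 0 x hx y hy hxy,
      SignedMeasure.apply_eq_posPart_real_sub_negPart_real _ measurableSet_Ioc]
  · rw [← hνg x hx y hy hxy, hE _ (Ioc_subset_Ioc hx.1 hy.2) measurableSet_Ioc,
      Fin.sum_univ_one, sInt]

theorem tendsto_real_Ioo_right (μ : Measure ℝ) [IsFiniteMeasure μ] (x : ℝ) :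
    Tendsto (fun d => μ.real (Ioo x d)) (𝓝[>] x) (𝓝 0) := by
  have h := tendsto_measure_biInter_gt (μ := μ) (s := fun d => Ioo x d) (a := x)
    (fun _ _ => measurableSet_Ioo.nullMeasurableSet) (fun i j _ hij => Ioo_subset_Ioo_right hij)
    ⟨x + 1, by simp, measure_ne_top _ _⟩
  have hset : ⋂ r > x, Ioo x r = ∅ := by
    refine eq_empty_of_forall_notMem fun y hy => ?_
    simp only [mem_iInter, mem_Ioo] at hy
    exact lt_irrefl y (hy y (hy (x + 1) (by simp)).1).2
  rw [hset, measure_empty] at h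
  exact (ENNReal.tendsto_toReal ENNReal.zero_ne_top).comp h

theorem tendsto_real_Ioo_left (μ : Measure ℝ) [IsFiniteMeasure μ] (x : ℝ) :
    Tendsto (fun d => μ.real (Ioo d x)) (𝓝[<] x) (𝓝 0) := by
  have h := tendsto_measure_biInter_gt (ι := ℝᵒᵈ) (μ := μ)
    (s := fun d => Ioo (OrderDual.ofDual d) x) (a := OrderDual.toDual x)
    (fun _ _ => measurableSet_Ioo.nullMeasurableSet)
    (fun i j _ hij => Ioo_subset_Ioo_left hij)
    ⟨OrderDual.toDual (x - 1), OrderDual.toDual_lt_toDual.2 (by simp), measure_ne_top _ _⟩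
  have hset : ⋂ r > OrderDual.toDual x, Ioo (OrderDual.ofDual r) x = ∅ := by
    refine eq_empty_of_forall_notMem fun y hy => ?_
    simp only [mem_iInter, mem_Ioo] at hy
    have hy' : ∀ r : ℝ, r < x → r < y ∧ y < x := fun r hr => hy (OrderDual.toDual r) hr
    exact lt_irrefl y (hy' y (hy' (x - 1) (by simp)).2).1
  rw [hset, measure_empty] at h
  exact (ENNReal.tendsto_toReal ENNReal.zero_ne_top).comp h

theorem RBalanced.mem_of_rightLim_mem {I J S : Set ℝ} (hI : IsOpen I) {r : ℝ}
    (hr : r ∈ Icc (0 : ℝ) 1) {h : ℝ → ℝ} (hh : RBalanced r I h) (hJ : IsOpen J) (hJI : J ⊆ I)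
    (hS : IsClosed S) (hSc : Convex ℝ S) (hmem : ∀ t ∈ J, rightLim h t ∈ S) {t : ℝ} (ht : t ∈ J) :
    h t ∈ S := by
  have hleft : leftLim h t ∈ S :=
    hS.mem_of_tendsto (hh.1.tendsto_rightLim_left hI (hJI ht))
      (mem_of_superset (mem_nhdsWithin_of_mem_nhds (hJ.mem_nhds ht)) hmem)
  rw [hh.2 t (hJI ht)]
  exact hSc hleft (hmem t ht) hr.1 (by linarith [hr.2]) (by ring)

theorem abs_integral_sub_integral_le {p n : Measure ℝ} [IsFiniteMeasure p] [IsFiniteMeasure n]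
    {h : ℝ → ℝ} {M : ℝ} {A B : Set ℝ} (hM : 0 ≤ M) (hAB : A ⊆ B) (hh : ∀ t ∈ A, |h t| ≤ M)
    (hB : p.real B + n.real B ≤ 1 / 2) :
    |(∫ t in A, h t ∂p) - ∫ t in A, h t ∂n| ≤ M / 2 := by
  have hp := norm_setIntegral_le_of_norm_le_const (μ := p) (measure_lt_top p A)
    fun t ht => (Real.norm_eq_abs (h t)).trans_le (hh t ht)
  have hn := norm_setIntegral_le_of_norm_le_const (μ := n) (measure_lt_top n A)
    fun t ht => (Real.norm_eq_abs (h t)).trans_le (hh t ht)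
  rw [Real.norm_eq_abs] at hp hn
  have hpB : M * p.real A ≤ M * p.real B := mul_le_mul_of_nonneg_left (measureReal_mono hAB) hM
  have hnB : M * n.real A ≤ M * n.real B := mul_le_mul_of_nonneg_left (measureReal_mono hAB) hM
  have hMB := mul_le_mul_of_nonneg_left hB hM
  have := abs_sub (∫ t in A, h t ∂p) (∫ t in A, h t ∂n)
  linarith

/-- On the interval `J` the oscillation of `g⁺` is at most half of the supremum of `|h⁺|`. -/
def OscHalfOn (J : Set ℝ) (g h : ℝ → ℝ) : Prop :=
  ∀ M, 0 ≤ M → (∀ t ∈ J, |rightLim h t| ≤ M) →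
    ∀ y ∈ J, ∀ z ∈ J, |rightLim g z - rightLim g y| ≤ M / 2

theorem MeasureEqOn.oscHalfOn_of_real_le {I : Set ℝ} (hI : IsOpen I) {r : ℝ}
    (hr : r ∈ Icc (0 : ℝ) 1) {f g h : ℝ → ℝ} (hh : RBalanced r I h) {p n : Measure ℝ}
    [IsFiniteMeasure p] [IsFiniteMeasure n] {c d l m : ℝ} (hcl : c ≤ l) (hmd : m ≤ d)
    (hcd : Icc c d ⊆ I)
    (hpn : ∀ x ∈ Icc c d, ∀ y ∈ Icc c d, x ≤ y →
      p.real (Ioc x y) - n.real (Ioc x y) = rightLim f y - rightLim f x ∧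
      rightLim g y - rightLim g x = (∫ t in Ioc x y, h t ∂p) - ∫ t in Ioc x y, h t ∂n)
    (hlm : p.real (Ioo l m) + n.real (Ioo l m) ≤ 1 / 2) : OscHalfOn (Ioo l m) g h := by
  have hJ : Ioo l m ⊆ Icc c d := fun t ht => ⟨hcl.trans ht.1.le, ht.2.le.trans hmd⟩
  intro M hM hbound
  have habs : ∀ t ∈ Ioo l m, |h t| ≤ M := fun t ht => abs_le.2 <|
    hh.mem_of_rightLim_mem hI hr isOpen_Ioo (hJ.trans hcd) isClosed_Icc (convex_Icc (-M) M)
      (fun t ht => abs_le.1 (hbound t ht)) ht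
  have key : ∀ y ∈ Ioo l m, ∀ z ∈ Ioo l m, y ≤ z → |rightLim g z - rightLim g y| ≤ M / 2 := by
    intro y hy z hz hyz
    rw [(hpn y (hJ hy) z (hJ hz) hyz).2]
    have hsub : Ioc y z ⊆ Ioo l m := fun t ht => ⟨hy.1.trans ht.1, ht.2.trans_lt hz.2⟩
    exact abs_integral_sub_integral_le hM hsub (fun t ht => habs t (hsub ht)) hlm
  intro y hy z hz
  rcases le_total y z with hyz | hzy
  · exact key y hy z hz hyz
  · rw [abs_sub_comm]
    exact key z hz y hy hzy

theorem MeasureEqOn.eventually_oscHalfOn {I : Set ℝ} (hI : IsOpen I) {r : ℝ}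
    (hr : r ∈ Icc (0 : ℝ) 1) {f g h : ℝ → ℝ}
    (H : MeasureEqOn I g (fun _ : Fin 1 => h) (fun _ => f)) (hh : RBalanced r I h) {x : ℝ}
    (hx : x ∈ I) :
    (∀ᶠ d in 𝓝[>] x, OscHalfOn (Ioo x d) g h) ∧ ∀ᶠ c in 𝓝[<] x, OscHalfOn (Ioo c x) g h := by
  obtain ⟨c, d, hcx, hxd, hcd⟩ := hI.exists_Icc_subset hx
  have hlt := hcx.trans hxd
  obtain ⟨p, n, _, _, -, hpn⟩ := H.exists_measure (hcd ⟨le_rfl, hlt.le⟩) (hcd ⟨hlt.le, le_rfl⟩) hlt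
  constructor
  · have hlim := (tendsto_real_Ioo_right p x).add (tendsto_real_Ioo_right n x)
    rw [add_zero] at hlim
    filter_upwards [hlim.eventually (ge_mem_nhds one_half_pos), Ioo_mem_nhdsGT hxd] with m hm hmd
    exact oscHalfOn_of_real_le hI hr hh hcx.le hmd.2.le hcd hpn hm
  · have hlim := (tendsto_real_Ioo_left p x).add (tendsto_real_Ioo_left n x)
    rw [add_zero] at hlim
    filter_upwards [hlim.eventually (ge_mem_nhds one_half_pos), Ioo_mem_nhdsLT hcx] with m hm hmd
    exact oscHalfOn_of_real_le hI hr hh hmd.1.le hxd.le hcd hpn hm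

theorem OscHalfOn.rightLim_eq_zero {J : Set ℝ} {v w : ℝ → ℝ} (hvw : OscHalfOn J v w)
    (hwv : OscHalfOn J w v) {F : Filter ℝ} [F.NeBot] (hJF : J ∈ F)
    (hv : Tendsto (rightLim v) F (𝓝 0)) (hw : Tendsto (rightLim w) F (𝓝 0))
    (hv1 : ∀ t ∈ J, |rightLim v t| ≤ 1) (hw1 : ∀ t ∈ J, |rightLim w t| ≤ 1) :
    ∀ t ∈ J, rightLim v t = 0 ∧ rightLim w t = 0 := by
  have halve : ∀ {g h : ℝ → ℝ}, OscHalfOn J g h → Tendsto (rightLim g) F (𝓝 0) → ∀ M, 0 ≤ M →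
      (∀ t ∈ J, |rightLim h t| ≤ M) → ∀ z ∈ J, |rightLim g z| ≤ M / 2 := by
    intro g h hgh hg M hM hb z hz
    have hlim : Tendsto (fun y => |rightLim g z - rightLim g y|) F (𝓝 |rightLim g z - 0|) :=
      (tendsto_const_nhds.sub hg).abs
    rw [sub_zero] at hlim
    exact le_of_tendsto hlim (mem_of_superset hJF fun y hy => hgh M hM hb y hy z hz)
  have hpow : ∀ k : ℕ, ∀ t ∈ J, |rightLim v t| ≤ (1 / 2) ^ k ∧ |rightLim w t| ≤ (1 / 2) ^ k := by
    intro k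
    induction k with
    | zero => simpa using fun t ht => ⟨hv1 t ht, hw1 t ht⟩
    | succ k ih =>
      intro t ht
      have h₁ := halve hvw hv _ (by positivity) (fun t ht => (ih t ht).2) t ht
      have h₂ := halve hwv hw _ (by positivity) (fun t ht => (ih t ht).1) t ht
      rw [pow_succ]
      constructor <;> linarith
  have hzero : Tendsto (fun k : ℕ => (1 / 2 : ℝ) ^ k) atTop (𝓝 0) :=
    tendsto_pow_atTop_nhds_zero_of_lt_one (by norm_num) (by norm_num)
  exact fun t ht =>
    ⟨abs_nonpos_iff.1 (ge_of_tendsto' hzero fun k => (hpow k t ht).1),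
      abs_nonpos_iff.1 (ge_of_tendsto' hzero fun k => (hpow k t ht).2)⟩

theorem IsHomSol.eventually_right {I : Set ℝ} (hI : IsOpen I) {r : ℝ} (hr : r ∈ Icc (0 : ℝ) 1)
    {α β v w : ℝ → ℝ} (hv : IsHomSol I r α β v w) {x : ℝ} (hx : x ∈ I)
    (hv0 : rightLim v x = 0) (hw0 : rightLim w x = 0) :
    ∀ᶠ y in 𝓝[>] x, rightLim v y = 0 ∧ rightLim w y = 0 := by
  obtain ⟨hvb, hwb, hvα, hwβ⟩ := hv
  have hvt : Tendsto (rightLim v) (𝓝[>] x) (𝓝 0) := hv0 ▸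
    (continuousWithinAt_rightLim_Ici (hvb.1.tendsto_rightLim hI hx)).mono Ioi_subset_Ici_self
  have hwt : Tendsto (rightLim w) (𝓝[>] x) (𝓝 0) := hw0 ▸
    (continuousWithinAt_rightLim_Ici (hwb.1.tendsto_rightLim hI hx)).mono Ioi_subset_Ici_self
  have hone : {t : ℝ | |t| ≤ 1} ∈ 𝓝 (0 : ℝ) := by
    simpa [Metric.closedBall, Real.dist_eq] using Metric.closedBall_mem_nhds (0 : ℝ) one_pos
  obtain ⟨m, hm, hsub⟩ := mem_nhdsGT_iff_exists_Ioo_subset.1 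
    ((hvt.eventually hone).and (hwt.eventually hone))
  obtain ⟨d, ⟨h₁, h₂⟩, hd⟩ := (((hvα.eventually_oscHalfOn hI hr hwb hx).1.and
    (hwβ.eventually_oscHalfOn hI hr hvb hx).1).and (Ioo_mem_nhdsGT hm)).exists
  have hsub' : Ioo x d ⊆ Ioo x m := Ioo_subset_Ioo_right hd.2.le
  have hmem : Ioo x d ∈ 𝓝[>] x := Ioo_mem_nhdsGT hd.1
  exact mem_of_superset hmem <| h₁.rightLim_eq_zero h₂ hmem hvt hwt
    (fun t ht => (hsub (hsub' ht)).1) fun t ht => (hsub (hsub' ht)).2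

theorem IsHomSol.eventually_left {I : Set ℝ} (hI : IsOpen I) {r : ℝ} (hr : r ∈ Icc (0 : ℝ) 1)
    {α β v w : ℝ → ℝ} (hv : IsHomSol I r α β v w) {x : ℝ} (hx : x ∈ I)
    (hv0 : leftLim v x = 0) (hw0 : leftLim w x = 0) :
    ∀ᶠ y in 𝓝[<] x, rightLim v y = 0 ∧ rightLim w y = 0 := by
  obtain ⟨hvb, hwb, hvα, hwβ⟩ := hv
  have hvt : Tendsto (rightLim v) (𝓝[<] x) (𝓝 0) := hv0 ▸ hvb.1.tendsto_rightLim_left hI hx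
  have hwt : Tendsto (rightLim w) (𝓝[<] x) (𝓝 0) := hw0 ▸ hwb.1.tendsto_rightLim_left hI hx
  have hone : {t : ℝ | |t| ≤ 1} ∈ 𝓝 (0 : ℝ) := by
    simpa [Metric.closedBall, Real.dist_eq] using Metric.closedBall_mem_nhds (0 : ℝ) one_pos
  obtain ⟨m, hm, hsub⟩ := mem_nhdsLT_iff_exists_Ioo_subset.1 
    ((hvt.eventually hone).and (hwt.eventually hone))
  obtain ⟨d, ⟨h₁, h₂⟩, hd⟩ := (((hvα.eventually_oscHalfOn hI hr hwb hx).2.and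
    (hwβ.eventually_oscHalfOn hI hr hvb hx).2).and (Ioo_mem_nhdsLT hm)).exists
  have hsub' : Ioo d x ⊆ Ioo m x := Ioo_subset_Ioo_left hd.1.le
  have hmem : Ioo d x ∈ 𝓝[<] x := Ioo_mem_nhdsLT hd.2
  exact mem_of_superset hmem <| h₁.rightLim_eq_zero h₂ hmem hvt hwt
    (fun t ht => (hsub (hsub' ht)).1) fun t ht => (hsub (hsub' ht)).2

theorem IsHomSol.rightLim_eq_zero_of_leftLim {I : Set ℝ} (hI : IsOpen I) {r : ℝ}
    {α β v w : ℝ → ℝ} (hα : LocallyBoundedVariationOn α I) (hβ : LocallyBoundedVariationOn β I)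
    (hv : IsHomSol I r α β v w) {x : ℝ} (hx : x ∈ I) (hθ : theta α β (1 - r) x ≠ 0)
    (hv0 : leftLim v x = 0) (hw0 : leftLim w x = 0) : rightLim v x = 0 ∧ rightLim w x = 0 := by
  obtain ⟨hvb, hwb, hvα, hwβ⟩ := hv
  have h₁ := hvα.jump_eq hI hα hvb.1 hx
  have h₂ := hwβ.jump_eq hI hβ hwb.1 hx
  rw [hwb.2 x hx, hw0] at h₁
  rw [hvb.2 x hx, hv0] at h₂
  rw [jump, hv0] at h₁
  rw [jump, hw0] at h₂
  unfold theta at hθ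
  have hv1 : (1 - (1 - r) ^ 2 * jump α x * jump β x) * rightLim v x = 0 := by
    linear_combination h₁ + (1 - r) * jump α x * h₂
  have hv2 := (mul_eq_zero.1 hv1).resolve_left hθ
  rw [hv2] at h₂
  exact ⟨hv2, by linear_combination h₂⟩

theorem IsHomSol.leftLim_eq_zero_of_rightLim {I : Set ℝ} (hI : IsOpen I) {r : ℝ}
    {α β v w : ℝ → ℝ} (hα : LocallyBoundedVariationOn α I) (hβ : LocallyBoundedVariationOn β I)
    (hv : IsHomSol I r α β v w) {x : ℝ} (hx : x ∈ I) (hθ : theta α β r x ≠ 0)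
    (hv0 : rightLim v x = 0) (hw0 : rightLim w x = 0) : leftLim v x = 0 ∧ leftLim w x = 0 := by
  obtain ⟨hvb, hwb, hvα, hwβ⟩ := hv
  have h₁ := hvα.jump_eq hI hα hvb.1 hx
  have h₂ := hwβ.jump_eq hI hβ hwb.1 hx
  rw [hwb.2 x hx, hw0] at h₁
  rw [hvb.2 x hx, hv0] at h₂
  rw [jump, hv0] at h₁
  rw [jump, hw0] at h₂
  unfold theta at hθ
  have hv1 : (1 - r ^ 2 * jump α x * jump β x) * leftLim v x = 0 := by
    linear_combination -h₁ + r * jump α x * h₂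
  have hv2 := (mul_eq_zero.1 hv1).resolve_left hθ
  rw [hv2] at h₂
  exact ⟨hv2, by linear_combination -h₂⟩

theorem IsHomSol.eq_zero {I : Set ℝ} (hI : IsOpen I) (hIc : IsPreconnected I) {r : ℝ}
    (hr : r ∈ Icc (0 : ℝ) 1) {α β v w : ℝ → ℝ} (hα : LocallyBoundedVariationOn α I)
    (hβ : LocallyBoundedVariationOn β I)
    (hθ : ∀ x ∈ I, theta α β (1 - r) x ≠ 0 ∧ theta α β r x ≠ 0)
    (hv : IsHomSol I r α β v w) {s : ℝ} (hs : s ∈ I) (hv0 : rightLim v s = 0)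
    (hw0 : rightLim w s = 0) : ∀ x ∈ I, v x = 0 := by
  set Z : Set ℝ := {x | ∀ᶠ y in 𝓝 x, rightLim v y = 0 ∧ rightLim w y = 0} with hZ
  have hZ_of_right : ∀ x ∈ I, rightLim v x = 0 → rightLim w x = 0 → x ∈ Z := by
    intro x hx h₁ h₂
    obtain ⟨h₃, h₄⟩ := hv.leftLim_eq_zero_of_rightLim hI hα hβ hx (hθ x hx).2 h₁ h₂
    have hne : ∀ᶠ y in 𝓝[≠] x, rightLim v y = 0 ∧ rightLim w y = 0 := by
      rw [← Iio_union_Ioi, nhdsWithin_union]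
      exact eventually_sup.2
        ⟨hv.eventually_left hI hr hx h₃ h₄, hv.eventually_right hI hr hx h₁ h₂⟩
    rw [eventually_nhdsWithin_iff] at hne
    filter_upwards [hne] with y hy
    rcases eq_or_ne y x with rfl | hyx
    · exact ⟨h₁, h₂⟩
    · exact hy hyx
  have hZ_of_left : ∀ x ∈ I, leftLim v x = 0 → leftLim w x = 0 → x ∈ Z := by
    intro x hx h₁ h₂
    obtain ⟨h₃, h₄⟩ := hv.rightLim_eq_zero_of_leftLim hI hα hβ hx (hθ x hx).1 h₁ h₂
    exact hZ_of_right x hx h₃ h₄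
  have hlim : ∀ {F : Filter ℝ} {g : ℝ → ℝ} {l : ℝ}, Tendsto g F (𝓝 l) →
      (∃ᶠ y in F, g y = 0) → l = 0 := fun hg hF =>
    ((isClosed_singleton (x := (0 : ℝ))).mem_of_frequently_of_tendsto hF hg)
  have hclosed : closure Z ∩ I ⊆ Z := by
    rintro x ⟨hxZ, hx⟩
    rw [mem_closure_iff_frequently] at hxZ
    have hfreq : ∃ᶠ y in 𝓝 x, rightLim v y = 0 ∧ rightLim w y = 0 :=
      hxZ.mono fun y hy => hy.self_of_nhds
    have hsplit : 𝓝 x = 𝓝[<] x ⊔ 𝓝[≥] x := by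
      rw [← nhdsWithin_union, Iio_union_Ici, nhdsWithin_univ]
    rw [hsplit, frequently_sup] at hfreq
    rcases hfreq with hl | hr'
    · exact hZ_of_left x hx
        (hlim (hv.1.1.tendsto_rightLim_left hI hx) (hl.mono fun _ h => h.1))
        (hlim (hv.2.1.1.tendsto_rightLim_left hI hx) (hl.mono fun _ h => h.2))
    · exact hZ_of_right x hx
        (hlim (continuousWithinAt_rightLim_Ici (hv.1.1.tendsto_rightLim hI hx))
          (hr'.mono fun _ h => h.1))
        (hlim (continuousWithinAt_rightLim_Ici (hv.2.1.1.tendsto_rightLim hI hx))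
          (hr'.mono fun _ h => h.2))
  have hIZ : I ⊆ Z := hIc.subset_of_closure_inter_subset isOpen_setOfPred_eventually_nhds
    ⟨s, hs, hZ_of_right s hs hv0 hw0⟩ hclosed
  intro x hx
  exact hv.1.mem_of_rightLim_mem hI hr hI subset_rfl isClosed_singleton (convex_singleton 0)
    (fun t ht => (hIZ ht).self_of_nhds.1) hx

theorem MonotoneOn.negPart_Ioc_eq_zero {α : ℝ → ℝ} {l m y z : ℝ} (hα : MonotoneOn α (Icc l m))
    (hly : l < y) (hzm : z < m) {p n : Measure ℝ} [IsFiniteMeasure p]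
    [IsFiniteMeasure n] (hsing : p ⟂ₘ n)
    (hpn : ∀ a ∈ Icc y z, ∀ b ∈ Icc y z, a ≤ b →
      p.real (Ioc a b) - n.real (Ioc a b) = rightLim α b - rightLim α a) :
    n (Ioc y z) = 0 := by
  rcases le_or_gt z y with hzy | hyz
  · simp [hzy]
  have hlm : l ≤ m := by linarith
  obtain ⟨G, hG, hGα⟩ := hα.exists_monotone_extension
    ⟨α l, forall_mem_image.2 fun t ht => hα ⟨le_rfl, hlm⟩ ht ht.1⟩
    ⟨α m, forall_mem_image.2 fun t ht => hα ht ⟨hlm, le_rfl⟩ ht.2⟩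
  have hlim : ∀ t ∈ Icc y z, rightLim α t = rightLim G t := by
    intro t ht
    refine rightLim_eq_of_tendsto ((hG.tendsto_rightLim t).congr' ?_)
    filter_upwards [Ioo_mem_nhdsGT (ht.2.trans_lt hzm)] with x hx
    exact (hGα ⟨by linarith [ht.1, hx.1], hx.2.le⟩).symm
  set μ := hG.stieltjesFunction.measure
  have heq : p.restrict (Ioc y z) = n.restrict (Ioc y z) + μ.restrict (Ioc y z) := by
    refine Measure.ext_of_Ioc _ _ fun a b _ => ?_
    rw [Measure.add_apply, Measure.restrict_apply measurableSet_Ioc,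
      Measure.restrict_apply measurableSet_Ioc, Measure.restrict_apply measurableSet_Ioc,
      Ioc_inter_Ioc]
    rcases le_or_gt (b ⊓ z) (a ⊔ y) with hle | hlt
    · simp only [Ioc_eq_empty (not_lt.2 hle), measure_empty, add_zero]
    have ha : a ⊔ y ∈ Icc y z := ⟨le_sup_right, hlt.le.trans inf_le_right⟩
    have hb : b ⊓ z ∈ Icc y z := ⟨le_sup_right.trans hlt.le, inf_le_right⟩
    have h := hpn _ ha _ hb hlt.le
    rw [hlim _ ha, hlim _ hb] at h
    rw [StieltjesFunction.measure_Ioc, Monotone.stieltjesFunction_eq, Monotone.stieltjesFunction_eq,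
      ← h, ← ofReal_measureReal, ← ofReal_measureReal (μ := n),
      ← ENNReal.ofReal_add measureReal_nonneg (by rw [h]; exact sub_nonneg.2 (hG.rightLim hlt.le))]
    congr 1
    ring
  obtain ⟨T, hT, hpT, hnT⟩ := hsing
  have hle : n (T ∩ Ioc y z) ≤ p T := by
    have := congrArg (fun ρ : Measure ℝ => ρ T) heq
    simp only [Measure.add_apply, Measure.restrict_apply hT] at this
    calc n (T ∩ Ioc y z) ≤ p (T ∩ Ioc y z) := by rw [this]; exact le_self_add
      _ ≤ p T := measure_mono inter_subset_left
  refine measure_mono_null (t := T ∩ Ioc y z ∪ Tᶜ) (fun t ht => ?_)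
    (measure_union_null (le_zero_iff.1 (hpT ▸ hle)) hnT)
  by_cases htT : t ∈ T
  · exact Or.inl ⟨htT, ht⟩
  · exact Or.inr htT

theorem LocallyBoundedVariationOn.integrableOn_Icc {I : Set ℝ} {f : ℝ → ℝ}
    (hf : LocallyBoundedVariationOn f I) {c d : ℝ} (hcd : Icc c d ⊆ I) (μ : Measure ℝ)
    [IsFiniteMeasure μ] : IntegrableOn f (Icc c d) μ := by
  obtain ⟨p, q, hp, hq, rfl⟩ := hf.exists_monotoneOn_sub_monotoneOn
  exact ((hp.mono hcd).integrableOn_isCompact isCompact_Icc).sub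
    ((hq.mono hcd).integrableOn_isCompact isCompact_Icc)

theorem StrictMonoOn.rightLim_lt {α : ℝ → ℝ} {l m y z : ℝ} (hα : StrictMonoOn α (Ioo l m))
    (hly : l < y) (hyz : y < z) (hzm : z < m) : rightLim α y < rightLim α z := by
  have hbv := hα.monotoneOn.locallyBoundedVariationOn
  have hy := hbv.tendsto_rightLim isOpen_Ioo ⟨hly, hyz.trans hzm⟩
  have hz := hbv.tendsto_rightLim isOpen_Ioo ⟨hly.trans hyz, hzm⟩
  obtain ⟨a, hya, haz⟩ := exists_between hyz
  have ha : a ∈ Ioo l m := ⟨hly.trans hya, haz.trans hzm⟩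
  have h₁ : rightLim α y ≤ α a := by
    refine le_of_tendsto hy ?_
    filter_upwards [Ioo_mem_nhdsGT hya] with t ht
    exact (hα ⟨hly.trans ht.1, ht.2.trans ha.2⟩ ha ht.2).le
  have h₂ : α z ≤ rightLim α z := by
    refine ge_of_tendsto hz ?_
    filter_upwards [Ioo_mem_nhdsGT hzm] with t ht
    exact (hα ⟨hly.trans hyz, hzm⟩ ⟨(hly.trans hyz).trans ht.1, ht.2⟩ ht.1).le
  exact (h₁.trans_lt (hα ha ⟨hly.trans hyz, hzm⟩ haz)).trans_le h₂

theorem MeasureEqOn.rightLim_sub_pos {I : Set ℝ} {α g h : ℝ → ℝ}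
    (H : MeasureEqOn I g (fun _ : Fin 1 => h) (fun _ => α)) (hα : StrictMonoOn α I)
    (hh : LocallyBoundedVariationOn h I) {l m σ : ℝ} (hlm : Icc l m ⊆ I)
    (hpos : ∀ t ∈ Ioo l m, 0 < σ * h t) {y z : ℝ} (hly : l < y) (hyz : y < z) (hzm : z < m) :
    0 < σ * (rightLim g z - rightLim g y) := by
  have hsub : Icc y z ⊆ Ioo l m := fun t ht => ⟨hly.trans_le ht.1, ht.2.trans_lt hzm⟩
  have hsubI : Icc y z ⊆ I := (hsub.trans Ioo_subset_Icc_self).trans hlm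
  have hyI : y ∈ Icc y z := ⟨le_rfl, hyz.le⟩
  have hzI : z ∈ Icc y z := ⟨hyz.le, le_rfl⟩
  obtain ⟨p, n, _, _, hsing, hpn⟩ := H.exists_measure (hsubI hyI) (hsubI hzI) hyz
  have hn : n (Ioc y z) = 0 := (hα.monotoneOn.mono hlm).negPart_Ioc_eq_zero hly hzm hsing
    fun a ha b hb hab => (hpn a ha b hb hab).1
  obtain ⟨hp, hg⟩ := hpn y hyI z hzI hyz.le
  have hαlt := (hα.mono (Ioo_subset_Icc_self.trans hlm)).rightLim_lt hly hyz hzm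
  have hp0 : 0 < p (Ioc y z) := by
    rw [measureReal_def n, hn, ENNReal.toReal_zero, sub_zero] at hp
    rw [← ofReal_measureReal, ENNReal.ofReal_pos, hp]
    linarith
  rw [hg, setIntegral_measure_zero _ hn, sub_zero, ← integral_const_mul]
  have hposc : ∀ t ∈ Ioc y z, 0 < σ * h t := fun t ht => hpos t (hsub (Ioc_subset_Icc_self ht))
  rw [setIntegral_pos_iff_support_of_nonneg_ae]
  · refine hp0.trans_le (measure_mono fun t ht => ⟨(hposc t ht).ne', ht⟩)
  · filter_upwards [ae_restrict_mem measurableSet_Ioc] with t ht using (hposc t ht).le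
  · exact ((hh.integrableOn_Icc hsubI p).mono_set Ioc_subset_Icc_self).const_mul σ

theorem IsHomSol.eventually_pos_right {I : Set ℝ} (hI : IsOpen I) {r σ : ℝ} {α β v w : ℝ → ℝ}
    (hα : StrictMonoOn α I) (hv : IsHomSol I r α β v w) {s : ℝ} (hs : s ∈ I)
    (hv0 : rightLim v s = 0) (hw : 0 < σ * rightLim w s) :
    ∀ᶠ y in 𝓝[>] s, 0 < σ * rightLim v y := by
  obtain ⟨hvb, hwb, hvα, -⟩ := hv
  obtain ⟨c, d, hcs, hsd, hcd⟩ := hI.exists_Icc_subset hs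
  have hev : ∀ᶠ t in 𝓝[>] s, 0 < σ * w t :=
    ((hwb.1.tendsto_rightLim hI hs).const_mul σ).eventually (lt_mem_nhds hw)
  obtain ⟨m, ⟨hsm, hmd⟩, hsub⟩ := (mem_nhdsGT_iff_exists_mem_Ioc_Ioo_subset hsd).1 hev
  have hinc : ∀ y z, s < y → y < z → z < m → 0 < σ * (rightLim v z - rightLim v y) :=
    fun y z => hvα.rightLim_sub_pos hα hwb.1
      ((Icc_subset_Icc hcs.le hmd).trans hcd) fun t ht => hsub ht
  have hlim : Tendsto (fun t => σ * rightLim v t) (𝓝[>] s) (𝓝 0) := by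
    have := ((continuousWithinAt_rightLim_Ici (hvb.1.tendsto_rightLim hI hs)).mono
      Ioi_subset_Ici_self).tendsto.const_mul σ
    rwa [hv0, mul_zero] at this
  filter_upwards [Ioo_mem_nhdsGT hsm] with y hy
  obtain ⟨y', hsy', hy'y⟩ := exists_between hy.1
  have h₁ := hinc y' y hsy' hy'y hy.2
  have h₂ : 0 ≤ σ * rightLim v y' := by
    refine le_of_tendsto hlim ?_
    filter_upwards [Ioo_mem_nhdsGT hsy'] with t ht
    linarith [hinc t y' ht.1 ht.2 (hy'y.trans hy.2)]
  linarith

theorem IsHomSol.eventually_neg_left {I : Set ℝ} (hI : IsOpen I) {r σ : ℝ} {α β v w : ℝ → ℝ}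
    (hα : StrictMonoOn α I) (hv : IsHomSol I r α β v w) {s : ℝ} (hs : s ∈ I)
    (hv0 : leftLim v s = 0) (hw : 0 < σ * leftLim w s) :
    ∀ᶠ y in 𝓝[<] s, σ * leftLim v y < 0 := by
  obtain ⟨hvb, hwb, hvα, -⟩ := hv
  obtain ⟨c, d, hcs, hsd, hcd⟩ := hI.exists_Icc_subset hs
  have hev : ∀ᶠ t in 𝓝[<] s, 0 < σ * w t :=
    ((hwb.1.tendsto_leftLim hI hs).const_mul σ).eventually (lt_mem_nhds hw)
  obtain ⟨l, ⟨hcl, hls⟩, hsub⟩ := (mem_nhdsLT_iff_exists_mem_Ico_Ioo_subset hcs).1 hev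
  have hls_sub : Icc l s ⊆ I := (Icc_subset_Icc hcl hsd.le).trans hcd
  have hinc : ∀ y z, l < y → y < z → z < s → 0 < σ * (rightLim v z - rightLim v y) :=
    fun y z => hvα.rightLim_sub_pos hα hwb.1 hls_sub fun t ht => hsub ht
  have hlim : Tendsto (fun t => σ * rightLim v t) (𝓝[<] s) (𝓝 0) := by
    have := (hvb.1.tendsto_rightLim_left hI hs).const_mul σ
    rwa [hv0, mul_zero] at this
  filter_upwards [Ioo_mem_nhdsLT hls] with y hy
  obtain ⟨y₁, hyy₁, hy₁s⟩ := exists_between hy.2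
  obtain ⟨y₂, hy₁₂, hy₂s⟩ := exists_between hy₁s
  have h₁ : σ * leftLim v y ≤ σ * rightLim v y₁ := by
    refine le_of_tendsto ((hvb.1.tendsto_rightLim_left hI
      (hls_sub ⟨hy.1.le, hy.2.le⟩)).const_mul σ) ?_
    filter_upwards [Ioo_mem_nhdsLT hy.1] with t ht
    linarith [hinc t y₁ ht.1 (ht.2.trans hyy₁) hy₁s]
  have h₂ := hinc y₁ y₂ (hy.1.trans hyy₁) hy₁₂ hy₂s
  have h₃ : σ * rightLim v y₂ ≤ 0 := by
    refine ge_of_tendsto hlim ?_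
    filter_upwards [Ioo_mem_nhdsLT hy₂s] with t ht
    linarith [hinc y₂ t (hy.1.trans (hyy₁.trans hy₁₂)) ht.1 ht.2]
  linarith

theorem changesSignAt_of_eventually {I : Set ℝ} (hI : IsOpen I) {v : ℝ → ℝ} {s : ℝ} (hs : s ∈ I)
    {k : ℝ} (hleft : ∀ᶠ y in 𝓝[<] s, k * leftLim v y < 0)
    (hright : ∀ᶠ y in 𝓝[>] s, 0 < k * rightLim v y) : ChangesSignAt I v s := by
  have hk : k ≠ 0 := by
    rintro rfl
    simpa using hright.exists
  have h : ∀ᶠ y in 𝓝 s, y ∈ I ∧ (y < s → k * leftLim v y < 0) ∧ (s < y → 0 < k * rightLim v y) :=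
    (hI.eventually_mem hs).and
      ((eventually_nhdsWithin_iff.1 hleft).and (eventually_nhdsWithin_iff.1 hright))
  obtain ⟨δ, hδ, hball⟩ := Metric.mem_nhds_iff.1 h
  rw [Real.ball_eq_Ioo] at hball
  have hl : ∀ x ∈ Ioo (s - δ) s, k * leftLim v x < 0 := fun x hx =>
    (hball ⟨hx.1, by linarith [hx.2]⟩).2.1 hx.2
  have hr : ∀ x ∈ Ioo s (s + δ), 0 < k * rightLim v x := fun x hx =>
    (hball ⟨by linarith [hx.1], hx.2⟩).2.2 hx.1
  refine ⟨δ, hδ, fun x hx => (hball hx).1, ?_⟩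
  rcases hk.lt_or_gt with hk | hk
  · exact Or.inr ⟨fun x hx => (neg_iff_pos_of_mul_neg (hl x hx)).1 hk,
      fun x hx => (neg_iff_neg_of_mul_pos (hr x hx)).1 hk⟩
  · exact Or.inl ⟨fun x hx => (pos_iff_neg_of_mul_neg (hl x hx)).1 hk,
      fun x hx => (pos_iff_pos_of_mul_pos (hr x hx)).1 hk⟩

theorem StrictMonoOn.leftLim_le_rightLim {I : Set ℝ} (hI : IsOpen I) {α : ℝ → ℝ}
    (hα : StrictMonoOn α I) {s : ℝ} (hs : s ∈ I) : leftLim α s ≤ rightLim α s := by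
  have hbv := hα.monotoneOn.locallyBoundedVariationOn
  have hmem : ∀ᶠ t in 𝓝 s, t ∈ I := hI.eventually_mem hs
  calc leftLim α s ≤ α s := by
        refine le_of_tendsto (hbv.tendsto_leftLim hI hs) ?_
        filter_upwards [self_mem_nhdsWithin, hmem.filter_mono nhdsWithin_le_nhds] with t ht hI
        exact (hα hI hs ht).le
    _ ≤ rightLim α s := by
        refine ge_of_tendsto (hbv.tendsto_rightLim hI hs) ?_
        filter_upwards [self_mem_nhdsWithin, hmem.filter_mono nhdsWithin_le_nhds] with t ht hI
        exact (hα hs hI ht).le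

/-- Lemma 5.4: if `u⁻(s) u⁺(s) < 0` and `v` does not change sign at `s`,
then `v(s) (du/dα)(s) W[u,v](s) < 0`. -/
theorem statement14 (a b : EReal) (hab : a < b) (r : ℝ) (hr : r ∈ Icc (0 : ℝ) 1)
    (α β : ℝ → ℝ) (hα : StrictMonoOn α (EI a b))
    (hβ : LocallyBoundedVariationOn β (EI a b))
    (hθ : ∀ x ∈ EI a b, theta α β (1 - r) x ≠ 0 ∧ theta α β r x ≠ 0)
    (u wu v wv : ℝ → ℝ)
    (hu : IsHomSol (EI a b) r α β u wu) (hv : IsHomSol (EI a b) r α β v wv)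
    (hind : ¬ LinDepOn (EI a b) u v)
    (s : ℝ) (hs : s ∈ EI a b)
    (hujump : leftLim u s * rightLim u s < 0)
    (hnosign : ¬ ChangesSignAt (EI a b) v s) :
    v s * wu s * (u s * wv s - v s * wu s) < 0 := by
  have hI := isOpen_EI a b
  have hIc := (ordConnected_EI a b).isPreconnected
  have hαb := hα.monotoneOn.locallyBoundedVariationOn
  obtain ⟨hub, -, huα, -⟩ := hu
  obtain ⟨hvb, hwb, hvα, hwβ⟩ := id hv
  have hju : rightLim u s - leftLim u s = wu s * jump α s := huα.jump_eq hI hαb hub.1 hs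
  have hjv : rightLim v s - leftLim v s = wv s * jump α s := hvα.jump_eq hI hαb hvb.1 hs
  have hjw : rightLim wv s - leftLim wv s = v s * jump β s := hwβ.jump_eq hI hβ hwb.1 hs
  have hA : 0 < jump α s := by
    refine (sub_nonneg.2 (hα.leftLim_le_rightLim hI hs)).lt_of_ne' fun h0 => ?_
    rw [show jump α s = 0 from h0, mul_zero, sub_eq_zero] at hju
    rw [hju] at hujump
    exact hujump.not_ge (mul_self_nonneg _)
  have hvlim_left : Tendsto (leftLim v) (𝓝[<] s) (𝓝 (leftLim v s)) :=
    (continuousWithinAt_leftLim_Iic (hvb.1.tendsto_leftLim hI hs)).mono Iio_subset_Iic_self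
  have hvlim_right : Tendsto (rightLim v) (𝓝[>] s) (𝓝 (rightLim v s)) :=
    (continuousWithinAt_rightLim_Ici (hvb.1.tendsto_rightLim hI hs)).mono Ioi_subset_Ici_self
  have hus := hub.2 s hs
  have hvs := hvb.2 s hs
  have hws := hwb.2 s hs
  suffices key : 0 < (r * leftLim v s + (1 - r) * rightLim v s) *
      ((leftLim u s ^ 2 - leftLim u s * rightLim u s) * rightLim v s +
        (rightLim u s ^ 2 - leftLim u s * rightLim u s) * leftLim v s) by
    have hE : v s * wu s * (u s * wv s - v s * wu s) * jump α s ^ 2 =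
        v s * (wu s * jump α s) * (u s * (wv s * jump α s) - v s * (wu s * jump α s)) := by ring
    rw [← hju, ← hjv, hus, hvs] at hE
    refine neg_of_mul_neg_left (b := jump α s ^ 2) ?_ (sq_nonneg _)
    rw [hus, hvs, hE]
    linear_combination key
  have hk₁ : 0 < leftLim u s ^ 2 - leftLim u s * rightLim u s := by
    nlinarith [sq_nonneg (leftLim u s)]
  have hk₂ : 0 < rightLim u s ^ 2 - leftLim u s * rightLim u s := by
    nlinarith [sq_nonneg (rightLim u s)]
  set k₁ := leftLim u s ^ 2 - leftLim u s * rightLim u s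
  set k₂ := rightLim u s ^ 2 - leftLim u s * rightLim u s
  have hr₀ := hr.1
  have hr₁ := sub_nonneg.2 hr.2
  by_cases hl : leftLim v s = 0 <;> by_cases hrt : rightLim v s = 0
  · rw [hl, hrt] at hvs hjv
    have hwv : wv s = 0 := by
      rcases mul_eq_zero.1 (hjv.symm.trans (sub_zero 0)) with h | h
      · exact h
      · exact absurd h hA.ne'
    rw [hvs] at hjw
    have hw0 : rightLim wv s = 0 := by linear_combination hwv - hws + r * hjw
    refine absurd ⟨0, 1, by simp, fun x hx => ?_⟩ hind
    rw [hv.eq_zero hI hIc hr hαb hβ hθ hs hrt hw0 x hx]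
    ring
  · have hsq := pow_pos (abs_pos.2 hrt) 2
    rw [sq_abs] at hsq
    rcases hr₁.eq_or_lt with h1 | h1
    · refine absurd (changesSignAt_of_eventually hI hs (k := rightLim v s)
        (hv.eventually_neg_left hI hα hs hl ?_) ?_) hnosign
      · have hw : wv s = leftLim wv s := by
          rw [hws]; linear_combination (leftLim wv s - rightLim wv s) * h1
        rw [hl, hw] at hjv
        refine pos_of_mul_pos_left (b := jump α s) ?_ hA.le
        rw [mul_assoc, ← hjv]
        linarith
      · exact (hvlim_right.const_mul _).eventually (lt_mem_nhds (by linarith))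
    · have := mul_pos (mul_pos h1 hk₁) hsq
      rw [hl]
      linarith
  · have hsq := pow_pos (abs_pos.2 hl) 2
    rw [sq_abs] at hsq
    rcases hr₀.eq_or_lt with h0 | h0
    · refine absurd (changesSignAt_of_eventually hI hs (k := -leftLim v s) ?_
        (hv.eventually_pos_right hI hα hs hrt ?_)) hnosign
      · exact (hvlim_left.const_mul _).eventually (gt_mem_nhds (by linarith))
      · have hw : wv s = rightLim wv s := by
          rw [hws]; linear_combination (rightLim wv s - leftLim wv s) * h0
        rw [hrt, hw] at hjv
        refine pos_of_mul_pos_left (b := jump α s) ?_ hA.le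
        rw [mul_assoc, ← hjv]
        linarith
    · have := mul_pos (mul_pos h0 hk₂) hsq
      rw [hrt]
      linarith
  · rcases (mul_ne_zero hl hrt).lt_or_gt with h | h
    · refine absurd (changesSignAt_of_eventually hI hs (k := rightLim v s) ?_ ?_) hnosign
      · exact (hvlim_left.const_mul _).eventually (gt_mem_nhds (by linarith))
      · exact (hvlim_right.const_mul _).eventually (lt_mem_nhds (mul_self_pos.2 hrt))
    · have h₁ : 0 < k₁ * rightLim v s ^ 2 + k₂ * (leftLim v s * rightLim v s) := by positivity
      have h₂ : 0 < k₂ * leftLim v s ^ 2 + k₁ * (leftLim v s * rightLim v s) := by positivity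
      have hconv : 0 < (1 - r) * (k₁ * rightLim v s ^ 2 + k₂ * (leftLim v s * rightLim v s)) +
          r * (k₂ * leftLim v s ^ 2 + k₁ * (leftLim v s * rightLim v s)) := by
        rcases hr₀.eq_or_lt with h0 | h0
        · rw [← h0]; linarith
        · exact add_pos_of_nonneg_of_pos (mul_nonneg hr₁ h₁.le) (mul_pos h0 h₂)
      linarith
end
end
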